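/- Let γ, η be Jordan curves in ℝ² of Lebesgue measure zero that intersect at exactly 2 points, admitting solutions Γ, H to the curvature flow problem with stopping time S; write cf(γ,t) = Γ(S¹,t), cf(η,t) = H(S¹,t) for t ∈ (0,S) and cf(γ,0) = γ, cf(η,0) = η. Let x be one of the two points of γ ∩ η, and suppose T* ∈ (0,S] is such that for every t ∈ [0,T*) the set cf(γ,t) ∩ cf(η,t) has exactly two points (i.e., the two intersection points have not yet merged). Then there is a unique continuous trajectory p : [0,T*) → ℝ² such that p(0) = x and p(t) ∈ cf(γ,t) ∩ cf(η,t) for all t ∈ [0,T*). -/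

import Mathlib

open Set Filter Metric Real MeasureTheory

noncomputable section

/-- The Euclidean plane. -/
abbrev E2 := EuclideanSpace ℝ (Fin 2)

/-- `φ` is a parametrization of the curve `γ`: a continuous injective map from the unit
circle onto `γ` (such a map is automatically a homeomorphism onto its image). -/
def IsParam (γ : Set E2) (φ : Circle → E2) : Prop :=
  Continuous φ ∧ Function.Injective φ ∧ Set.range φ = γ

/-- A Jordan curve in the plane: the image of a continuous injective map from the
unit circle. -/
def IsJordanCurve (γ : Set E2) : Prop :=
  ∃ φ : Circle → E2, IsParam γ φ

/-- The Fréchet distance between two Jordan curves. -/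
noncomputable def frechetDist (γ₁ γ₂ : Set E2) : ℝ :=
  sInf { d : ℝ | ∃ φ₁ φ₂ : Circle → E2, IsParam γ₁ φ₁ ∧ IsParam γ₂ φ₂ ∧
    d = ⨆ x : Circle, ‖φ₁ x - φ₂ x‖ }

/-- The curvature vector of a curve `c` parametrized by angle, at parameter `x`:
`kn = (1/‖c'‖) ∂ₓ(c'/‖c'‖)`. -/
noncomputable def curvatureVector (c : ℝ → E2) (x : ℝ) : E2 :=
  ‖deriv c x‖⁻¹ • deriv (fun y => ‖deriv c y‖⁻¹ • deriv c y) x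

/-- A solution to the curvature flow problem with initial curve `γ₀` and stopping time `T`:
a smooth map `Γ : S¹ × (0,T) → ℝ²` (with `S¹` parametrized by angle, i.e. `Γ` is `2π`-periodic
in the space variable), injective on `S¹` with nonvanishing space derivative for each fixed
time, satisfying `∂ₜΓ = kn` and converging to `γ₀` in Fréchet distance as `t → 0⁺`. -/
structure CurvatureFlowSolution (γ₀ : Set E2) (T : ℝ) where
  Γ : ℝ → ℝ → E2
  periodic : ∀ t, Function.Periodic (fun x => Γ x t) (2 * π)
  smooth : ContDiffOn ℝ (⊤ : ℕ∞) (fun p : ℝ × ℝ => Γ p.1 p.2) (univ ×ˢ Ioo 0 T)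
  inj : ∀ t ∈ Ioo 0 T, ∀ x ∈ Ico 0 (2 * π), ∀ y ∈ Ico 0 (2 * π), Γ x t = Γ y t → x = y
  deriv_ne : ∀ t ∈ Ioo 0 T, ∀ x : ℝ, deriv (fun y => Γ y t) x ≠ 0
  flow : ∀ t ∈ Ioo 0 T, ∀ x : ℝ,
    deriv (fun s => Γ x s) t = curvatureVector (fun y => Γ y t) x
  init : Tendsto (fun t => frechetDist (Set.range (fun x => Γ x t)) γ₀)
    (nhdsWithin 0 (Ioi 0)) (nhds 0)

/-- The evolved curve at time `t` (by convention, the initial curve at `t = 0`). -/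
noncomputable def CurvatureFlowSolution.cf {γ₀ : Set E2} {T : ℝ}
    (sol : CurvatureFlowSolution γ₀ T) (t : ℝ) : Set E2 :=
  if t = 0 then γ₀ else Set.range (fun x => sol.Γ x t)

/-- A set consisting of exactly two points. -/
def HasTwoPoints (s : Set E2) : Prop := ∃ a b : E2, a ≠ b ∧ s = {a, b}

namespace PlaneCurve
open scoped ComplexConjugate Topology

/-- A simple closed regular plane curve of class `C²`, parametrized by angle. -/
structure IsSimpleClosed (c : ℝ → ℂ) : Prop where
  smooth : ContDiff ℝ 2 c
  per : Function.Periodic c (2 * π)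
  reg : ∀ x, deriv c x ≠ 0
  inj : ∀ x y, |x - y| < 2 * π → c x = c y → x = y

namespace IsSimpleClosed
variable {c : ℝ → ℂ} (hc : IsSimpleClosed c)
include hc

lemma cont : Continuous c := hc.smooth.continuous

lemma hasDerivAt (x : ℝ) : HasDerivAt c (deriv c x) x :=
  ((hc.smooth.differentiable (by norm_num)) x).hasDerivAt

lemma contDiff_deriv : ContDiff ℝ 1 (deriv c) := by
  have h : ContDiff ℝ (1 + 1) c := by
    have := hc.smooth
    norm_num
    exact this
  exact (contDiff_succ_iff_deriv.1 h).2.2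

lemma cont_deriv : Continuous (deriv c) := hc.contDiff_deriv.continuous

lemma hasDerivAt_deriv (x : ℝ) : HasDerivAt (deriv c) (deriv (deriv c) x) x :=
  ((hc.contDiff_deriv.differentiable (by norm_num)) x).hasDerivAt

lemma cont_deriv_deriv : Continuous (deriv (deriv c)) :=
  hc.contDiff_deriv.continuous_deriv le_rfl

lemma per_deriv : Function.Periodic (deriv c) (2 * π) := by
  intro x
  have h : (fun y => c (y + 2 * π)) = c := funext hc.per
  rw [← deriv_comp_add_const c (2 * π) x, h]

lemma per_deriv_deriv : Function.Periodic (deriv (deriv c)) (2 * π) := by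
  intro x
  have h : (fun y => deriv c (y + 2 * π)) = deriv c := funext hc.per_deriv
  rw [← deriv_comp_add_const (deriv c) (2 * π) x, h]

end IsSimpleClosed

lemma exists_bound_of_periodic {f : ℝ → ℂ} (hf : Continuous f)
    (hp : Function.Periodic f (2 * π)) : ∃ M, 0 < M ∧ ∀ x, ‖f x‖ ≤ M := by
  obtain ⟨M, hM⟩ := isCompact_Icc (a := (0 : ℝ)) (b := 2 * π) |>.exists_bound_of_continuousOn
    hf.continuousOn
  refine ⟨max M 1, by positivity, fun x => ?_⟩
  obtain ⟨y, hy, hxy⟩ := hp.exists_mem_Ico₀ (by positivity) x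
  rw [hxy]
  exact (hM y ⟨hy.1, hy.2.le⟩).trans (le_max_left _ _)

/-- The difference quotient `(c (x + h) - c x) / h`, extended to `h = 0`. -/
def slopeFun (c : ℝ → ℂ) (p : ℝ × ℝ) : ℂ := ∫ r in (0 : ℝ)..1, deriv c (p.1 + r * p.2)

namespace IsSimpleClosed
variable {c : ℝ → ℂ} (hc : IsSimpleClosed c)
include hc

lemma continuous_slopeFun : Continuous (slopeFun c) := by
  unfold slopeFun
  apply intervalIntegral.continuous_parametric_intervalIntegral_of_continuous'
  have := hc.cont_deriv
  fun_prop

omit hc in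
lemma slopeFun_zero (x : ℝ) : slopeFun c (x, 0) = deriv c x := by
  simp [slopeFun]

lemma mul_slopeFun (x h : ℝ) : (h : ℂ) * slopeFun c (x, h) = c (x + h) - c x := by
  have h1 : ∀ r ∈ uIcc (0 : ℝ) 1, HasDerivAt (fun r : ℝ => c (x + r * h))
      (h • deriv c (x + r * h)) r := by
    intro r _
    have h2 : HasDerivAt (fun r : ℝ => x + r * h) h r := by
      simpa using ((hasDerivAt_id r).mul_const h).const_add x
    exact (hc.hasDerivAt (x + r * h)).scomp r h2
  have h3 := intervalIntegral.integral_eq_sub_of_hasDerivAt h1 (by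
    apply Continuous.intervalIntegrable
    have := hc.cont_deriv
    fun_prop)
  simp only [one_mul, zero_mul, add_zero] at h3
  rw [← h3, intervalIntegral.integral_smul]
  simp [slopeFun]

lemma slopeFun_eq {x h : ℝ} (hh : h ≠ 0) : slopeFun c (x, h) = (c (x + h) - c x) / h := by
  rw [← hc.mul_slopeFun, mul_div_cancel_left₀ _ (by exact_mod_cast hh)]

lemma slopeFun_ne_zero {x h : ℝ} (hh : |h| < 2 * π) : slopeFun c (x, h) ≠ 0 := by
  by_cases h0 : h = 0
  · rw [h0, slopeFun_zero]; exact hc.reg x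
  · intro h1
    have h2 := hc.mul_slopeFun x h
    rw [h1, mul_zero, eq_comm, sub_eq_zero] at h2
    have := hc.inj (x + h) x (by simpa using hh) h2
    exact h0 (by linarith)

/-- Chord-arc lower bound. -/
lemma exists_chord : ∃ κ, 0 < κ ∧ ∀ x y, |y - x| ≤ π → κ * |y - x| ≤ ‖c y - c x‖ := by
  have hK : IsCompact (Icc 0 (2 * π) ×ˢ Icc (-π) π) := isCompact_Icc.prod isCompact_Icc
  have hne : (Icc 0 (2 * π) ×ˢ Icc (-π) π).Nonempty :=
    ⟨(0, 0), ⟨le_rfl, by positivity⟩, by constructor <;> linarith [pi_pos]⟩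
  obtain ⟨p, hp, hmin⟩ := hK.exists_isMinOn hne hc.continuous_slopeFun.norm.continuousOn
  have hpos : 0 < ‖slopeFun c p‖ := by
    rw [norm_pos_iff]
    apply hc.slopeFun_ne_zero
    have := abs_le.2 hp.2
    linarith [pi_pos]
  refine ⟨_, hpos, fun x y hxy => ?_⟩
  obtain ⟨n, hn⟩ : ∃ n : ℤ, x - n * (2 * π) ∈ Icc 0 (2 * π) := by
    refine ⟨⌊x / (2 * π)⌋, ?_, ?_⟩
    · have := Int.floor_le (x / (2 * π))
      have := (le_div_iff₀ (by positivity)).1 this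
      linarith
    · have := (Int.lt_floor_add_one (x / (2 * π))).le
      have := (div_le_iff₀ (by positivity)).1 this
      linarith
  have h1 := hc.mul_slopeFun (x - n * (2 * π)) (y - x)
  have e1 : x - n * (2 * π) + (y - x) = y - n * (2 * π) := by ring
  rw [e1, hc.per.sub_int_mul_eq, hc.per.sub_int_mul_eq] at h1
  rw [← h1, norm_mul, mul_comm, Complex.norm_real, Real.norm_eq_abs]
  gcongr
  exact hmin (a := (x - n * (2 * π), y - x)) ⟨hn, abs_le.1 hxy⟩

/-- First order Taylor estimate. -/
lemma exists_taylor : ∃ C, 0 < C ∧ ∀ x y, ‖c y - c x - (y - x) * deriv c y‖ ≤ C * |y - x| ^ 2 := by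
  obtain ⟨M, hM, hb⟩ := exists_bound_of_periodic hc.cont_deriv_deriv hc.per_deriv_deriv
  refine ⟨M, hM, fun x y => ?_⟩
  have hlip : ∀ a b : ℝ, ‖deriv c b - deriv c a‖ ≤ M * |b - a| := fun a b =>
    Convex.norm_image_sub_le_of_norm_hasDerivWithin_le
      (fun z _ => (hc.hasDerivAt_deriv z).hasDerivWithinAt) (fun z _ => hb z) convex_univ
      (mem_univ a) (mem_univ b)
  have h1 : ‖(c y - y • deriv c y) - (c x - x • deriv c y)‖ ≤ (M * |y - x|) * |y - x| := by
    refine Convex.norm_image_sub_le_of_norm_hasDerivWithin_le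
      (f := fun z : ℝ => c z - z • deriv c y) (f' := fun z => deriv c z - deriv c y)
      (s := uIcc x y) (fun z _ => ?_) (fun z hz => ?_)
      (convex_uIcc x y) left_mem_uIcc right_mem_uIcc
    · have := (hc.hasDerivAt z).sub ((hasDerivAt_id z).smul_const (deriv c y))
      rw [one_smul] at this
      exact this.hasDerivWithinAt
    · refine (hlip y z).trans ?_
      have := Set.abs_sub_right_of_mem_uIcc hz
      rw [abs_sub_comm z y]
      exact mul_le_mul_of_nonneg_left this hM.le
  have e : c y - c x - (y - x) * deriv c y = (c y - y • deriv c y) - (c x - x • deriv c y) := by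
    simp only [Complex.real_smul]; ring
  rw [e]
  calc _ ≤ _ := h1
    _ = _ := by ring

end IsSimpleClosed

/-- A continuous logarithm of a nonvanishing function on `ℝ × ℝ`. -/
lemma exists_continuous_log {F : ℝ × ℝ → ℂ} (hF : Continuous F) (h0 : ∀ p, F p ≠ 0) :
    ∃ L : ℝ × ℝ → ℂ, Continuous L ∧ ∀ p, Complex.exp (L p) = F p := by
  have hs : IsSimplyConnected (univ : Set (ℝ × ℝ)) := by
    have := (convex_univ (𝕜 := ℝ) (E := ℝ × ℝ)).contractibleSpace univ_nonempty
    exact (inferInstance : SimplyConnectedSpace (univ : Set (ℝ × ℝ)))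
  obtain ⟨L, hL, hE⟩ := Complex.exists_continuousOn_eqOn_exp_comp hs isOpen_univ hF.continuousOn
    (by rintro ⟨p, -, hp⟩; exact h0 p hp)
  exact ⟨L, continuousOn_univ.1 hL, fun p => hE (mem_univ p)⟩

lemma hasDerivAt_of_exp {L F : ℝ → ℂ} {F' : ℂ} {t : ℝ} (hL : ContinuousAt L t)
    (hE : ∀ᶠ s in 𝓝 t, Complex.exp (L s) = F s) (hF : HasDerivAt F F' t) :
    HasDerivAt L (F' / F t) t := by
  have ht := hE.self_of_nhds
  have hne : F t ≠ 0 := ht ▸ Complex.exp_ne_zero _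
  have h1 : ∀ᶠ s in 𝓝 t, L s = Complex.log (F s / F t) + L t := by
    have h2 : ∀ᶠ s in 𝓝 t, |(L s - L t).im| < π := by
      have : ContinuousAt (fun s => |(L s - L t).im|) t := by
        exact (Complex.continuous_im.continuousAt.comp (hL.sub continuousAt_const)).abs
      exact this.eventually_lt continuousAt_const (by simpa using pi_pos)
    filter_upwards [h2, hE] with s hs hs2
    rw [← hs2, ← ht, ← Complex.exp_sub, Complex.log_exp (abs_lt.1 hs).1 (abs_lt.1 hs).2.le]
    ring
  have h3 : HasDerivAt (fun s => Complex.log (F s / F t) + L t) (F' / F t / (F t / F t)) t := by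
    have := (hF.div_const (F t)).clog_real (by simp [hne])
    exact this.add_const _
  rw [div_self hne, div_one] at h3
  exact h3.congr_of_eventuallyEq h1

/-- The (regularized) angular velocity of the curve `c` seen from the point `z`. -/
def kern (c : ℝ → ℂ) (ε : ℝ) (z : ℂ) (x : ℝ) : ℝ :=
  (conj (c x - z) * deriv c x).im / (Complex.normSq (c x - z) + ε ^ 2)

/-- The (regularized) winding number of `c` around `z`. For `ε = 0` and `z` on the curve, this is
the mean of the values on both sides. -/
def pot (c : ℝ → ℂ) (ε : ℝ) (z : ℂ) : ℝ := (2 * π)⁻¹ * ∫ x in 0..2 * π, kern c ε z x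

lemma abs_kern_le (c : ℝ → ℂ) (ε : ℝ) (z : ℂ) (x : ℝ) : |kern c ε z x| ≤ |kern c 0 z x| := by
  unfold kern
  rw [abs_div, abs_div]
  by_cases h : c x - z = 0
  · simp [h]
  · have h1 : 0 < Complex.normSq (c x - z) := Complex.normSq_pos.2 h
    have h2 : 0 ≤ ε ^ 2 := sq_nonneg ε
    rw [abs_of_pos (a := Complex.normSq (c x - z) + ε ^ 2) (by linarith),
      abs_of_pos (a := Complex.normSq (c x - z) + 0 ^ 2) (by linarith)]
    apply div_le_div_of_nonneg_left (abs_nonneg _) <;> linarith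

lemma tendsto_kern (c : ℝ → ℂ) (z : ℂ) (x : ℝ) :
    Tendsto (fun ε => kern c ε z x) (𝓝[>] 0) (𝓝 (kern c 0 z x)) := by
  by_cases h : c x - z = 0
  · simp [kern, h]
  · have h1 : 0 < Complex.normSq (c x - z) := Complex.normSq_pos.2 h
    have : ContinuousAt (fun ε => kern c ε z x) 0 := by
      unfold kern
      apply ContinuousAt.div continuousAt_const (by fun_prop)
      simpa using h
    exact this.tendsto.mono_left nhdsWithin_le_nhds

lemma integral_div_sq_le {d l x₀ : ℝ} (hd : 0 ≤ d) (hl : 0 < l) :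
    IntervalIntegrable (fun x => d / (d ^ 2 + l ^ 2 * (x - x₀) ^ 2)) volume (x₀ - π) (x₀ + π) ∧
    ∫ x in (x₀ - π)..(x₀ + π), d / (d ^ 2 + l ^ 2 * (x - x₀) ^ 2) ≤ π / l := by
  rcases hd.eq_or_lt with rfl | hd
  · simp only [zero_div]
    simp
    positivity
  · have hInt : IntervalIntegrable (fun x => d / (d ^ 2 + l ^ 2 * (x - x₀) ^ 2)) volume
        (x₀ - π) (x₀ + π) := by
      apply Continuous.intervalIntegrable
      apply Continuous.div (by fun_prop) (by fun_prop)
      intro x; positivity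
    refine ⟨hInt, ?_⟩
    have hder : ∀ x ∈ uIcc (x₀ - π) (x₀ + π),
        HasDerivAt (fun x => Real.arctan (l * (x - x₀) / d) / l)
        (d / (d ^ 2 + l ^ 2 * (x - x₀) ^ 2)) x := by
      intro x _
      have h1 : HasDerivAt (fun x => l * (x - x₀) / d) (l / d) x := by
        simpa using (((hasDerivAt_id x).sub_const x₀).const_mul l).div_const d
      have h2 := h1.arctan.div_const l
      convert! h2 using 1
      field_simp
    rw [intervalIntegral.integral_eq_sub_of_hasDerivAt hder hInt, ← sub_div]
    gcongr
    have := Real.arctan_lt_pi_div_two (l * (x₀ + π - x₀) / d)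
    have := Real.neg_pi_div_two_lt_arctan (l * (x₀ - π - x₀) / d)
    linarith

namespace IsSimpleClosed
variable {c : ℝ → ℂ} (hc : IsSimpleClosed c)
include hc

lemma kern_periodic (ε : ℝ) (z : ℂ) : Function.Periodic (kern c ε z) (2 * π) := by
  intro x
  simp only [kern, hc.per x, hc.per_deriv x]

lemma continuous_kern {ε : ℝ} (hε : ε ≠ 0) :
    Continuous (fun p : ℂ × ℝ => kern c ε p.1 p.2) := by
  have h1 := hc.cont
  have h2 := hc.cont_deriv
  have := Complex.continuous_normSq
  unfold kern
  apply Continuous.div (by fun_prop) (by fun_prop)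
  intro p
  have := Complex.normSq_nonneg (c p.2 - p.1)
  positivity

lemma measurable_kern_right (ε : ℝ) (z : ℂ) : Measurable (kern c ε z) := by
  have h1 := hc.cont.measurable
  have h2 := hc.cont_deriv.measurable
  have h3 := Complex.continuous_normSq.measurable
  have h4 := Complex.continuous_conj.measurable
  unfold kern
  exact (Complex.measurable_im.comp ((h4.comp (h1.sub_const z)).mul h2)).div
    ((h3.comp (h1.sub_const z)).add_const _)

/-- Pointwise bound of the angular velocity in terms of a nearest point. -/
lemma exists_kern_bound : ∃ A M l, 0 ≤ A ∧ 0 ≤ M ∧ 0 < l ∧ ∀ z : ℂ, ∃ x₀, ∀ x, |x - x₀| ≤ π →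
    |kern c 0 z x| ≤ A + M * (‖c x₀ - z‖ / (‖c x₀ - z‖ ^ 2 + l ^ 2 * (x - x₀) ^ 2)) := by
  obtain ⟨κ, hκ, hchord⟩ := hc.exists_chord
  obtain ⟨C, hC, htay⟩ := hc.exists_taylor
  obtain ⟨M, hM, hb⟩ := exists_bound_of_periodic hc.cont_deriv hc.per_deriv
  refine ⟨4 * C * M / κ ^ 2, 2 * M, κ / 2, by positivity, by positivity, by positivity,
    fun z => ?_⟩
  obtain ⟨x₀, -, hx₀⟩ : ∃ x₀ ∈ Icc 0 (2 * π), ∀ x, ‖c x₀ - z‖ ≤ ‖c x - z‖ := by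
    obtain ⟨x₀, hx, hmin⟩ := (isCompact_Icc (a := (0 : ℝ)) (b := 2 * π)).exists_isMinOn
      ⟨0, le_rfl, by positivity⟩ (f := fun x => ‖c x - z‖)
      ((hc.cont.sub continuous_const).norm.continuousOn)
    refine ⟨x₀, hx, fun x => ?_⟩
    obtain ⟨y, hy, hxy⟩ := hc.per.exists_mem_Ico₀ (by positivity) x
    rw [hxy]
    exact hmin (Ico_subset_Icc_self hy)
  refine ⟨x₀, fun x hx => ?_⟩
  set d := ‖c x₀ - z‖ with hd
  set N := ‖c x - z‖ with hN
  have hdN : d ≤ N := hx₀ x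
  have hd0 : 0 ≤ d := norm_nonneg _
  have hchord' : κ * |x - x₀| ≤ 2 * N := by
    calc κ * |x - x₀| ≤ ‖c x - c x₀‖ := hchord x₀ x hx
      _ = ‖(c x - z) - (c x₀ - z)‖ := by congr 1; ring
      _ ≤ N + d := norm_sub_le _ _
      _ ≤ 2 * N := by linarith
  have hnum : |(conj (c x - z) * deriv c x).im| ≤ C * M * (x - x₀) ^ 2 + d * M := by
    have e : (conj (c x - z) * deriv c x).im =
        (conj (c x - c x₀ - (x - x₀) * deriv c x) * deriv c x).im +
        (conj (c x₀ - z) * deriv c x).im := by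
      have h1 : ((x : ℂ) - x₀) * conj (deriv c x) * deriv c x =
        (((x - x₀) * Complex.normSq (deriv c x) : ℝ) : ℂ) := by
        rw [mul_assoc, ← Complex.normSq_eq_conj_mul_self]; push_cast; ring
      have h2 : conj (c x - z) * deriv c x = conj (c x - c x₀ - (x - x₀) * deriv c x) * deriv c x +
          conj (c x₀ - z) * deriv c x + (((x - x₀) * Complex.normSq (deriv c x) : ℝ) : ℂ) := by
        rw [← h1]
        simp only [map_sub, map_mul, Complex.conj_ofReal]
        ring
      rw [h2, Complex.add_im, Complex.add_im, Complex.ofReal_im, add_zero]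
    rw [e]
    refine (abs_add_le _ _).trans ?_
    gcongr
    · refine (Complex.abs_im_le_norm _).trans ?_
      rw [norm_mul, Complex.norm_conj]
      calc _ ≤ (C * |x - x₀| ^ 2) * M := by
            gcongr
            · exact htay x₀ x
            · exact hb x
        _ = _ := by rw [sq_abs]; ring
    · refine (Complex.abs_im_le_norm _).trans ?_
      rw [norm_mul, Complex.norm_conj]
      gcongr
      exact hb x
  rcases (norm_nonneg (c x - z)).eq_or_lt with h0 | hpos
  · have : c x - z = 0 := norm_eq_zero.1 h0.symm
    simp only [kern, this]
    simp
    positivity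
  · have hNpos : 0 < N := hpos
    unfold kern
    rw [abs_div, Complex.normSq_eq_norm_sq, ← hN, abs_of_pos (a := N ^ 2 + 0 ^ 2) (by positivity)]
    have hsq : κ ^ 2 * (x - x₀) ^ 2 ≤ 4 * N ^ 2 := by
      have := mul_self_le_mul_self (by positivity) hchord'
      calc κ ^ 2 * (x - x₀) ^ 2 = (κ * |x - x₀|) * (κ * |x - x₀|) := by
            rw [← sq_abs (x - x₀)]; ring
        _ ≤ _ := this
        _ = _ := by ring
    have hd2 : d ^ 2 ≤ N ^ 2 := by gcongr
    calc _ ≤ (C * M * (x - x₀) ^ 2 + d * M) / (N ^ 2 + 0 ^ 2) := by gcongr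
      _ = C * M * (x - x₀) ^ 2 / N ^ 2 + d * M / N ^ 2 := by ring
      _ ≤ 4 * C * M / κ ^ 2 + 2 * M * (d / (d ^ 2 + (κ / 2) ^ 2 * (x - x₀) ^ 2)) := by
        gcongr ?_ + ?_
        · rw [div_le_div_iff₀ (by positivity) (by positivity)]
          have : 0 ≤ C * M := by positivity
          nlinarith
        · rcases hd0.eq_or_lt with h | h
          · simp [← h]
          · rw [← mul_div_assoc, div_le_div_iff₀ (by positivity) (by positivity)]
            have : 0 ≤ d * M := by positivity
            nlinarith

/-- The angular velocity is integrable, with a bound uniform in the base point. -/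
lemma exists_kern_integral_bound : ∃ B, ∀ z : ℂ,
    IntervalIntegrable (kern c 0 z) volume 0 (2 * π) ∧
      ∫ x in 0..2 * π, |kern c 0 z x| ≤ B := by
  obtain ⟨A, M, l, hA, hM, hl, hbd⟩ := hc.exists_kern_bound
  refine ⟨A * (2 * π) + M * (π / l), fun z => ?_⟩
  obtain ⟨x₀, hx₀⟩ := hbd z
  obtain ⟨hi, hInt⟩ := integral_div_sq_le (d := ‖c x₀ - z‖) (x₀ := x₀) (norm_nonneg _) hl
  have hle : x₀ - π ≤ x₀ + π := by linarith [pi_pos]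
  have hi2 : IntervalIntegrable (fun x => A + M * (‖c x₀ - z‖ / (‖c x₀ - z‖ ^ 2 +
      l ^ 2 * (x - x₀) ^ 2))) volume (x₀ - π) (x₀ + π) :=
    intervalIntegrable_const.add (hi.const_mul M)
  have hb : ∀ x ∈ Icc (x₀ - π) (x₀ + π), |kern c 0 z x| ≤ A + M * (‖c x₀ - z‖ /
      (‖c x₀ - z‖ ^ 2 + l ^ 2 * (x - x₀) ^ 2)) := by
    intro x hx
    apply hx₀
    rw [abs_le]; constructor <;> linarith [hx.1, hx.2]
  have hi3 : IntervalIntegrable (kern c 0 z) volume (x₀ - π) (x₀ + π) := by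
    refine hi2.mono_fun (hc.measurable_kern_right 0 z).aestronglyMeasurable ?_
    rw [uIoc_of_le hle]
    filter_upwards [ae_restrict_mem measurableSet_Ioc] with x hx
    rw [Real.norm_eq_abs, Real.norm_eq_abs]
    exact (hb x (Ioc_subset_Icc_self hx)).trans (le_abs_self _)
  have e2 : x₀ - π + 2 * π = x₀ + π := by ring
  constructor
  · have hp := (hc.kern_periodic 0 z)
    have h := hp.intervalIntegrable (t := x₀ - π) (by positivity) (by rwa [e2])
    exact h 0 (2 * π)
  · have hp : Function.Periodic (fun x => |kern c 0 z x|) (2 * π) := by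
      intro x
      simp only [hc.kern_periodic 0 z x]
    have := hp.intervalIntegral_add_eq 0 (x₀ - π)
    rw [zero_add, e2] at this
    rw [this]
    calc _ ≤ ∫ x in (x₀ - π)..(x₀ + π), (A + M * (‖c x₀ - z‖ / (‖c x₀ - z‖ ^ 2 +
      l ^ 2 * (x - x₀) ^ 2))) := intervalIntegral.integral_mono_on hle hi3.abs hi2 hb
      _ ≤ _ := by
        rw [intervalIntegral.integral_add intervalIntegrable_const (hi.const_mul M),
          intervalIntegral.integral_const_mul]
        simp only [intervalIntegral.integral_const, smul_eq_mul]
        have : x₀ + π - (x₀ - π) = 2 * π := by ring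
        rw [this]
        nlinarith

lemma intervalIntegrable_kern (ε : ℝ) (z : ℂ) :
    IntervalIntegrable (kern c ε z) volume 0 (2 * π) := by
  obtain ⟨B, hB⟩ := hc.exists_kern_integral_bound
  refine (hB z).1.abs.mono_fun (hc.measurable_kern_right ε z).aestronglyMeasurable ?_
  exact Eventually.of_forall fun x => by simpa using abs_kern_le c ε z x

lemma exists_pot_bound : ∃ B, 0 ≤ B ∧ ∀ ε z, |pot c ε z| ≤ B := by
  obtain ⟨B, hB⟩ := hc.exists_kern_integral_bound
  have h2 : (0 : ℝ) ≤ 2 * π := by positivity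
  have key : ∀ ε z, |pot c ε z| ≤ (2 * π)⁻¹ * B := by
    intro ε z
    unfold pot
    rw [abs_mul, abs_of_pos (a := (2 * π)⁻¹) (by positivity)]
    gcongr
    calc _ ≤ ∫ x in 0..2 * π, |kern c ε z x| := intervalIntegral.abs_integral_le_integral_abs h2
      _ ≤ ∫ x in 0..2 * π, |kern c 0 z x| :=
        intervalIntegral.integral_mono_on h2 (hc.intervalIntegrable_kern ε z).abs
          (hc.intervalIntegrable_kern 0 z).abs fun x _ => abs_kern_le c ε z x
      _ ≤ B := (hB z).2
  exact ⟨_, (abs_nonneg _).trans (key 0 0), key⟩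

lemma tendsto_pot (z : ℂ) : Tendsto (fun ε => pot c ε z) (𝓝[>] 0) (𝓝 (pot c 0 z)) := by
  unfold pot
  apply Tendsto.const_mul
  apply intervalIntegral.tendsto_integral_filter_of_dominated_convergence
    (fun x => |kern c 0 z x|)
  · exact Eventually.of_forall fun ε => (hc.measurable_kern_right ε z).aestronglyMeasurable
  · exact Eventually.of_forall fun ε => Eventually.of_forall fun x _ => by
      simpa using abs_kern_le c ε z x
  · exact (hc.intervalIntegrable_kern 0 z).abs
  · exact Eventually.of_forall fun x _ => tendsto_kern c z x

lemma continuous_pot {ε : ℝ} (hε : ε ≠ 0) : Continuous (pot c ε) := by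
  unfold pot
  refine continuous_const.mul ?_
  exact intervalIntegral.continuous_parametric_intervalIntegral_of_continuous'
    (hc.continuous_kern hε) 0 (2 * π)

lemma measurable_pot (ε : ℝ) : Measurable (pot c ε) := by
  by_cases hε : ε = 0
  · subst hε
    refine measurable_of_tendsto_metrizable (f := fun n : ℕ => pot c (1 / ((n : ℝ) + 1)))
      (fun n => (hc.continuous_pot (by positivity)).measurable) ?_
    rw [tendsto_pi_nhds]
    intro z
    refine (hc.tendsto_pot z).comp ?_
    refine tendsto_nhdsWithin_iff.2 ⟨tendsto_one_div_add_atTop_nhds_zero_nat, ?_⟩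
    exact Eventually.of_forall fun n => by simp only [mem_Ioi]; positivity
  · exact (hc.continuous_pot hε).measurable

end IsSimpleClosed

lemma kern_zero_eq (c : ℝ → ℂ) (z : ℂ) (x : ℝ) :
    kern c 0 z x = (deriv c x / (c x - z)).im := by
  unfold kern
  rw [Complex.div_im, Complex.mul_im, Complex.conj_re, Complex.conj_im]
  simp only [ne_eq, OfNat.ofNat_ne_zero, not_false_eq_true, zero_pow, add_zero]
  ring

lemma eq_of_continuousOn_of_int {X : Type*} [TopologicalSpace X] {s : Set X}
    (hs : IsPreconnected s) {f : X → ℝ} (hf : ContinuousOn f s)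
    (hi : ∀ x ∈ s, ∃ n : ℤ, f x = n) {x y : X} (hx : x ∈ s) (hy : y ∈ s) : f x = f y := by
  have hd : IsDiscrete (range ((↑) : ℤ → ℝ)) := ⟨
    Int.isClosedEmbedding_coe_real.isEmbedding.toHomeomorph.symm.isEmbedding.discreteTopology⟩
  refine hs.constant_of_mapsTo (T := range ((↑) : ℤ → ℝ)) hd hf (fun z hz => ?_) hx hy
  obtain ⟨n, hn⟩ := hi z hz
  exact ⟨n, hn.symm⟩

lemma hasDerivAt_log_im {L F : ℝ → ℂ} (hL : Continuous L) {t : ℝ} {F' : ℂ}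
    (hE : ∀ᶠ s in 𝓝 t, Complex.exp (L s) = F s) (hF : HasDerivAt F F' t) :
    HasDerivAt (fun s => (L s).im) (F' / F t).im t := by
  have := hasDerivAt_of_exp hL.continuousAt hE hF
  exact Complex.imCLM.hasFDerivAt.comp_hasDerivAt t this

namespace IsSimpleClosed
variable {c : ℝ → ℂ} (hc : IsSimpleClosed c)
include hc

lemma exists_log_slopeFun {m : ℝ} (hm : m < 2 * π) : ∃ L : ℝ × ℝ → ℂ, Continuous L ∧
    ∀ x h, |h| ≤ m → Complex.exp (L (x, h)) = slopeFun c (x, h) := by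
  by_cases hm0 : 0 ≤ m
  swap
  · exact ⟨0, continuous_zero, fun x h hh => absurd ((abs_nonneg h).trans hh) hm0⟩
  have hF : Continuous (fun p : ℝ × ℝ => slopeFun c (p.1, max (-m) (min p.2 m))) :=
    hc.continuous_slopeFun.comp (by fun_prop)
  obtain ⟨L, hL, hE⟩ := exists_continuous_log hF (fun p => hc.slopeFun_ne_zero (by
    have : |max (-m) (min p.2 m)| ≤ m := by
      rw [abs_le]
      exact ⟨le_max_left _ _, max_le (by linarith) (min_le_right _ _)⟩
    linarith))
  refine ⟨L, hL, fun x h hh => ?_⟩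
  rw [hE]
  have := abs_le.1 hh
  simp only [min_eq_left this.2, max_eq_right this.1]

lemma intervalIntegrable_kern' (ε : ℝ) (z : ℂ) (a b : ℝ) :
    IntervalIntegrable (kern c ε z) volume a b :=
  (hc.kern_periodic ε z).intervalIntegrable (t := 0) (by positivity)
    (by rw [zero_add]; exact hc.intervalIntegrable_kern ε z) a b

lemma integral_kern_vertical {m : ℝ} {L : ℝ × ℝ → ℂ} (hL : Continuous L)
    (hE : ∀ x h, |h| ≤ m → Complex.exp (L (x, h)) = slopeFun c (x, h)) (x : ℝ) {h₁ h₂ : ℝ}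
    (h12 : h₁ ≤ h₂) (hm1 : -m ≤ h₁) (hm2 : h₂ ≤ m) (h0 : 0 ≤ h₁ ∨ h₂ ≤ 0) :
    ∫ y in (x + h₁)..(x + h₂), kern c 0 (c x) y = (L (x, h₂)).im - (L (x, h₁)).im := by
  have hLc : Continuous (fun h => L (x, h)) := hL.comp (by fun_prop)
  have hder : ∀ h ∈ Ioo h₁ h₂, HasDerivAt (fun h => (L (x, h)).im) (kern c 0 (c x) (x + h)) h := by
    intro h hh
    have hne : h ≠ 0 := by
      rcases h0 with h0 | h0
      · exact (h0.trans_lt hh.1).ne'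
      · exact (hh.2.trans_le h0).ne
    have hnear : ∀ᶠ s in 𝓝 h, Complex.exp (L (x, s)) = (c (x + s) - c x) / s := by
      filter_upwards [isOpen_Ioo.mem_nhds hh, isOpen_ne.mem_nhds hne] with s hs hs0
      rw [hE x s (abs_le.2 ⟨by linarith [hs.1], by linarith [hs.2]⟩), hc.slopeFun_eq hs0]
    have h1 : HasDerivAt (fun s : ℝ => c (x + s) - c x) (deriv c (x + h)) h :=
      ((hc.hasDerivAt (x + h)).comp_const_add x h).sub_const _
    have h2 : HasDerivAt (fun s : ℝ => (s : ℂ)) 1 h := Complex.ofRealCLM.hasDerivAt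
    have hne' : (h : ℂ) ≠ 0 := by exact_mod_cast hne
    have h3 := hasDerivAt_log_im hLc hnear (h1.div h2 hne')
    have hD : c (x + h) - c x ≠ 0 := by
      have := hnear.self_of_nhds
      intro h0
      rw [h0, zero_div] at this
      exact Complex.exp_ne_zero _ this
    convert! h3 using 1
    rw [kern_zero_eq]
    have e : (deriv c (x + h) * (h : ℂ) - (c (x + h) - c x) * 1) / (h : ℂ) ^ 2 /
        ((c (x + h) - c x) / h) = deriv c (x + h) / (c (x + h) - c x) - ((h⁻¹ : ℝ) : ℂ) := by
      push_cast
      field_simp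
    rw [e, Complex.sub_im, Complex.ofReal_im, sub_zero]
  have key := intervalIntegral.integral_eq_sub_of_hasDerivAt_of_le h12
    (Complex.continuous_im.comp hLc).continuousOn hder (by
      have := (hc.intervalIntegrable_kern' 0 (c x) (x + h₁) (x + h₂)).comp_add_left x
      simpa using this)
  rw [intervalIntegral.integral_comp_add_left (fun y => kern c 0 (c x) y)] at key
  exact key

lemma pot_curve_aux : Continuous (fun x => pot c 0 (c x)) ∧
    ∀ x, ∃ n : ℤ, pot c 0 (c x) = n + 1 / 2 := by
  obtain ⟨L, hL, hE⟩ := hc.exists_log_slopeFun (m := π) (by linarith [pi_pos])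
  have hpi := pi_pos
  have key : ∀ x, pot c 0 (c x) = (2 * π)⁻¹ * ((L (x, π)).im - (L (x, -π)).im) := by
    intro x
    unfold pot
    have h1 := (hc.kern_periodic 0 (c x)).intervalIntegral_add_eq 0 (x - π)
    have e2 : x - π + 2 * π = x + π := by ring
    rw [zero_add, e2] at h1
    rw [h1]
    have hv1 := hc.integral_kern_vertical hL hE x (h₁ := 0) (h₂ := π) hpi.le (by linarith) le_rfl
      (Or.inl le_rfl)
    have hv2 := hc.integral_kern_vertical hL hE x (h₁ := -π) (h₂ := 0) (by linarith) le_rfl hpi.le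
      (Or.inr le_rfl)
    rw [← intervalIntegral.integral_add_adjacent_intervals
      (hc.intervalIntegrable_kern' 0 (c x) (x - π) (x + 0))
      (hc.intervalIntegrable_kern' 0 (c x) (x + 0) (x + π)), hv1]
    rw [← sub_eq_add_neg] at hv2
    rw [hv2]
    ring
  constructor
  · simp_rw [key]
    have h1 : Continuous (fun x : ℝ => L (x, π)) := hL.comp (by fun_prop)
    have h2 : Continuous (fun x : ℝ => L (x, -π)) := hL.comp (by fun_prop)
    exact continuous_const.mul ((Complex.continuous_im.comp h1).sub (Complex.continuous_im.comp h2))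
  · intro x
    have e1 := hE x π (abs_of_pos hpi).le
    have e2 := hE x (-π) (by rw [abs_neg, abs_of_pos hpi])
    rw [hc.slopeFun_eq hpi.ne'] at e1
    rw [hc.slopeFun_eq (neg_ne_zero.2 hpi.ne')] at e2
    have e3 : c (x + -π) = c (x + π) := by
      rw [← hc.per (x + -π)]; congr 1; ring
    have e4 : Complex.exp (L (x, π)) = Complex.exp (L (x, -π) + π * Complex.I) := by
      rw [Complex.exp_add, Complex.exp_pi_mul_I, e1, e2, e3]
      push_cast
      rw [div_neg]; ring
    obtain ⟨n, hn⟩ := Complex.exp_eq_exp_iff_exists_int.1 e4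
    refine ⟨n, ?_⟩
    rw [key, hn]
    simp
    field_simp
    ring

/-- Twice the mean value of the winding number at points of the curve: an odd integer. -/
lemma exists_pot_curve : ∃ s : ℝ, s ≠ 0 ∧ (∃ n : ℤ, s = n) ∧ ∀ x, pot c 0 (c x) = s / 2 := by
  obtain ⟨h1, h2⟩ := hc.pot_curve_aux
  obtain ⟨n, hn⟩ := h2 0
  refine ⟨2 * n + 1, ?_, ⟨2 * n + 1, by push_cast; ring⟩, fun x => ?_⟩
  · have : (2 * n + 1 : ℤ) ≠ 0 := by omega
    exact_mod_cast this
  · have := eq_of_continuousOn_of_int isPreconnected_univ (f := fun x => pot c 0 (c x) - 1 / 2)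
      (h1.sub continuous_const).continuousOn
      (fun x _ => by obtain ⟨n, hn⟩ := h2 x; exact ⟨n, by rw [hn]; ring⟩) (mem_univ x) (mem_univ 0)
    simp only [hn] at this
    linarith

/-- The total curvature of an embedded arc is the sum of the angles under which it is seen from its
endpoints. -/
lemma integral_curvature_arc {y₁ y₂ : ℝ} (h12 : y₁ ≤ y₂) (h2 : y₂ < y₁ + 2 * π) :
    ∫ x in y₁..y₂, (deriv (deriv c) x / deriv c x).im =
      ∫ x in y₁..y₂, (kern c 0 (c y₁) x + kern c 0 (c y₂) x) := by
  obtain ⟨L, hL, hE⟩ := hc.exists_log_slopeFun (m := y₂ - y₁) (by linarith)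
  have hv := hc.integral_kern_vertical hL hE y₁ (h₁ := 0) (h₂ := y₂ - y₁) (by linarith)
    (by linarith) le_rfl (Or.inl le_rfl)
  rw [add_zero, add_sub_cancel] at hv
  have hh : ∫ x in y₁..y₂, (deriv (deriv c) x / deriv c x).im =
      (L (y₂, 0)).im - (L (y₁, 0)).im := by
    have hLc : Continuous (fun x => L (x, 0)) := hL.comp (by fun_prop)
    apply intervalIntegral.integral_eq_sub_of_hasDerivAt (f := fun x => (L (x, 0)).im)
    · intro x _
      refine hasDerivAt_log_im hLc (F := deriv c) (Eventually.of_forall fun s => ?_)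
        (hc.hasDerivAt_deriv x)
      rw [hE s 0 (by simpa using h12), slopeFun_zero]
    · apply Continuous.intervalIntegrable
      exact Complex.continuous_im.comp (hc.cont_deriv_deriv.div hc.cont_deriv hc.reg)
  have hd : ∫ x in y₁..y₂, kern c 0 (c y₂) x = (L (y₂, 0)).im - (L (y₁, y₂ - y₁)).im := by
    have hLc : Continuous (fun x => L (x, y₂ - x)) := hL.comp (by fun_prop)
    have := intervalIntegral.integral_eq_sub_of_hasDerivAt_of_le h12
      (f := fun x => (L (x, y₂ - x)).im) (f' := kern c 0 (c y₂))
      (Complex.continuous_im.comp hLc).continuousOn (fun x hx => ?_)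
      (hc.intervalIntegrable_kern' 0 (c y₂) y₁ y₂)
    · rw [this, sub_self]
    · have hnear : ∀ᶠ s in 𝓝 x, Complex.exp (L (s, y₂ - s)) =
          (c s - c y₂) / ((s - y₂ : ℝ) : ℂ) := by
        filter_upwards [isOpen_Ioo.mem_nhds hx] with s hs
        have : y₂ - s ≠ 0 := by linarith [hs.2] |> ne_of_gt
        rw [hE s _ (abs_le.2 ⟨by linarith [hs.1, hs.2], by linarith [hs.1]⟩), hc.slopeFun_eq this,
          add_sub_cancel, ← neg_sub (c s), ← neg_sub s y₂, Complex.ofReal_neg, neg_div_neg_eq]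
      have hne' : ((x - y₂ : ℝ) : ℂ) ≠ 0 := by
        have : x - y₂ ≠ 0 := by linarith [hx.2] |> ne_of_lt
        exact_mod_cast this
      have h1 : HasDerivAt (fun s : ℝ => c s - c y₂) (deriv c x) x := (hc.hasDerivAt x).sub_const _
      have h2 : HasDerivAt (fun s : ℝ => ((s - y₂ : ℝ) : ℂ)) 1 x := by
        have := ((hasDerivAt_id x).sub_const y₂).ofReal_comp
        simpa using this
      have h3 := hasDerivAt_log_im hLc hnear (h1.div h2 hne')
      have hD : c x - c y₂ ≠ 0 := by
        have := hnear.self_of_nhds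
        intro h0
        rw [h0, zero_div] at this
        exact Complex.exp_ne_zero _ this
      convert! h3 using 1
      rw [kern_zero_eq]
      have e : (deriv c x * ((x - y₂ : ℝ) : ℂ) - (c x - c y₂) * 1) / ((x - y₂ : ℝ) : ℂ) ^ 2 /
          ((c x - c y₂) / ((x - y₂ : ℝ) : ℂ)) =
            deriv c x / (c x - c y₂) - (((x - y₂)⁻¹ : ℝ) : ℂ) := by
        rw [Complex.ofReal_inv]
        field_simp
      rw [e, Complex.sub_im, Complex.ofReal_im, sub_zero]
  rw [intervalIntegral.integral_add (hc.intervalIntegrable_kern' _ _ _ _)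
    (hc.intervalIntegrable_kern' _ _ _ _), hh, hv, hd]
  ring

end IsSimpleClosed

/-- The Cauchy-type approximate identity on the plane. -/
def rho (ε : ℝ) (ζ : ℂ) : ℝ := ε ^ 2 / (π * (Complex.normSq ζ + ε ^ 2) ^ 2)

lemma rho_nonneg (ε : ℝ) (ζ : ℂ) : 0 ≤ rho ε ζ := by unfold rho; positivity

lemma rho_neg (ε : ℝ) (ζ : ℂ) : rho ε (-ζ) = rho ε ζ := by simp [rho]

lemma normSq_add_sq_pos {ε : ℝ} (hε : ε ≠ 0) (ζ : ℂ) : 0 < Complex.normSq ζ + ε ^ 2 := by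
  have := Complex.normSq_nonneg ζ
  positivity

lemma continuous_rho {ε : ℝ} (hε : ε ≠ 0) : Continuous (rho ε) := by
  unfold rho
  refine continuous_const.div (by fun_prop) fun ζ => ?_
  have := normSq_add_sq_pos hε ζ
  positivity

lemma rho_scale {ε : ℝ} (hε : 0 < ε) (ζ : ℂ) : rho ε ζ = ε⁻¹ ^ 2 * rho 1 (ε⁻¹ • ζ) := by
  have := Complex.normSq_nonneg ζ
  have h1 : Complex.normSq ζ + ε ^ 2 ≠ 0 := (normSq_add_sq_pos hε.ne' ζ).ne'
  simp only [rho, Complex.real_smul, Complex.normSq_mul, Complex.normSq_ofReal]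
  have h2 : ε⁻¹ * ε⁻¹ * Complex.normSq ζ + 1 ^ 2 = (Complex.normSq ζ + ε ^ 2) / ε ^ 2 := by
    field_simp
  rw [h2]
  field_simp

lemma integral_rho_one : ∫ ζ, rho 1 ζ = 1 := by
  have h1 : ∀ ζ : ℂ, rho 1 ζ = (fun r : ℝ => 1 / (π * (r ^ 2 + 1) ^ 2)) ‖ζ‖ := by
    intro ζ; simp [rho, Complex.normSq_eq_norm_sq]
  simp_rw [h1]
  rw [integral_fun_norm_addHaar volume (fun r : ℝ => 1 / (π * (r ^ 2 + 1) ^ 2))]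
  have hd : ∀ x ∈ Ici (0 : ℝ), HasDerivAt (fun r : ℝ => -(1 / (2 * π * (r ^ 2 + 1))))
      (x ^ (Module.finrank ℝ ℂ - 1) • (1 / (π * (x ^ 2 + 1) ^ 2))) x := by
    intro x _
    have hx : x ^ 2 + 1 ≠ 0 := by positivity
    have hx2 : 2 * π * (x ^ 2 + 1) ≠ 0 := by positivity
    have h := ((((hasDerivAt_pow 2 x).add_const 1).const_mul (2 * π)).inv hx2).neg
    simp only [one_div]
    convert! h using 1
    simp only [Complex.finrank_real_complex, smul_eq_mul]
    field_simp
    norm_num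
  have ht : Tendsto (fun r : ℝ => -(1 / (2 * π * (r ^ 2 + 1)))) atTop (𝓝 0) := by
    rw [← neg_zero]
    refine Tendsto.neg (tendsto_const_nhds.div_atTop ?_)
    refine Tendsto.const_mul_atTop (by positivity) (tendsto_atTop_add_const_right _ _ ?_)
    exact tendsto_pow_atTop two_ne_zero
  rw [integral_Ioi_of_hasDerivAt_of_nonneg' hd ?_ ht]
  · simp [Measure.real, Complex.volume_ball]
  · intro x hx
    have : 0 < x := hx
    simp only [smul_eq_mul]
    positivity

lemma integrable_rho_one : Integrable (rho 1) := integrable_of_integral_eq_one integral_rho_one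

lemma integrable_rho {ε : ℝ} (hε : 0 < ε) (q : ℂ) : Integrable fun z => rho ε (z - q) := by
  have h : Integrable (rho ε) := by
    have : rho ε = fun ζ => ε⁻¹ ^ 2 * rho 1 (ε⁻¹ • ζ) := funext (rho_scale hε)
    rw [this]
    exact (integrable_rho_one.comp_smul (by positivity)).const_mul _
  exact h.comp_sub_right q

lemma integral_rho {ε : ℝ} (hε : 0 < ε) (q : ℂ) : ∫ z, rho ε (z - q) = 1 := by
  rw [integral_sub_right_eq_self (rho ε) q]
  have : rho ε = fun ζ => ε⁻¹ ^ 2 * rho 1 (ε⁻¹ • ζ) := funext (rho_scale hε)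
  rw [this, integral_const_mul, Measure.integral_comp_smul, integral_rho_one]
  simp only [Complex.finrank_real_complex, smul_eq_mul, mul_one]
  rw [abs_of_pos (by positivity)]
  field_simp

lemma tendsto_integral_rho {E : Type*} [NormedAddCommGroup E] [NormedSpace ℝ E] [CompleteSpace E]
    {g : ℂ → E} (hg : Integrable g) {q : ℂ} (hq : ContinuousAt g q) :
    Tendsto (fun ε => ∫ z, rho ε (z - q) • g z) (𝓝[>] 0) (𝓝 (g q)) := by
  have key := tendsto_integral_comp_smul_smul_of_integrable' (μ := (volume : Measure ℂ))
    (rho_nonneg 1) integral_rho_one ?_ hg hq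
  · refine (key.comp tendsto_inv_nhdsGT_zero).congr' ?_
    filter_upwards [self_mem_nhdsWithin] with ε hε
    refine integral_congr_ae (Eventually.of_forall fun z => ?_)
    simp only [Complex.finrank_real_complex]
    rw [rho_scale hε, ← rho_neg 1 (ε⁻¹ • (z - q)), ← smul_neg, neg_sub]
  · have h1 : Tendsto (fun x : ℂ => ‖x‖) (Bornology.cobounded ℂ) atTop :=
      tendsto_norm_cobounded_atTop
    have h2 : Tendsto (fun r : ℝ => (π * r ^ 2)⁻¹) atTop (𝓝 0) := by
      refine Tendsto.inv_tendsto_atTop ?_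
      exact Tendsto.const_mul_atTop (by positivity) (tendsto_pow_atTop two_ne_zero)
    refine squeeze_zero' (Eventually.of_forall fun x => ?_) ?_ (h2.comp h1)
    · have := rho_nonneg 1 x
      positivity
    · filter_upwards [h1.eventually_gt_atTop 0] with x hx
      simp only [Complex.finrank_real_complex, rho, Complex.normSq_eq_norm_sq, Function.comp]
      rw [← one_div, mul_div_assoc', div_le_div_iff₀ (by positivity) (by positivity)]
      have : 0 < π := pi_pos
      have : (‖x‖^2)^2 ≤ (‖x‖^2+1^2)^2 := by gcongr; linarith
      nlinarith

/-- The operator `2i ∂̄` on functions of one complex variable. -/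
def dbar2 (f : ℂ → ℂ) (z : ℂ) : ℂ := Complex.I * fderiv ℝ f z 1 - fderiv ℝ f z Complex.I

/-- The regularised Cauchy kernel with pole `q`. -/
def cauchyK (ε : ℝ) (q z : ℂ) : ℂ := conj (z - q) / ((Complex.normSq (z - q) + ε ^ 2 : ℝ) : ℂ)

lemma contDiff_normSq {n : WithTop ℕ∞} : ContDiff ℝ n fun z : ℂ => Complex.normSq z := by
  have : (fun z : ℂ => Complex.normSq z) = fun z => ‖z‖ ^ 2 :=
    funext fun z => Complex.normSq_eq_norm_sq z
  rw [this]
  exact contDiff_norm_sq ℝ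

lemma contDiff_conj {n : WithTop ℕ∞} : ContDiff ℝ n fun z : ℂ => conj z :=
  Complex.conjCLE.contDiff

lemma contDiff_cauchyK_uncurry {ε : ℝ} (hε : ε ≠ 0) {n : WithTop ℕ∞} :
    ContDiff ℝ n fun p : ℂ × ℂ => cauchyK ε p.1 p.2 := by
  unfold cauchyK
  have h : ContDiff ℝ n fun p : ℂ × ℂ => p.2 - p.1 := contDiff_snd.sub contDiff_fst
  have h1 : ContDiff ℝ n fun p : ℂ × ℂ => ((Complex.normSq (p.2 - p.1) + ε ^ 2 : ℝ) : ℂ) :=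
    (Complex.ofRealCLM.contDiff (n := n)).comp
      (((contDiff_normSq (n := n)).comp h).add contDiff_const)
  simp_rw [div_eq_mul_inv]
  refine ((contDiff_conj (n := n)).comp h).mul (h1.inv ?_)
  · intro p
    have := normSq_add_sq_pos hε (p.2 - p.1)
    exact_mod_cast this.ne'

lemma contDiff_cauchyK {ε : ℝ} (hε : ε ≠ 0) (q : ℂ) {n : WithTop ℕ∞} :
    ContDiff ℝ n (cauchyK ε q) :=
  (contDiff_cauchyK_uncurry hε (n := n)).comp (contDiff_const.prodMk contDiff_id)

lemma continuous_dbar2 {f : ℂ → ℂ} (hf : ContDiff ℝ 1 f) : Continuous (dbar2 f) := by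
  unfold dbar2
  have := hf.continuous_fderiv one_ne_zero
  fun_prop

lemma dbar2_mul {f g : ℂ → ℂ} {z : ℂ} (hf : DifferentiableAt ℝ f z)
    (hg : DifferentiableAt ℝ g z) :
    dbar2 (fun z => f z * g z) z = f z * dbar2 g z + dbar2 f z * g z := by
  unfold dbar2
  rw [fderiv_fun_mul hf hg]
  simp only [add_apply, smul_apply, smul_eq_mul]
  ring

lemma dbar2_eq_zero_of_notMem {f : ℂ → ℂ} {z : ℂ} (hz : z ∉ tsupport f) : dbar2 f z = 0 := by
  unfold dbar2
  rw [fderiv_of_notMem_tsupport ℝ hz]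
  simp

lemma dbar2_congr {f g : ℂ → ℂ} {z : ℂ} (h : f =ᶠ[𝓝 z] g) : dbar2 f z = dbar2 g z := by
  unfold dbar2
  rw [h.fderiv_eq]

lemma hasDerivAt_normSq_line (w v : ℂ) (t : ℝ) :
    HasDerivAt (fun s : ℝ => Complex.normSq (w + s * v)) (2 * (conj (w + t * v) * v).re) t := by
  have h : (fun s : ℝ => Complex.normSq (w + s * v)) =
      fun s : ℝ => (w.re + s * v.re) ^ 2 + (w.im + s * v.im) ^ 2 := by
    funext s; simp [Complex.normSq_apply]; ring
  rw [h]
  have h1 := ((((hasDerivAt_id t).mul_const v.re).const_add w.re).pow 2).add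
    ((((hasDerivAt_id t).mul_const v.im).const_add w.im).pow 2)
  convert! h1 using 1
  simp
  ring

lemma fderiv_cauchyK {ε : ℝ} (hε : ε ≠ 0) (q z v : ℂ) :
    fderiv ℝ (cauchyK ε q) z v = (conj v * ((Complex.normSq (z - q) + ε ^ 2 : ℝ) : ℂ) -
      conj (z - q) * ((2 * (conj (z - q) * v).re : ℝ) : ℂ)) /
      ((Complex.normSq (z - q) + ε ^ 2 : ℝ) : ℂ) ^ 2 := by
  have hd :=
    ((contDiff_cauchyK hε q (n := 1)).differentiable one_ne_zero z).hasFDerivAt.hasLineDerivAt v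
  unfold HasLineDerivAt at hd
  refine hd.unique ?_
  have h1 : HasDerivAt (fun t : ℝ => conj (z + t • v - q)) (conj v) 0 := by
    have h0 : HasDerivAt (fun t : ℝ => z + t • v - q) v 0 := by
      simpa using (((hasDerivAt_id (0 : ℝ)).smul_const v).const_add z).sub_const q
    exact (Complex.conjCLE : ℂ →L[ℝ] ℂ).hasFDerivAt.comp_hasDerivAt 0 h0
  have h2 : HasDerivAt (fun t : ℝ => ((Complex.normSq (z + t • v - q) + ε ^ 2 : ℝ) : ℂ))
      ((2 * (conj (z - q) * v).re : ℝ) : ℂ) 0 := by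
    have := (hasDerivAt_normSq_line (z - q) v 0).add_const (ε ^ 2)
    simp only [Complex.ofReal_zero, zero_mul, add_zero] at this
    refine HasDerivAt.ofReal_comp ?_
    convert! this using 1
    funext t
    congr 2
    rw [Complex.real_smul]; ring
  have := h1.div h2 (by
    have := normSq_add_sq_pos hε (z + (0 : ℝ) • v - q)
    exact_mod_cast this.ne')
  convert! this using 1
  simp

lemma dbar2_cauchyK {ε : ℝ} (hε : ε ≠ 0) (q z : ℂ) :
    dbar2 (cauchyK ε q) z = 2 * π * Complex.I * (rho ε (z - q) : ℝ) := by
  unfold dbar2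
  rw [fderiv_cauchyK hε, fderiv_cauchyK hε]
  have h0 := normSq_add_sq_pos hε (z - q)
  have h1 : ((Complex.normSq (z - q) + ε ^ 2 : ℝ) : ℂ) ≠ 0 := by exact_mod_cast h0.ne'
  have hpi : (π : ℂ) ≠ 0 := by exact_mod_cast pi_ne_zero
  have h2 : ((rho ε (z - q) : ℝ) : ℂ) =
      (ε : ℂ) ^ 2 / (π * ((Complex.normSq (z - q) + ε ^ 2 : ℝ) : ℂ) ^ 2) := by
    simp [rho]
  rw [h2]
  field_simp
  simp only [map_one, Complex.conj_I, Complex.mul_re, Complex.conj_re, Complex.conj_im,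
    Complex.I_re, Complex.I_im]
  set a := z - q with ha
  rw [Complex.normSq_apply]
  apply Complex.ext <;> simp [pow_two] <;> ring

lemma integral_mul_dbar2 {f g : ℂ → ℂ} (hf : ContDiff ℝ 1 f) (hg : ContDiff ℝ 1 g)
    (hc : HasCompactSupport f) :
    ∫ z, f z * dbar2 g z = -∫ z, dbar2 f z * g z := by
  have hf' := hf.continuous_fderiv one_ne_zero
  have hg' := hg.continuous_fderiv one_ne_zero
  have i1 : ∀ v, Integrable fun z => fderiv ℝ f z v * g z := fun v => by
    refine Continuous.integrable_of_hasCompactSupport (by have := hg.continuous; fun_prop) ?_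
    have h : HasCompactSupport fun z => fderiv ℝ f z v :=
      (hc.fderiv (𝕜 := ℝ)).comp_left (g := fun L : ℂ →L[ℝ] ℂ => L v) rfl
    exact h.mul_right
  have i2 : ∀ v, Integrable fun z => f z * fderiv ℝ g z v := fun v => by
    refine Continuous.integrable_of_hasCompactSupport (by have := hf.continuous; fun_prop) ?_
    exact hc.mul_right
  have i3 : Integrable fun z => f z * g z :=
    (hf.continuous.mul hg.continuous).integrable_of_hasCompactSupport hc.mul_right
  have key : ∀ v, ∫ z, f z * fderiv ℝ g z v = -∫ z, fderiv ℝ f z v * g z := fun v =>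
    integral_mul_fderiv_eq_neg_fderiv_mul_of_integrable (i1 v) (i2 v) i3
      (fun z _ => hf.differentiable one_ne_zero z) (fun z _ => hg.differentiable one_ne_zero z)
  have e1 : ∫ z, f z * dbar2 g z =
      Complex.I * (∫ z, f z * fderiv ℝ g z 1) - ∫ z, f z * fderiv ℝ g z Complex.I := by
    rw [← integral_const_mul, ← integral_sub ((i2 1).const_mul _) (i2 _)]
    refine integral_congr_ae (Eventually.of_forall fun z => ?_)
    simp only [dbar2]; ring
  have e2 : ∫ z, dbar2 f z * g z =
      Complex.I * (∫ z, fderiv ℝ f z 1 * g z) - ∫ z, fderiv ℝ f z Complex.I * g z := by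
    rw [← integral_const_mul, ← integral_sub ((i1 1).const_mul _) (i1 _)]
    refine integral_congr_ae (Eventually.of_forall fun z => ?_)
    simp only [dbar2]; ring
  rw [e1, e2, key, key]
  ring

lemma hasCompactSupport_dbar2 {f : ℂ → ℂ} (hc : HasCompactSupport f) :
    HasCompactSupport (dbar2 f) :=
  HasCompactSupport.intro hc fun _ hz => dbar2_eq_zero_of_notMem hz

/-- Exchange of a plane integral against an integrable weight and a contour integral. -/
lemma integral_swap_interval {W : ℂ → ℂ} (hW : Integrable W) {g : ℂ → ℝ → ℂ}
    (hg : Continuous fun p : ℂ × ℝ => g p.1 p.2) {a b : ℝ} {C : ℝ}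
    (hC : ∀ z, ∀ x ∈ uIcc a b, W z ≠ 0 → ‖g z x‖ ≤ C) :
    ∫ z, W z * (∫ x in a..b, g z x) = ∫ x in a..b, ∫ z, W z * g z x := by
  have h := intervalIntegral_integral_swap (μ := (volume : Measure ℂ)) (a := a) (b := b)
    (f := fun (x : ℝ) (z : ℂ) => W z * g z x) ?_
  · rw [h]
    refine integral_congr_ae (Eventually.of_forall fun z => ?_)
    simp only
    rw [intervalIntegral.integral_const_mul]
  · have h1 : Integrable (fun p : ℝ × ℂ => (1 : ℂ) * W p.2)
        ((volume.restrict (uIoc a b)).prod volume) := by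
      refine Integrable.mul_prod (f := fun _ => (1 : ℂ)) ?_ hW
      exact (intervalIntegrable_iff (μ := volume)).1 intervalIntegrable_const
    have h2 : Integrable (fun p : ℝ × ℂ => C * ‖W p.2‖)
        ((volume.restrict (uIoc a b)).prod volume) := by
      simpa using h1.norm.const_mul C
    refine h2.mono ?_ ?_
    · refine AEStronglyMeasurable.mul (by simpa using h1.aestronglyMeasurable) ?_
      exact (hg.comp continuous_swap).aestronglyMeasurable
    · have : ∀ᵐ p ∂(volume.restrict (uIoc a b)).prod (volume : Measure ℂ), p.1 ∈ uIoc a b := by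
        have := ae_restrict_mem (μ := (volume : Measure ℝ)) (s := uIoc a b) measurableSet_uIoc
        exact Measure.quasiMeasurePreserving_fst.ae this
      filter_upwards [this] with p hp
      rw [Function.uncurry, norm_mul]
      by_cases h0 : W p.2 = 0
      · simp [h0]
      · have h3 := hC p.2 p.1 (uIoc_subset_uIcc hp) h0
        rw [Real.norm_eq_abs]
        refine le_trans ?_ (le_abs_self _)
        nlinarith [norm_nonneg (W p.2)]

lemma cauchyK_mul_im (c : ℝ → ℂ) (ε : ℝ) (q : ℂ) (x : ℝ) :
    (cauchyK ε q (c x) * deriv c x).im = kern c ε q x := by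
  unfold cauchyK kern
  rw [div_mul_eq_mul_div, Complex.div_ofReal_im]

lemma cauchyK_symm (ε : ℝ) (q z : ℂ) : cauchyK ε q z = -cauchyK ε z q := by
  unfold cauchyK
  rw [← neg_sub q z, Complex.normSq_neg, map_neg, neg_div]

lemma norm_cauchyK_le {ε : ℝ} (hε : 0 < ε) (q z : ℂ) : ‖cauchyK ε q z‖ ≤ ε⁻¹ := by
  unfold cauchyK
  rw [norm_div, Complex.norm_conj, Complex.norm_real, Real.norm_eq_abs,
    abs_of_pos (normSq_add_sq_pos hε.ne' _), Complex.normSq_eq_norm_sq, ← one_div,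
    div_le_div_iff₀ (by positivity) hε]
  nlinarith [sq_nonneg (‖z - q‖ - ε), norm_nonneg (z - q)]

namespace IsSimpleClosed
variable {c : ℝ → ℂ} (hc : IsSimpleClosed c)
include hc

lemma integral_cauchyK {ε : ℝ} (hε : 0 < ε) (q : ℂ) :
    ∫ x in 0..2 * π, cauchyK ε q (c x) * deriv c x = 2 * π * Complex.I * (pot c ε q : ℝ) := by
  have hcont : Continuous fun x => cauchyK ε q (c x) * deriv c x :=
    ((contDiff_cauchyK hε.ne' q (n := 1)).continuous.comp hc.cont).mul hc.cont_deriv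
  have hi := hcont.intervalIntegrable (μ := volume) 0 (2 * π)
  have him : (∫ x in 0..2 * π, cauchyK ε q (c x) * deriv c x).im = 2 * π * pot c ε q := by
    have h1 := Complex.imCLM.intervalIntegral_comp_comm hi
    simp only [Complex.imCLM_apply] at h1
    rw [← h1]
    simp_rw [cauchyK_mul_im]
    unfold pot
    have := pi_pos
    field_simp
  have hre : (∫ x in 0..2 * π, cauchyK ε q (c x) * deriv c x).re = 0 := by
    have h1 := Complex.reCLM.intervalIntegral_comp_comm hi
    simp only [Complex.reCLM_apply] at h1
    rw [← h1]
    have hd : ∀ x ∈ uIcc 0 (2 * π), HasDerivAt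
        (fun x => Real.log (Complex.normSq (c x - q) + ε ^ 2) / 2)
        (cauchyK ε q (c x) * deriv c x).re x := by
      intro x _
      have h0 := normSq_add_sq_pos hε.ne' (c x - q)
      have hr : HasDerivAt (fun x => (c x).re) (deriv c x).re x :=
        Complex.reCLM.hasFDerivAt.comp_hasDerivAt x (hc.hasDerivAt x)
      have hm : HasDerivAt (fun x => (c x).im) (deriv c x).im x :=
        Complex.imCLM.hasFDerivAt.comp_hasDerivAt x (hc.hasDerivAt x)
      have h2 : HasDerivAt (fun x => Complex.normSq (c x - q) + ε ^ 2)
          (2 * (conj (c x - q) * deriv c x).re) x := by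
        have h3 := (((hr.sub_const q.re).pow 2).add ((hm.sub_const q.im).pow 2)).add_const (ε ^ 2)
        convert! h3 using 1
        · funext y; simp [Complex.normSq_apply]; ring
        · simp; ring
      convert! (h2.log h0.ne').div_const 2 using 1
      unfold cauchyK
      rw [div_mul_eq_mul_div, Complex.div_ofReal_re]
      ring
    rw [intervalIntegral.integral_eq_sub_of_hasDerivAt hd
      ((Complex.continuous_re.comp hcont).intervalIntegrable _ _)]
    have := hc.per 0
    rw [zero_add] at this
    simp [this]
  apply Complex.ext
  · rw [hre]; simp
  · rw [him]; simp

lemma green_eps {ε : ℝ} (hε : 0 < ε) {f : ℂ → ℂ} (hf : ContDiff ℝ 1 f)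
    (hs : HasCompactSupport f) :
    ∫ x in 0..2 * π, (∫ z, f z * (rho ε (z - c x) : ℝ)) * deriv c x =
      ∫ z, (pot c ε z : ℂ) * dbar2 f z := by
  have hpi : (2 * π * Complex.I : ℂ) ≠ 0 := Complex.two_pi_I_ne_zero
  have hW : Integrable (dbar2 f) :=
    (continuous_dbar2 hf).integrable_of_hasCompactSupport (hasCompactSupport_dbar2 hs)
  have h1 : ∀ q, ∫ z, f z * (rho ε (z - q) : ℝ) =
      (2 * π * Complex.I)⁻¹ * ∫ z, dbar2 f z * cauchyK ε z q := by
    intro q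
    have h := integral_mul_dbar2 hf (contDiff_cauchyK hε.ne' q) hs
    simp_rw [dbar2_cauchyK hε.ne'] at h
    have h' : ∫ z, f z * (2 * π * Complex.I * (rho ε (z - q) : ℝ)) =
        2 * π * Complex.I * ∫ z, f z * (rho ε (z - q) : ℝ) := by
      rw [← integral_const_mul]
      exact integral_congr_ae (Eventually.of_forall fun z => by ring)
    rw [h'] at h
    rw [eq_inv_mul_iff_mul_eq₀ hpi, h, ← integral_neg]
    exact integral_congr_ae (Eventually.of_forall fun z => by
      simp only
      rw [cauchyK_symm ε q z]; ring)
  obtain ⟨M, -, hM⟩ := exists_bound_of_periodic hc.cont_deriv hc.per_deriv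
  have hsw := integral_swap_interval hW (g := fun z x => cauchyK ε z (c x) * deriv c x)
    (a := 0) (b := 2 * π) (C := ε⁻¹ * M) ?_ ?_
  · have h2 : ∀ x, (∫ z, f z * (rho ε (z - c x) : ℝ)) * deriv c x = (2 * π * Complex.I)⁻¹ *
        ∫ z, dbar2 f z * (cauchyK ε z (c x) * deriv c x) := by
      intro x
      rw [h1, mul_assoc, ← integral_mul_const]
      simp_rw [mul_assoc]
    simp_rw [h2]
    rw [intervalIntegral.integral_const_mul, ← hsw, ← integral_const_mul]
    refine integral_congr_ae (Eventually.of_forall fun z => ?_)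
    simp only
    rw [hc.integral_cauchyK hε]
    field_simp
  · exact ((contDiff_cauchyK_uncurry hε.ne' (n := 1)).continuous.comp
      (continuous_fst.prodMk (hc.cont.comp continuous_snd))).mul (hc.cont_deriv.comp continuous_snd)
  · intro z x _ _
    rw [norm_mul]
    have h3 := norm_cauchyK_le hε z (c x)
    have h4 := hM x
    gcongr

lemma green_compact {f : ℂ → ℂ} (hf : ContDiff ℝ 1 f) (hs : HasCompactSupport f) :
    ∫ x in 0..2 * π, f (c x) * deriv c x = ∫ z, (pot c 0 z : ℂ) * dbar2 f z := by
  have hfi := hf.continuous.integrable_of_hasCompactSupport (μ := volume) hs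
  have hW : Integrable (dbar2 f) :=
    (continuous_dbar2 hf).integrable_of_hasCompactSupport (hasCompactSupport_dbar2 hs)
  obtain ⟨B, hB0, hB⟩ := hc.exists_pot_bound
  obtain ⟨A, hA⟩ := hf.continuous.bounded_above_of_compact_support hs
  obtain ⟨M, -, hM⟩ := exists_bound_of_periodic hc.cont_deriv hc.per_deriv
  have hconv : ∀ ε z, ∫ y, f y * (rho ε (y - z) : ℝ) = ∫ y, rho ε (y - z) • f y := by
    intro ε z
    refine integral_congr_ae (Eventually.of_forall fun y => ?_)
    simp only [Complex.real_smul]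
    ring
  have hL : Tendsto (fun ε => ∫ x in 0..2 * π, (∫ z, f z * (rho ε (z - c x) : ℝ)) * deriv c x)
      (𝓝[>] 0) (𝓝 (∫ x in 0..2 * π, f (c x) * deriv c x)) := by
    refine intervalIntegral.tendsto_integral_filter_of_dominated_convergence (fun _ => A * M)
      ?_ ?_ ?_ ?_
    · filter_upwards [self_mem_nhdsWithin] with ε hε
      have hε0 : (0 : ℝ) < ε := hε
      refine Continuous.aestronglyMeasurable (Continuous.mul ?_ hc.cont_deriv)
      have : Continuous fun q : ℂ => ∫ z, f z * (rho ε (z - q) : ℝ) := by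
        have hK : IsCompact (tsupport f) := hs
        have h1 : ∀ q : ℂ, ∫ z, f z * (rho ε (z - q) : ℝ) =
            ∫ z in tsupport f, f z * (rho ε (z - q) : ℝ) := fun q =>
          (setIntegral_eq_integral_of_forall_compl_eq_zero fun z hz => by
            rw [image_eq_zero_of_notMem_tsupport hz, zero_mul]).symm
        simp_rw [h1]
        refine continuous_parametric_integral_of_continuous
          (f := fun q z => f z * (rho ε (z - q) : ℝ)) ?_ hK
        have := continuous_rho hε0.ne'
        have := hf.continuous
        unfold Function.uncurry
        fun_prop
      exact this.comp hc.cont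
    · filter_upwards [self_mem_nhdsWithin] with ε hε
      refine Eventually.of_forall fun x _ => ?_
      rw [norm_mul]
      have h4 := hM x
      have hA0 : 0 ≤ A := (norm_nonneg _).trans (hA 0)
      have h5 : ‖∫ z, f z * (rho ε (z - c x) : ℝ)‖ ≤ A := by
        have h6 : ‖∫ z, f z * (rho ε (z - c x) : ℝ)‖ ≤ ∫ z, A * rho ε (z - c x) := by
          refine norm_integral_le_of_norm_le ((integrable_rho hε _).const_mul A)
            (Eventually.of_forall fun z => ?_)
          rw [norm_mul, Complex.norm_real, Real.norm_eq_abs, abs_of_nonneg (rho_nonneg _ _)]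
          have := hA z
          have := rho_nonneg ε (z - c x)
          gcongr
        rwa [integral_const_mul, integral_rho hε, mul_one] at h6
      gcongr
    · exact intervalIntegrable_const
    · refine Eventually.of_forall fun x _ => Tendsto.mul_const _ ?_
      simp_rw [hconv]
      exact tendsto_integral_rho hfi hf.continuous.continuousAt
  have hR : Tendsto (fun ε => ∫ z, (pot c ε z : ℂ) * dbar2 f z) (𝓝[>] 0)
      (𝓝 (∫ z, (pot c 0 z : ℂ) * dbar2 f z)) := by
    refine tendsto_integral_filter_of_dominated_convergence (fun z => B * ‖dbar2 f z‖) ?_ ?_ ?_ ?_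
    · refine Eventually.of_forall fun ε => ?_
      exact (Complex.measurable_ofReal.comp (hc.measurable_pot ε)).aestronglyMeasurable.mul
        hW.aestronglyMeasurable
    · refine Eventually.of_forall fun ε => Eventually.of_forall fun z => ?_
      rw [norm_mul, Complex.norm_real, Real.norm_eq_abs]
      have := hB ε z
      gcongr
    · exact hW.norm.const_mul B
    · refine Eventually.of_forall fun z => Tendsto.mul_const _ ?_
      exact (Complex.continuous_ofReal.tendsto _).comp (hc.tendsto_pot z)
  refine tendsto_nhds_unique hL (hR.congr' ?_)
  filter_upwards [self_mem_nhdsWithin] with ε hε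
  exact (hc.green_eps hε hf hs).symm

lemma exists_pot_eq_zero : ∃ R, (∀ x, ‖c x‖ < R) ∧ ∀ z, R ≤ ‖z‖ → pot c 0 z = 0 := by
  obtain ⟨M, -, hM⟩ := exists_bound_of_periodic hc.cont hc.per
  refine ⟨M + 1, fun x => (hM x).trans_lt (by linarith), fun z hz => ?_⟩
  have hM0 : 0 ≤ M := (norm_nonneg _).trans (hM 0)
  have hz0 : z ≠ 0 := by
    intro h; rw [h, norm_zero] at hz; linarith
  have hlt : ∀ x, ‖c x / z‖ < 1 := by
    intro x
    rw [norm_div, div_lt_one (by linarith)]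
    linarith [hM x]
  have hne : ∀ x, c x - z ≠ 0 := by
    intro x h
    have := hM x
    rw [sub_eq_zero.1 h] at this
    linarith
  have hcont : Continuous fun x => deriv c x / (c x - z) :=
    hc.cont_deriv.div (hc.cont.sub continuous_const) hne
  have hInt : ∫ x in 0..2 * π, deriv c x / (c x - z) = 0 := by
    have hd : ∀ x ∈ uIcc 0 (2 * π), HasDerivAt (fun x => Complex.log (1 - c x / z))
        (deriv c x / (c x - z)) x := by
      intro x _
      have hs : 1 - c x / z ∈ Complex.slitPlane := by
        refine Or.inl ?_
        have := (Complex.abs_re_le_norm (c x / z)).trans_lt (hlt x)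
        rw [Complex.sub_re, Complex.one_re]
        linarith [le_abs_self (c x / z).re]
      have h := (((hc.hasDerivAt x).div_const z).const_sub 1).clog_real hs
      convert! h using 1
      have h1 := hne x
      have h2 : z - c x ≠ 0 := fun h => h1 (by rw [← neg_sub, h, neg_zero])
      rw [one_sub_div hz0]
      field_simp
      rw [← neg_sub z (c x)]
      field_simp
    rw [intervalIntegral.integral_eq_sub_of_hasDerivAt hd (hcont.intervalIntegrable _ _)]
    have := hc.per 0
    rw [zero_add] at this
    simp [this]
  unfold pot
  simp_rw [kern_zero_eq]
  have h1 := Complex.imCLM.intervalIntegral_comp_comm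
    (hcont.intervalIntegrable (μ := volume) 0 (2 * π))
  simp only [Complex.imCLM_apply] at h1
  rw [h1, hInt]
  simp

lemma integrable_pot_mul {g : ℂ → ℂ} (hg : Continuous g) :
    Integrable fun z => (pot c 0 z : ℂ) * g z := by
  obtain ⟨R, -, hR⟩ := hc.exists_pot_eq_zero
  obtain ⟨B, -, hB⟩ := hc.exists_pot_bound
  have h : IntegrableOn (fun z => (pot c 0 z : ℂ) * g z) (closedBall 0 R) := by
    refine Integrable.bdd_mul (c := B)
      (hg.continuousOn.integrableOn_compact (isCompact_closedBall 0 R)) ?_ ?_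
    · exact (Complex.measurable_ofReal.comp (hc.measurable_pot 0)).aestronglyMeasurable
    · refine Eventually.of_forall fun z => ?_
      rw [Complex.norm_real]
      exact hB 0 z
  refine (integrableOn_iff_integrable_of_support_subset fun z hz => ?_).1 h
  by_contra hz'
  refine hz ?_
  simp only [mem_closedBall, dist_zero_right, not_le] at hz'
  simp [hR z hz'.le]

lemma integrable_pot : Integrable (pot c 0) := by
  have := (hc.integrable_pot_mul continuous_const (g := fun _ => 1)).re
  simpa using this

lemma green {f : ℂ → ℂ} (hf : ContDiff ℝ 1 f) :
    ∫ x in 0..2 * π, f (c x) * deriv c x = ∫ z, (pot c 0 z : ℂ) * dbar2 f z := by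
  obtain ⟨R, hR1, hR⟩ := hc.exists_pot_eq_zero
  have hR0 : 0 < R := (norm_nonneg _).trans_lt (hR1 0)
  let φ : ContDiffBump (0 : ℂ) := ⟨R, R + 1, hR0, by linarith⟩
  have h1 : ∀ z, ‖z‖ < R → (fun z => (φ z : ℂ) * f z) =ᶠ[𝓝 z] f := by
    intro z hz
    filter_upwards [isOpen_ball.mem_nhds (mem_ball_zero_iff.2 hz)] with y hy
    have : φ y = 1 := φ.one_of_mem_closedBall (ball_subset_closedBall hy)
    simp [this]
  have h2 := hc.green_compact (f := fun z => (φ z : ℂ) * f z)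
    ((Complex.ofRealCLM.contDiff.comp φ.contDiff).mul hf)
    (φ.hasCompactSupport.comp_left (g := ((↑) : ℝ → ℂ)) rfl).mul_right
  have h3 : ∀ x, (φ (c x) : ℂ) * f (c x) = f (c x) := fun x => (h1 _ (hR1 x)).self_of_nhds
  simp_rw [h3] at h2
  rw [h2]
  refine integral_congr_ae (Eventually.of_forall fun z => ?_)
  simp only
  by_cases hz : ‖z‖ < R
  · rw [dbar2_congr (h1 z hz)]
  · rw [hR z (not_lt.1 hz)]
    simp

lemma pot_eq_integral {ε : ℝ} (hε : 0 < ε) (q : ℂ) :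
    pot c ε q = ∫ z, pot c 0 z * rho ε (z - q) := by
  have h := hc.green (contDiff_cauchyK hε.ne' q)
  rw [hc.integral_cauchyK hε] at h
  simp_rw [dbar2_cauchyK hε.ne'] at h
  have h' : ∫ z, (pot c 0 z : ℂ) * (2 * π * Complex.I * (rho ε (z - q) : ℝ)) =
      2 * π * Complex.I * ((∫ z, pot c 0 z * rho ε (z - q) : ℝ) : ℂ) := by
    rw [← integral_complex_ofReal, ← integral_const_mul]
    exact integral_congr_ae (Eventually.of_forall fun z => by push_cast; ring)
  rw [h'] at h
  exact_mod_cast mul_left_cancel₀ Complex.two_pi_I_ne_zero h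

end IsSimpleClosed

section Parametric
variable {E G : Type*} [NormedAddCommGroup E] [NormedSpace ℝ E] [FiniteDimensional ℝ E]
  [NormedAddCommGroup G] [NormedSpace ℝ G]

lemma hasFDerivAt_intervalIntegral {f : E × ℝ → G} (hf : ContDiff ℝ 1 f) (a b : ℝ) (z : E) :
    HasFDerivAt (fun z => ∫ x in a..b, f (z, x))
      (∫ x in a..b, (fderiv ℝ f (z, x)).comp (ContinuousLinearMap.inl ℝ E ℝ)) z := by
  have : ProperSpace E := FiniteDimensional.proper ℝ E
  have hf' := hf.continuous_fderiv one_ne_zero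
  have hcf := hf.continuous
  have hcont : Continuous fun p : E × ℝ =>
      (fderiv ℝ f p).comp (ContinuousLinearMap.inl ℝ E ℝ) := hf'.clm_comp continuous_const
  obtain ⟨C, hC⟩ := ((isCompact_closedBall z 1).prod (isCompact_uIcc
    (a := a) (b := b))).exists_bound_of_continuousOn
    hcont.continuousOn
  refine intervalIntegral.hasFDerivAt_integral_of_dominated_of_fderiv_le
    (F := fun z x => f (z, x))
    (F' := fun z x => (fderiv ℝ f (z, x)).comp (ContinuousLinearMap.inl ℝ E ℝ))
    (bound := fun _ => C) (closedBall_mem_nhds z one_pos) ?_ ?_ ?_ ?_ ?_ ?_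
  · exact Eventually.of_forall fun y => (Continuous.aestronglyMeasurable (by fun_prop))
  · exact Continuous.intervalIntegrable (by fun_prop) _ _
  · exact (hcont.comp (by fun_prop : Continuous fun x : ℝ => (z, x))).aestronglyMeasurable
  · exact Eventually.of_forall fun x hx y hy => hC (y, x) ⟨hy, uIoc_subset_uIcc hx⟩
  · exact intervalIntegrable_const
  · refine Eventually.of_forall fun x _ y _ => ?_
    exact ((hf.differentiable one_ne_zero (y, x)).hasFDerivAt).comp y (hasFDerivAt_prodMk_left y x)

lemma contDiff_intervalIntegral {f : E × ℝ → G} (hf : ContDiff ℝ 1 f) (a b : ℝ) :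
    ContDiff ℝ 1 (fun z => ∫ x in a..b, f (z, x)) := by
  have hf' := hf.continuous_fderiv one_ne_zero
  rw [contDiff_one_iff_fderiv]
  refine ⟨fun z => (hasFDerivAt_intervalIntegral hf a b z).differentiableAt, ?_⟩
  have h : fderiv ℝ (fun z => ∫ x in a..b, f (z, x)) =
      fun z => ∫ x in a..b, (fderiv ℝ f (z, x)).comp (ContinuousLinearMap.inl ℝ E ℝ) :=
    funext fun z => (hasFDerivAt_intervalIntegral hf a b z).fderiv
  rw [h]
  exact intervalIntegral.continuous_parametric_intervalIntegral_of_continuous'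
    (f := fun z x => (fderiv ℝ f (z, x)).comp (ContinuousLinearMap.inl ℝ E ℝ))
    (hf'.clm_comp continuous_const) a b

lemma fderiv_intervalIntegral_apply {f : E × ℝ → G} (hf : ContDiff ℝ 1 f) (a b : ℝ) (z v : E) :
    fderiv ℝ (fun z => ∫ x in a..b, f (z, x)) z v =
      ∫ x in a..b, fderiv ℝ (fun y => f (y, x)) z v := by
  have hf' := hf.continuous_fderiv one_ne_zero
  have h1 : ∀ x, fderiv ℝ (fun y => f (y, x)) z =
      (fderiv ℝ f (z, x)).comp (ContinuousLinearMap.inl ℝ E ℝ) := fun x =>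
    (((hf.differentiable one_ne_zero (z, x)).hasFDerivAt).comp z
      (hasFDerivAt_prodMk_left z x)).fderiv
  simp_rw [h1]
  rw [(hasFDerivAt_intervalIntegral hf a b z).fderiv]
  refine ContinuousLinearMap.intervalIntegral_apply (𝕜 := ℝ) (φ := fun x =>
    (fderiv ℝ f (z, x)).comp (ContinuousLinearMap.inl ℝ E ℝ)) ?_ v
  refine Continuous.intervalIntegrable ?_ _ _
  exact (hf'.comp (by fun_prop : Continuous fun x : ℝ => (z, x))).clm_comp continuous_const

end Parametric

lemma fderiv_kern (c : ℝ → ℂ) {ε : ℝ} (hε : ε ≠ 0) (x : ℝ) (z v : ℂ) :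
    HasFDerivAt (fun z => kern c ε z x) (fderiv ℝ (fun z => kern c ε z x) z) z ∧
    fderiv ℝ (fun z => kern c ε z x) z v =
      (-(conj v * deriv c x).im * (Complex.normSq (c x - z) + ε ^ 2) +
        (conj (c x - z) * deriv c x).im * (2 * (conj (c x - z) * v).re)) /
        (Complex.normSq (c x - z) + ε ^ 2) ^ 2 := by
  have hk : (fun z => kern c ε z x) = fun z => -(cauchyK ε (c x) z * deriv c x).im := by
    funext z
    rw [← cauchyK_mul_im, cauchyK_symm]
    simp
  have hd : ContDiff ℝ 1 (fun z => kern c ε z x) := by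
    rw [hk]
    exact (Complex.imCLM.contDiff.comp
      ((contDiff_cauchyK hε (c x) (n := 1)).mul contDiff_const)).neg
  have h1 := (hd.differentiable one_ne_zero z).hasFDerivAt
  refine ⟨h1, ?_⟩
  have hK := ((contDiff_cauchyK hε (c x) (n := 1)).differentiable one_ne_zero z).hasFDerivAt
  have h2 := (Complex.imCLM.hasFDerivAt.comp z (hK.mul_const (deriv c x))).neg
  have h3 : fderiv ℝ (fun z => kern c ε z x) z v =
      -(fderiv ℝ (cauchyK ε (c x)) z v * deriv c x).im := by
    rw [hk, show (fun z => -(cauchyK ε (c x) z * deriv c x).im) =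
      -(Complex.imCLM ∘ fun z => cauchyK ε (c x) z * deriv c x) from rfl, h2.fderiv]
    simp [mul_comm]
  rw [h3, fderiv_cauchyK hε, ← neg_sub z (c x), Complex.normSq_neg]
  have h0 : Complex.normSq (z - c x) + ε ^ 2 ≠ 0 := (normSq_add_sq_pos hε _).ne'
  set D := Complex.normSq (z - c x) + ε ^ 2 with hD
  rw [div_mul_eq_mul_div, ← Complex.ofReal_pow, Complex.div_ofReal_im, ← neg_div]
  congr 1
  set a := z - c x
  simp
  ring

lemma dbar2_ofReal {f : ℂ → ℝ} {z : ℂ} (hf : DifferentiableAt ℝ f z) :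
    dbar2 (fun z => (f z : ℂ)) z =
      Complex.I * (fderiv ℝ f z 1 : ℝ) - (fderiv ℝ f z Complex.I : ℝ) := by
  unfold dbar2
  have := (Complex.ofRealCLM.hasFDerivAt (x := f z)).comp z hf.hasFDerivAt
  rw [show (fun z => (f z : ℂ)) = Complex.ofRealCLM ∘ f from rfl, this.fderiv]
  simp

namespace IsSimpleClosed
variable {c : ℝ → ℂ} (hc : IsSimpleClosed c)
include hc

lemma contDiff_kern {ε : ℝ} (hε : ε ≠ 0) : ContDiff ℝ 1 fun p : ℂ × ℝ => kern c ε p.1 p.2 := by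
  have hk : (fun p : ℂ × ℝ => kern c ε p.1 p.2) =
      fun p => (cauchyK ε p.1 (c p.2) * deriv c p.2).im := by
    funext p
    rw [← cauchyK_mul_im]
  rw [hk]
  have h1 : ContDiff ℝ 1 fun p : ℂ × ℝ => c p.2 :=
    (hc.smooth.of_le one_le_two).comp contDiff_snd
  have h2 : ContDiff ℝ 1 fun p : ℂ × ℝ => deriv c p.2 := hc.contDiff_deriv.comp contDiff_snd
  exact Complex.imCLM.contDiff.comp
    (((contDiff_cauchyK_uncurry hε (n := 1)).comp (contDiff_fst.prodMk h1)).mul h2)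

lemma contDiff_pot {ε : ℝ} (hε : ε ≠ 0) : ContDiff ℝ 1 (pot c ε) :=
  contDiff_const.mul (contDiff_intervalIntegral (hc.contDiff_kern hε) 0 (2 * π))

lemma dbar2_pot {ε : ℝ} (hε : ε ≠ 0) (z : ℂ) :
    dbar2 (fun z => (pot c ε z : ℂ)) z =
      -∫ x in 0..2 * π, (rho ε (z - c x) : ℂ) * deriv c x := by
  have hcd := hc.contDiff_kern hε
  rw [dbar2_ofReal ((hc.contDiff_pot hε).differentiable one_ne_zero z)]
  have h1 : ∀ v, fderiv ℝ (pot c ε) z v = (2 * π)⁻¹ *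
      ∫ x in 0..2 * π, fderiv ℝ (fun y => kern c ε y x) z v := by
    intro v
    rw [← fderiv_intervalIntegral_apply hcd]
    have h2 := (hasFDerivAt_intervalIntegral hcd 0 (2 * π) z).const_mul (2 * π)⁻¹
    rw [show pot c ε = fun z => (2 * π)⁻¹ * ∫ x in 0..2 * π, kern c ε z x from rfl, h2.fderiv,
      (hasFDerivAt_intervalIntegral hcd 0 (2 * π) z).fderiv]
    simp
  have hci : ∀ v, Continuous fun x => fderiv ℝ (fun y => kern c ε y x) z v := by
    intro v
    simp_rw [fun x => (fderiv_kern c hε x z v).2]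
    have := hc.cont
    have := hc.cont_deriv
    refine Continuous.div ?_ ?_ fun x => ?_
    · fun_prop
    · fun_prop
    · have := normSq_add_sq_pos hε (c x - z)
      positivity
  rw [h1, h1]
  set N : ℝ → ℂ := fun x => c x - z with hN
  set D : ℝ → ℝ := fun x => Complex.normSq (N x) + ε ^ 2 with hD
  have hD0 : ∀ x, D x ≠ 0 := fun x => (normSq_add_sq_pos hε _).ne'
  have hNd : ∀ x, HasDerivAt N (deriv c x) x := fun x => (hc.hasDerivAt x).sub_const z
  have hDd : ∀ x, HasDerivAt D (2 * (conj (N x) * deriv c x).re) x := by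
    intro x
    have hr : HasDerivAt (fun x => (N x).re) (deriv c x).re x :=
      Complex.reCLM.hasFDerivAt.comp_hasDerivAt x (hNd x)
    have hm : HasDerivAt (fun x => (N x).im) (deriv c x).im x :=
      Complex.imCLM.hasFDerivAt.comp_hasDerivAt x (hNd x)
    have h3 := (((hr).pow 2).add ((hm).pow 2)).add_const (ε ^ 2)
    convert! h3 using 1
    · funext y; simp [D, Complex.normSq_apply]; ring
    · simp; ring
  set Q : ℝ → ℂ := fun x =>
    (deriv c x * (D x : ℂ) - N x * ((2 * (conj (N x) * deriv c x).re : ℝ) : ℂ)) /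
    (D x : ℂ) ^ 2 with hQ
  have hQd : ∀ x, HasDerivAt (fun x => N x / (D x : ℂ)) (Q x) x := fun x =>
    (hNd x).div (hDd x).ofReal_comp (by exact_mod_cast hD0 x)
  have hQc : Continuous Q := by
    have := hc.cont
    have := hc.cont_deriv
    refine Continuous.div ?_ ?_ fun x => ?_
    · fun_prop
    · fun_prop
    · exact_mod_cast pow_ne_zero 2 (hD0 x)
  have hQi : ∫ x in 0..2 * π, Q x = 0 := by
    rw [intervalIntegral.integral_eq_sub_of_hasDerivAt (fun x _ => hQd x)
      (hQc.intervalIntegrable _ _)]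
    have := hc.per 0
    rw [zero_add] at this
    simp [N, D, this]
  have hpt : ∀ x, Complex.I * (fderiv ℝ (fun y => kern c ε y x) z 1 : ℝ) -
      (fderiv ℝ (fun y => kern c ε y x) z Complex.I : ℝ) =
      Q x - 2 * π * ((rho ε (z - c x) : ℂ) * deriv c x) := by
    intro x
    rw [(fderiv_kern c hε x z 1).2, (fderiv_kern c hε x z Complex.I).2]
    have h2 : ((rho ε (z - c x) : ℝ) : ℂ) = (ε : ℂ) ^ 2 / (π * (D x : ℂ) ^ 2) := by
      rw [← neg_sub, rho_neg]
      simp [rho, D, N]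
    have hDc : (D x : ℂ) ≠ 0 := by exact_mod_cast hD0 x
    have hpi : (π : ℂ) ≠ 0 := by exact_mod_cast pi_ne_zero
    have hDe : (D x : ℂ) = (N x).re ^ 2 + (N x).im ^ 2 + (ε : ℂ) ^ 2 := by
      simp [D, Complex.normSq_apply]; ring
    rw [h2, show c x - z = N x from rfl, show Complex.normSq (N x) + ε ^ 2 = D x from rfl]
    simp only [hQ]
    push_cast
    field_simp
    rw [hDe]
    apply Complex.ext <;> simp [pow_two] <;> ring
  have i1 : ∀ v, IntervalIntegrable (fun x => ((fderiv ℝ (fun y => kern c ε y x) z v : ℝ) : ℂ))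
      volume 0 (2 * π) := fun v =>
    ((Complex.continuous_ofReal.comp (hci v)).intervalIntegrable (μ := volume) 0 (2 * π))
  have hrc : Continuous fun x => (rho ε (z - c x) : ℂ) * deriv c x := by
    have := hc.cont
    have := hc.cont_deriv
    have := continuous_rho hε
    fun_prop
  have e : Complex.I * ((∫ x in 0..2 * π, fderiv ℝ (fun y => kern c ε y x) z 1 : ℝ) : ℂ) -
      ((∫ x in 0..2 * π, fderiv ℝ (fun y => kern c ε y x) z Complex.I : ℝ) : ℂ) =
      -(2 * π * ∫ x in 0..2 * π, (rho ε (z - c x) : ℂ) * deriv c x) := by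
    rw [← intervalIntegral.integral_ofReal, ← intervalIntegral.integral_ofReal,
      ← intervalIntegral.integral_const_mul, ← intervalIntegral.integral_sub
      ((i1 1).const_mul _) (i1 _)]
    simp only [hpt]
    rw [intervalIntegral.integral_sub (hQc.intervalIntegrable _ _)
      ((hrc.intervalIntegrable _ _).const_mul _), hQi, intervalIntegral.integral_const_mul]
    ring
  have hpi : (π : ℂ) ≠ 0 := by exact_mod_cast pi_ne_zero
  push_cast
  rw [← mul_right_inj' (show (2 * π : ℂ) ≠ 0 by simp [hpi]), mul_neg, ← e]
  field_simp

end IsSimpleClosed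

lemma rho_le {ε : ℝ} (hε : 0 < ε) (ζ : ℂ) : rho ε ζ ≤ (π * ε ^ 2)⁻¹ := by
  have := Complex.normSq_nonneg ζ
  have := pi_pos
  unfold rho
  rw [← one_div, div_le_div_iff₀ (by positivity) (by positivity), one_mul]
  have : (ε ^ 2) ^ 2 ≤ (Complex.normSq ζ + ε ^ 2) ^ 2 := by gcongr; linarith
  nlinarith

lemma norm_integral_mul_rho_le {g : ℂ → ℂ} {A : ℝ} (hA : ∀ z, ‖g z‖ ≤ A)
    {ε : ℝ} (hε : 0 < ε) (q : ℂ) :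
    ‖∫ z, g z * (rho ε (z - q) : ℝ)‖ ≤ A := by
  have h6 : ‖∫ z, g z * (rho ε (z - q) : ℝ)‖ ≤ ∫ z, A * rho ε (z - q) := by
    refine norm_integral_le_of_norm_le ((integrable_rho hε _).const_mul A)
      (Eventually.of_forall fun z => ?_)
    rw [norm_mul, Complex.norm_real, Real.norm_eq_abs, abs_of_nonneg (rho_nonneg _ _)]
    have := hA z
    have := rho_nonneg ε (z - q)
    gcongr
  rwa [integral_const_mul, integral_rho hε, mul_one] at h6

namespace IsSimpleClosed
variable {c d : ℝ → ℂ} (hc : IsSimpleClosed c) (hd : IsSimpleClosed d)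

include hc in
/-- Sup bound for the weights `pot c 0 * g`. -/
lemma exists_bound_pot_mul {g : ℂ → ℂ} (hg : Continuous g) :
    ∃ A, 0 ≤ A ∧ ∀ z, ‖(pot c 0 z : ℂ) * g z‖ ≤ A := by
  obtain ⟨R, -, hR⟩ := hc.exists_pot_eq_zero
  obtain ⟨B, hB0, hB⟩ := hc.exists_pot_bound
  obtain ⟨C, hC⟩ := (isCompact_closedBall (0 : ℂ) R).exists_bound_of_continuousOn hg.continuousOn
  refine ⟨B * max C 0, by positivity, fun z => ?_⟩
  by_cases hz : ‖z‖ ≤ R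
  · rw [norm_mul, Complex.norm_real]
    have h1 := hB 0 z
    have h2 := (hC z (mem_closedBall_zero_iff.2 hz)).trans (le_max_left C 0)
    exact mul_le_mul h1 h2 (norm_nonneg _) hB0
  · rw [hR z (not_le.1 hz).le]
    simp
    positivity

include hc in
lemma tendsto_integral_pot_mul_rho {g : ℂ → ℂ} (hg : Continuous g) (q : ℂ) :
    Tendsto (fun ε => ∫ z, (pot c 0 z : ℂ) * g z * (rho ε (z - q) : ℝ)) (𝓝[>] 0)
      (𝓝 ((pot c 0 q : ℂ) * g q)) := by
  obtain ⟨B, hB0, hB⟩ := hc.exists_pot_bound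
  have hi : Integrable fun z => (pot c 0 z : ℂ) * (g z - g q) :=
    hc.integrable_pot_mul (hg.sub continuous_const)
  have hca : ContinuousAt (fun z => (pot c 0 z : ℂ) * (g z - g q)) q := by
    unfold ContinuousAt
    simp only [sub_self, mul_zero]
    have h1 : Tendsto (fun z => g z - g q) (𝓝 q) (𝓝 0) := by
      have : Tendsto (fun z => g z - g q) (𝓝 q) (𝓝 (g q - g q)) :=
        (hg.tendsto q).sub tendsto_const_nhds
      rwa [sub_self] at this
    refine squeeze_zero_norm (a := fun z => B * ‖g z - g q‖) (fun z => ?_) ?_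
    · rw [norm_mul, Complex.norm_real]
      exact mul_le_mul_of_nonneg_right (hB 0 z) (norm_nonneg _)
    · simpa using h1.norm.const_mul B
  have h1 := tendsto_integral_rho hi hca
  rw [sub_self, mul_zero] at h1
  have h2 : Tendsto (fun ε => (pot c ε q : ℂ) * g q) (𝓝[>] 0) (𝓝 ((pot c 0 q : ℂ) * g q)) :=
    (((Complex.continuous_ofReal.tendsto _).comp (hc.tendsto_pot q))).mul_const _
  have h3 := h1.add h2
  rw [zero_add] at h3
  refine h3.congr' ?_
  filter_upwards [self_mem_nhdsWithin] with ε hε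
  have hε0 : (0 : ℝ) < ε := hε
  have hb : ∀ {W : ℂ → ℂ}, Integrable W → Integrable fun z => W z * (rho ε (z - q) : ℝ) := by
    intro W hW
    refine hW.mul_bdd (c := (π * ε ^ 2)⁻¹) ?_ ?_
    · have := continuous_rho hε0.ne'
      exact (by fun_prop : Continuous fun z => (rho ε (z - q) : ℂ)).aestronglyMeasurable
    · refine Eventually.of_forall fun z => ?_
      rw [Complex.norm_real, Real.norm_eq_abs, abs_of_nonneg (rho_nonneg _ _)]
      exact rho_le hε0 _
  rw [hc.pot_eq_integral hε0 q, ← integral_complex_ofReal, ← integral_mul_const, ← integral_add]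
  · refine integral_congr_ae (Eventually.of_forall fun z => ?_)
    simp only [Complex.real_smul]
    push_cast
    ring
  · exact (hb hi).congr (Eventually.of_forall fun z => by simp only [Complex.real_smul]; ring)
  · refine ((hb (hc.integrable_pot_mul continuous_const (g := fun _ => 1))).mul_const (g q)).congr
      (Eventually.of_forall fun z => by push_cast; ring)

include hc hd

lemma star_eps {ε : ℝ} (hε : 0 < ε) {f : ℂ → ℂ} (hf : ContDiff ℝ 1 f) :
    (∫ x in 0..2 * π, (pot c ε (d x) : ℂ) * f (d x) * deriv d x) +
      ∫ x in 0..2 * π, (∫ z, (pot d 0 z : ℂ) * f z * (rho ε (z - c x) : ℝ)) * deriv c x =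
      ∫ z, (pot d 0 z : ℂ) * ((pot c ε z : ℂ) * dbar2 f z) := by
  have hp : ContDiff ℝ 1 fun z => (pot c ε z : ℂ) :=
    Complex.ofRealCLM.contDiff.comp (hc.contDiff_pot hε.ne')
  have hg := hd.green (hp.mul hf)
  have hdb : ∀ z, dbar2 (fun z => (pot c ε z : ℂ) * f z) z = (pot c ε z : ℂ) * dbar2 f z +
      dbar2 (fun z => (pot c ε z : ℂ)) z * f z := fun z =>
    dbar2_mul (hp.differentiable one_ne_zero z) (hf.differentiable one_ne_zero z)
  have i1 : Integrable fun z => (pot d 0 z : ℂ) * ((pot c ε z : ℂ) * dbar2 f z) :=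
    hd.integrable_pot_mul (hp.continuous.mul (continuous_dbar2 hf))
  have i2 : Integrable fun z => (pot d 0 z : ℂ) * (dbar2 (fun z => (pot c ε z : ℂ)) z * f z) :=
    hd.integrable_pot_mul ((continuous_dbar2 hp).mul hf.continuous)
  obtain ⟨M, hM0, hM⟩ := exists_bound_of_periodic hc.cont_deriv hc.per_deriv
  have hsw := integral_swap_interval (hd.integrable_pot_mul hf.continuous)
    (g := fun z x => (rho ε (z - c x) : ℂ) * deriv c x) (a := 0) (b := 2 * π)
    (C := (π * ε ^ 2)⁻¹ * M) ?_ ?_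
  rotate_left
  · have := hc.cont
    have := hc.cont_deriv
    have := continuous_rho hε.ne'
    fun_prop
  · intro z x _ _
    rw [norm_mul, Complex.norm_real, Real.norm_eq_abs, abs_of_nonneg (rho_nonneg _ _)]
    have h3 := rho_le hε (z - c x)
    have h4 := hM x
    gcongr
  rw [hg]
  simp_rw [hdb, mul_add]
  rw [integral_add i1 i2]
  have e : ∫ z, (pot d 0 z : ℂ) * (dbar2 (fun z => (pot c ε z : ℂ)) z * f z) =
      -∫ x in 0..2 * π, (∫ z, (pot d 0 z : ℂ) * f z * (rho ε (z - c x) : ℝ)) * deriv c x := by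
    simp_rw [← integral_mul_const, mul_assoc]
    simp_rw [mul_assoc] at hsw
    rw [← hsw, ← integral_neg]
    refine integral_congr_ae (Eventually.of_forall fun z => ?_)
    simp only
    rw [hc.dbar2_pot hε.ne']
    ring
  rw [e]
  ring

lemma star {f : ℂ → ℂ} (hf : ContDiff ℝ 1 f) :
    (∫ x in 0..2 * π, (pot c 0 (d x) : ℂ) * f (d x) * deriv d x) +
      ∫ x in 0..2 * π, (pot d 0 (c x) : ℂ) * f (c x) * deriv c x =
      ∫ z, (pot c 0 z : ℂ) * pot d 0 z * dbar2 f z := by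
  obtain ⟨B, hB0, hB⟩ := hc.exists_pot_bound
  obtain ⟨A, hA0, hA⟩ := hd.exists_bound_pot_mul hf.continuous
  obtain ⟨M, hM0, hM⟩ := exists_bound_of_periodic hc.cont_deriv hc.per_deriv
  have l1 : Tendsto (fun ε => ∫ x in 0..2 * π, (pot c ε (d x) : ℂ) * f (d x) * deriv d x) (𝓝[>] 0)
      (𝓝 (∫ x in 0..2 * π, (pot c 0 (d x) : ℂ) * f (d x) * deriv d x)) := by
    have hcont : Continuous fun x => f (d x) * deriv d x :=
      (hf.continuous.comp hd.cont).mul hd.cont_deriv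
    refine intervalIntegral.tendsto_integral_filter_of_dominated_convergence
      (fun x => B * ‖f (d x) * deriv d x‖) ?_ ?_ ?_ ?_
    · refine Eventually.of_forall fun ε => ?_
      simp_rw [mul_assoc]
      refine AEStronglyMeasurable.mul ?_ hcont.aestronglyMeasurable
      exact (Complex.measurable_ofReal.comp
        ((hc.measurable_pot ε).comp hd.cont.measurable)).aestronglyMeasurable
    · refine Eventually.of_forall fun ε => Eventually.of_forall fun x _ => ?_
      rw [mul_assoc, norm_mul, Complex.norm_real]
      exact mul_le_mul_of_nonneg_right (hB ε _) (norm_nonneg _)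
    · exact (hcont.norm.const_mul B : Continuous _).intervalIntegrable _ _
    · refine Eventually.of_forall fun x _ => Tendsto.mul_const _ (Tendsto.mul_const _ ?_)
      exact (Complex.continuous_ofReal.tendsto _).comp (hc.tendsto_pot _)
  have l2 : Tendsto (fun ε => ∫ x in 0..2 * π,
      (∫ z, (pot d 0 z : ℂ) * f z * (rho ε (z - c x) : ℝ)) * deriv c x) (𝓝[>] 0)
      (𝓝 (∫ x in 0..2 * π, (pot d 0 (c x) : ℂ) * f (c x) * deriv c x)) := by
    refine intervalIntegral.tendsto_integral_filter_of_dominated_convergence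
      (fun x => A * M) ?_ ?_ ?_ ?_
    · filter_upwards [self_mem_nhdsWithin] with ε hε
      have hε0 : (0 : ℝ) < ε := hε
      refine AEStronglyMeasurable.mul ?_ hc.cont_deriv.aestronglyMeasurable
      refine StronglyMeasurable.aestronglyMeasurable ?_
      refine StronglyMeasurable.integral_prod_right
        (f := fun x z => (pot d 0 z : ℂ) * f z * (rho ε (z - c x) : ℝ)) ?_
      refine Measurable.stronglyMeasurable ?_
      refine Measurable.mul (Measurable.mul ?_ ?_) ?_
      · exact Complex.measurable_ofReal.comp ((hd.measurable_pot 0).comp measurable_snd)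
      · exact (hf.continuous.comp continuous_snd).measurable
      · have := hc.cont
        have := continuous_rho hε0.ne'
        exact (by fun_prop : Continuous fun p : ℝ × ℂ => (rho ε (p.2 - c p.1) : ℂ)).measurable
    · filter_upwards [self_mem_nhdsWithin] with ε hε
      refine Eventually.of_forall fun x _ => ?_
      rw [norm_mul]
      have h1 := norm_integral_mul_rho_le hA hε (c x)
      have h2 := hM x
      gcongr
    · exact intervalIntegrable_const
    · refine Eventually.of_forall fun x _ => Tendsto.mul_const _ ?_
      exact hd.tendsto_integral_pot_mul_rho hf.continuous _
  have l3 : Tendsto (fun ε => ∫ z, (pot d 0 z : ℂ) * ((pot c ε z : ℂ) * dbar2 f z)) (𝓝[>] 0)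
      (𝓝 (∫ z, (pot c 0 z : ℂ) * pot d 0 z * dbar2 f z)) := by
    have hi := hd.integrable_pot_mul (continuous_dbar2 hf)
    have e : ∀ ε z, (pot d 0 z : ℂ) * ((pot c ε z : ℂ) * dbar2 f z) =
      (pot c ε z : ℂ) * ((pot d 0 z : ℂ) * dbar2 f z) := fun ε z => by ring
    simp_rw [e, mul_assoc]
    refine tendsto_integral_filter_of_dominated_convergence
      (fun z => B * ‖(pot d 0 z : ℂ) * dbar2 f z‖) ?_ ?_ ?_ ?_
    · refine Eventually.of_forall fun ε => ?_
      exact (Complex.measurable_ofReal.comp (hc.measurable_pot ε)).aestronglyMeasurable.mul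
        hi.aestronglyMeasurable
    · refine Eventually.of_forall fun ε => Eventually.of_forall fun z => ?_
      rw [norm_mul, Complex.norm_real]
      exact mul_le_mul_of_nonneg_right (hB ε z) (norm_nonneg _)
    · exact hi.norm.const_mul B
    · refine Eventually.of_forall fun z => Tendsto.mul_const _ ?_
      exact (Complex.continuous_ofReal.tendsto _).comp (hc.tendsto_pot z)
  refine tendsto_nhds_unique (l1.add l2) (l3.congr' ?_)
  filter_upwards [self_mem_nhdsWithin] with ε hε
  exact (hc.star_eps hd hε hf).symm

end IsSimpleClosed

/-- Joint continuity of the potential in the curve and in the point, away from the curve. -/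
lemma continuousAt_pot {X : Type*} [TopologicalSpace X] [FirstCountableTopology X]
    [LocallyCompactSpace X] {c : X → ℝ → ℂ} (hc : Continuous fun p : X × ℝ => c p.1 p.2)
    (hc' : Continuous fun p : X × ℝ => deriv (c p.1) p.2) {p : X × ℂ}
    (hp : p.2 ∉ range (c p.1)) : ContinuousAt (fun p : X × ℂ => pot (c p.1) 0 p.2) p := by
  have hN : Continuous fun q : (X × ℂ) × ℝ => Complex.normSq (c q.1.1 q.2 - q.1.2) := by
    have : Continuous fun q : (X × ℂ) × ℝ => c q.1.1 q.2 :=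
      hc.comp (by fun_prop : Continuous fun q : (X × ℂ) × ℝ => (q.1.1, q.2))
    fun_prop
  have hpos : ∀ x, 0 < Complex.normSq (c p.1 x - p.2) := fun x =>
    Complex.normSq_pos.2 (sub_ne_zero.2 fun h => hp ⟨x, h⟩)
  have hcx : Continuous fun x => Complex.normSq (c p.1 x - p.2) :=
    hN.comp (by fun_prop : Continuous fun x : ℝ => (p, x))
  obtain ⟨x₀, -, hx₀⟩ := (isCompact_uIcc (a := 0) (b := 2 * π)).exists_isMinOn
    (nonempty_uIcc) hcx.continuousOn
  set δ := Complex.normSq (c p.1 x₀ - p.2) / 2 with hδ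
  have hδ0 : 0 < δ := half_pos (hpos x₀)
  have hev : ∀ᶠ q in 𝓝 p, ∀ x ∈ uIcc 0 (2 * π), δ < Complex.normSq (c q.1 x - q.2) := by
    refine isCompact_uIcc.eventually_forall_of_forall_eventually fun x hx => ?_
    have h1 : δ < Complex.normSq (c p.1 x - p.2) := by
      have h2 : Complex.normSq (c p.1 x₀ - p.2) ≤ Complex.normSq (c p.1 x - p.2) := hx₀ hx
      have := hpos x₀
      linarith
    exact (hN.tendsto (p, x)).eventually_const_lt h1
  have hcont : Continuous fun q : X × ℂ => (2 * π)⁻¹ * ∫ x in 0..2 * π,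
      (conj (c q.1 x - q.2) * deriv (c q.1) x).im / max (Complex.normSq (c q.1 x - q.2)) δ := by
    refine continuous_const.mul <|
      (intervalIntegral.continuous_parametric_intervalIntegral_of_continuous'
      (f := fun (q : X × ℂ) x => (conj (c q.1 x - q.2) * deriv (c q.1) x).im /
        max (Complex.normSq (c q.1 x - q.2)) δ) ?_ _ _)
    have h1 : Continuous fun q : (X × ℂ) × ℝ => c q.1.1 q.2 :=
      hc.comp (by fun_prop : Continuous fun q : (X × ℂ) × ℝ => (q.1.1, q.2))
    have h2 : Continuous fun q : (X × ℂ) × ℝ => deriv (c q.1.1) q.2 :=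
      hc'.comp (by fun_prop : Continuous fun q : (X × ℂ) × ℝ => (q.1.1, q.2))
    unfold Function.uncurry
    refine Continuous.div (by fun_prop) (hN.max continuous_const) fun q => ?_
    exact (hδ0.trans_le (le_max_right _ _)).ne'
  refine hcont.continuousAt.congr ?_
  filter_upwards [hev] with q hq
  unfold pot kern
  congr 1
  refine intervalIntegral.integral_congr fun x hx => ?_
  rw [max_eq_left (hq x hx).le, zero_pow two_ne_zero, add_zero]

lemma eventually_notMem_image {X : Type*} [TopologicalSpace X] {c : X → ℝ → ℂ}
    (hc : Continuous fun p : X × ℝ => c p.1 p.2) {p : X × ℂ} {K : Set ℝ} (hK : IsCompact K)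
    (hp : p.2 ∉ c p.1 '' K) : ∀ᶠ q in 𝓝 p, q.2 ∉ c q.1 '' K := by
  have h : ∀ᶠ q in 𝓝 p, ∀ x ∈ K, c q.1 x ≠ q.2 := by
    refine hK.eventually_forall_of_forall_eventually fun x hx => ?_
    have h1 : Continuous fun q : (X × ℂ) × ℝ => c q.1.1 q.2 :=
      hc.comp (by fun_prop : Continuous fun q : (X × ℂ) × ℝ => (q.1.1, q.2))
    exact (isOpen_ne_fun h1 (by fun_prop : Continuous fun q : (X × ℂ) × ℝ => q.1.2)).mem_nhds
      fun h => hp ⟨x, hx, h⟩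
  filter_upwards [h] with q hq
  rintro ⟨x, hx, h⟩
  exact hq x hx h

/-- The jump of the potential across the curve. -/
def deg (c : ℝ → ℂ) : ℝ := 2 * pot c 0 (c 0)

namespace IsSimpleClosed
variable {c d : ℝ → ℂ} (hc : IsSimpleClosed c) (hd : IsSimpleClosed d)
include hc

lemma deg_ne_zero : deg c ≠ 0 := by
  obtain ⟨s, hs, -, h⟩ := hc.exists_pot_curve
  unfold deg; rw [h]; simpa using hs

lemma deg_int : ∃ n : ℤ, deg c = n := by
  obtain ⟨s, -, ⟨n, hn⟩, h⟩ := hc.exists_pot_curve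
  refine ⟨n, ?_⟩
  unfold deg; rw [h, ← hn]; ring

lemma pot_curve (x : ℝ) : pot c 0 (c x) = deg c / 2 := by
  obtain ⟨s, -, -, h⟩ := hc.exists_pot_curve
  unfold deg; rw [h, h]; ring

lemma continuousAt_pot {z : ℂ} (hz : z ∉ range c) : ContinuousAt (pot c 0) z := by
  have h := PlaneCurve.continuousAt_pot (X := Unit) (c := fun _ => c) (hc.cont.comp continuous_snd)
    (hc.cont_deriv.comp continuous_snd) (p := ((), z)) hz
  exact h.comp (f := fun w : ℂ => ((), w)) (by fun_prop)

lemma range_eq : range c = c '' Icc 0 (2 * π) := by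
  refine Subset.antisymm ?_ (image_subset_range _ _)
  rintro _ ⟨x, rfl⟩
  obtain ⟨y, hy, h⟩ := hc.per.exists_mem_Ico₀ (by positivity) x
  exact ⟨y, Ico_subset_Icc_self hy, h.symm⟩

lemma volume_range : volume (range c) = 0 := by
  have h0 : (volume : Measure ℂ) (LinearMap.ker Complex.imLm : Submodule ℝ ℂ) = 0 := by
    refine Measure.addHaar_submodule _ _ fun h => ?_
    have : (Complex.I) ∈ LinearMap.ker Complex.imLm := by rw [h]; trivial
    simp at this
  have h1 := addHaar_image_eq_zero_of_differentiableOn_of_addHaar_eq_zero volume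
    (f := fun z : ℂ => c z.re) (s := (LinearMap.ker Complex.imLm : Submodule ℝ ℂ)) ?_ h0
  · refine measure_mono_null ?_ h1
    rintro _ ⟨x, rfl⟩
    exact ⟨x, by simp, by simp⟩
  · have := hc.smooth.differentiable two_ne_zero
    exact (this.comp Complex.reCLM.differentiable).differentiableOn

lemma integrable_pot_mul_pot (hd : IsSimpleClosed d) {g : ℂ → ℂ} (hg : Continuous g) :
    Integrable fun z => (pot c 0 z : ℂ) * pot d 0 z * g z := by
  obtain ⟨B, hB0, hB⟩ := hc.exists_pot_bound
  simp_rw [mul_assoc]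
  refine (hd.integrable_pot_mul hg).bdd_mul (c := B)
    (Complex.measurable_ofReal.comp (hc.measurable_pot 0)).aestronglyMeasurable ?_
  refine Eventually.of_forall fun z => ?_
  rw [Complex.norm_real]
  exact hB 0 z

lemma pot_eq_or {z : ℂ} (hz : z ∉ range c) : pot c 0 z = 0 ∨ pot c 0 z = deg c := by
  have hk : ∀ δ > 0, ∫ y, rho δ (y - z) • (pot c 0 y * (pot c 0 y - deg c)) = 0 := by
    intro δ hδ
    have hf := contDiff_cauchyK hδ.ne' z (n := 1)
    have h1 := hc.star hc hf
    have h2 := hc.green hf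
    simp_rw [hc.pot_curve, mul_assoc] at h1
    rw [intervalIntegral.integral_const_mul, ← two_mul, h2] at h1
    simp_rw [dbar2_cauchyK hδ.ne'] at h1
    have e1 : ∫ y, (pot c 0 y : ℂ) * ((pot c 0 y : ℂ) * (2 * π * Complex.I * (rho δ (y - z) : ℝ))) =
        2 * π * Complex.I * ((∫ y, pot c 0 y * pot c 0 y * rho δ (y - z) : ℝ) : ℂ) := by
      rw [← integral_complex_ofReal, ← integral_const_mul]
      exact integral_congr_ae (Eventually.of_forall fun z => by push_cast; ring)
    have e2 : ∫ y, (pot c 0 y : ℂ) * (2 * π * Complex.I * (rho δ (y - z) : ℝ)) =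
        2 * π * Complex.I * ((∫ y, pot c 0 y * rho δ (y - z) : ℝ) : ℂ) := by
      rw [← integral_complex_ofReal, ← integral_const_mul]
      exact integral_congr_ae (Eventually.of_forall fun z => by push_cast; ring)
    rw [e1, e2] at h1
    have h3 : deg c * (∫ y, pot c 0 y * rho δ (y - z)) =
        ∫ y, pot c 0 y * pot c 0 y * rho δ (y - z) := by
      have h4 : (2 * π * Complex.I) * ((deg c : ℂ) * ((∫ y, pot c 0 y * rho δ (y - z) : ℝ) : ℂ)) =
        (2 * π * Complex.I) * ((∫ y, pot c 0 y * pot c 0 y * rho δ (y - z) : ℝ) : ℂ) := by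
        rw [← h1]; push_cast; ring
      exact_mod_cast mul_left_cancel₀ Complex.two_pi_I_ne_zero h4
    have hrc : Continuous fun y => (rho δ (y - z) : ℂ) := by
      have := continuous_rho hδ.ne'
      fun_prop
    have i1 : Integrable fun y => pot c 0 y * pot c 0 y * rho δ (y - z) := by
      have := (hc.integrable_pot_mul_pot hc hrc).re
      refine this.congr (Eventually.of_forall fun y => ?_)
      simp
    have i2 : Integrable fun y => pot c 0 y * rho δ (y - z) := by
      have := (hc.integrable_pot_mul hrc).re
      refine this.congr (Eventually.of_forall fun y => ?_)
      simp
    have h5 : ∫ y, rho δ (y - z) • (pot c 0 y * (pot c 0 y - deg c)) =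
        (∫ y, pot c 0 y * pot c 0 y * rho δ (y - z)) -
          deg c * ∫ y, pot c 0 y * rho δ (y - z) := by
      rw [← integral_const_mul, ← integral_sub i1 (i2.const_mul _)]
      refine integral_congr_ae (Eventually.of_forall fun y => ?_)
      simp only [smul_eq_mul]
      ring
    rw [h5, h3, sub_self]
  have hi : Integrable fun y => pot c 0 y * (pot c 0 y - deg c) := by
    have h1 := (hc.integrable_pot_mul_pot hc (continuous_const (y := (1 : ℂ)))).re
    have h2 := hc.integrable_pot.mul_const (deg c)
    refine (h1.sub h2).congr (Eventually.of_forall fun y => ?_)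
    simp
    ring
  have hca := hc.continuousAt_pot hz
  have hlim := tendsto_integral_rho hi (q := z) (hca.mul (hca.sub continuousAt_const))
  have h0 : pot c 0 z * (pot c 0 z - deg c) = 0 := by
    refine tendsto_nhds_unique hlim (tendsto_const_nhds.congr' ?_)
    filter_upwards [self_mem_nhdsWithin] with δ hδ
    exact (hk δ hδ).symm
  rcases mul_eq_zero.1 h0 with h | h
  · exact Or.inl h
  · exact Or.inr (by linarith)

lemma exists_pot_eq_deg : ∃ z, z ∉ range c ∧ pot c 0 z = deg c := by
  by_contra! h
  have h0 : pot c 0 =ᵐ[volume] 0 := by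
    have : ∀ᵐ z : ℂ, z ∉ range c := measure_eq_zero_iff_ae_notMem.1 hc.volume_range
    filter_upwards [this] with z hz
    exact (hc.pot_eq_or hz).resolve_right (h z hz)
  have h1 : ∀ ε > 0, pot c ε (c 0) = 0 := by
    intro ε hε
    rw [hc.pot_eq_integral hε]
    refine integral_eq_zero_of_ae ?_
    filter_upwards [h0] with z hz
    simp [hz]
  have h2 := hc.tendsto_pot (c 0)
  have h3 : pot c 0 (c 0) = 0 := by
    refine tendsto_nhds_unique h2 (tendsto_const_nhds.congr' ?_)
    filter_upwards [self_mem_nhdsWithin] with ε hε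
    exact (h1 ε hε).symm
  exact hc.deg_ne_zero (by simp [deg, h3])

end IsSimpleClosed

lemma deg_const {c : ℝ → ℝ → ℂ} (hc : Continuous fun p : ℝ × ℝ => c p.1 p.2)
    (hc' : Continuous fun p : ℝ × ℝ => deriv (c p.1) p.2) {s : Set ℝ} (hs : IsPreconnected s)
    (h : ∀ t ∈ s, IsSimpleClosed (c t)) {t₁ t₂ : ℝ} (h1 : t₁ ∈ s) (h2 : t₂ ∈ s) :
    deg (c t₁) = deg (c t₂) := by
  refine eq_of_continuousOn_of_int hs (f := fun t => deg (c t)) ?_ (fun t ht => (h t ht).deg_int)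
    h1 h2
  intro t ht
  obtain ⟨z, hz, hzd⟩ := (h t ht).exists_pot_eq_deg
  have hca : ContinuousAt (fun t => pot (c t) 0 z) t :=
    (continuousAt_pot hc hc' (p := (t, z)) hz).comp (f := fun t : ℝ => (t, z)) (by fun_prop)
  have hne : pot (c t) 0 z ≠ 0 := hzd ▸ (h t ht).deg_ne_zero
  have hoff : ∀ᶠ t' in 𝓝 t, z ∉ c t' '' Icc 0 (2 * π) := by
    have := eventually_notMem_image hc (p := (t, z)) (isCompact_Icc (a := 0) (b := 2 * π))
      (by rwa [← (h t ht).range_eq])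
    exact (by fun_prop : Continuous fun t : ℝ => (t, z)).continuousAt.eventually this
  have : ∀ᶠ t' in 𝓝[s] t, pot (c t') 0 z = deg (c t') := by
    filter_upwards [nhdsWithin_le_nhds (hca.eventually_ne hne), self_mem_nhdsWithin,
      nhdsWithin_le_nhds hoff] with t' h1 h2 h3
    exact ((h t' h2).pot_eq_or (by rwa [(h t' h2).range_eq])).resolve_left h1
  exact hca.continuousWithinAt.congr_of_eventuallyEq (this.mono fun _ h => h.symm) hzd.symm

namespace IsSimpleClosed
variable {c d : ℝ → ℂ} (hc : IsSimpleClosed c) (hd : IsSimpleClosed d)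
include hc

lemma tendsto_integral_mul_kern {g : ℝ → ℝ} (hg : Measurable g) {B : ℝ} (hB : ∀ y, |g y| ≤ B)
    (p : ℂ) : Tendsto (fun δ => ∫ y in 0..2 * π, g y * kern c δ p y) (𝓝[>] 0)
      (𝓝 (∫ y in 0..2 * π, g y * kern c 0 p y)) := by
  have hB0 : 0 ≤ B := (abs_nonneg _).trans (hB 0)
  apply intervalIntegral.tendsto_integral_filter_of_dominated_convergence
    (fun x => B * |kern c 0 p x|)
  · exact Eventually.of_forall fun ε => (hg.mul (hc.measurable_kern_right ε p)).aestronglyMeasurable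
  · refine Eventually.of_forall fun ε => Eventually.of_forall fun x _ => ?_
    rw [norm_mul, Real.norm_eq_abs, Real.norm_eq_abs]
    exact mul_le_mul (hB x) (abs_kern_le c ε p x) (abs_nonneg _) hB0
  · exact (hc.intervalIntegrable_kern 0 p).abs.const_mul B
  · exact Eventually.of_forall fun x _ => (tendsto_kern c p x).const_mul _

lemma intervalIntegrable_mul_kern {g : ℝ → ℝ} (hg : Measurable g) {B : ℝ} (hB : ∀ y, |g y| ≤ B)
    (ε : ℝ) (p : ℂ) (a b : ℝ) : IntervalIntegrable (fun y => g y * kern c ε p y) volume a b := by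
  refine ((hc.intervalIntegrable_kern' ε p a b).norm.const_mul B).mono_fun
    (hg.mul (hc.measurable_kern_right ε p)).aestronglyMeasurable
    (Eventually.of_forall fun x => ?_)
  simp only [norm_mul, norm_norm]
  have h0 : 0 ≤ B := (abs_nonneg _).trans (hB 0)
  gcongr
  exact (hB x).trans (le_abs_self B)

include hd in
lemma measurable_pot_comp : Measurable fun y => pot c 0 (d y) :=
  (hc.measurable_pot 0).comp hd.cont.measurable

include hd in
/-- The two mutual contour integrals of the potentials represent the mean of the product of the
potentials near a point. -/
lemma tendsto_pair (p : ℂ) : Tendsto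
    (fun δ => 2 * π * ∫ z, pot c 0 z * pot d 0 z * rho δ (z - p)) (𝓝[>] 0)
      (𝓝 ((∫ y in 0..2 * π, pot c 0 (d y) * kern d 0 p y) +
        ∫ x in 0..2 * π, pot d 0 (c x) * kern c 0 p x)) := by
  obtain ⟨B, -, hB⟩ := hc.exists_pot_bound
  obtain ⟨B', -, hB'⟩ := hd.exists_pot_bound
  refine ((hd.tendsto_integral_mul_kern (hc.measurable_pot_comp hd) (fun y => hB 0 (d y)) p).add
    (hc.tendsto_integral_mul_kern (hd.measurable_pot_comp hc) (fun y => hB' 0 (c y)) p)).congr' ?_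
  filter_upwards [self_mem_nhdsWithin] with δ hδ
  have hδ : 0 < δ := hδ
  have hf := contDiff_cauchyK hδ.ne' p (n := 1)
  have h := hc.star hd hf
  simp_rw [dbar2_cauchyK hδ.ne'] at h
  have key : ∀ {a b : ℝ → ℂ}, IsSimpleClosed a → IsSimpleClosed b →
      (∫ y in 0..2 * π, (pot a 0 (b y) : ℂ) * cauchyK δ p (b y) * deriv b y).im =
        ∫ y in 0..2 * π, pot a 0 (b y) * kern b δ p y := by
    intro a b ha hb
    obtain ⟨B, -, hB⟩ := ha.exists_pot_bound
    have hi : IntervalIntegrable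
        (fun y => (pot a 0 (b y) : ℂ) * cauchyK δ p (b y) * deriv b y) volume 0 (2 * π) := by
      have h1 : Continuous fun y => cauchyK δ p (b y) * deriv b y :=
        (hf.continuous.comp hb.cont).mul hb.cont_deriv
      refine ((h1.norm.const_mul B).intervalIntegrable 0 (2 * π)).mono_fun
        ((Complex.measurable_ofReal.comp (ha.measurable_pot_comp hb)).mul
          (hf.continuous.comp hb.cont).measurable |>.mul hb.cont_deriv.measurable
          |>.aestronglyMeasurable) (Eventually.of_forall fun x => ?_)
      beta_reduce
      rw [mul_assoc, norm_mul, norm_mul B, norm_norm, Complex.norm_real]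
      gcongr
      exact (hB 0 _).trans (le_abs_self B)
    have := Complex.imCLM.intervalIntegral_comp_comm hi
    simp only [Complex.imCLM_apply] at this
    rw [← this]
    refine intervalIntegral.integral_congr fun y _ => ?_
    rw [mul_assoc, Complex.im_ofReal_mul, cauchyK_mul_im]
  have h2 := congrArg Complex.im h
  rw [Complex.add_im, key hc hd, key hd hc] at h2
  rw [h2]
  have e1 : ∫ y, (pot c 0 y : ℂ) * (pot d 0 y : ℂ) * (2 * π * Complex.I * (rho δ (y - p) : ℝ)) =
      ((2 * π * ∫ y, pot c 0 y * pot d 0 y * rho δ (y - p) : ℝ) : ℂ) * Complex.I := by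
    rw [Complex.ofReal_mul, ← integral_complex_ofReal, ← integral_const_mul, ← integral_mul_const]
    exact integral_congr_ae (Eventually.of_forall fun z => by push_cast; ring)
  rw [e1, Complex.im_ofReal_mul]
  simp

lemma curvature_periodic :
    Function.Periodic (fun x => (deriv (deriv c) x / deriv c x).im) (2 * π) := fun x => by
  simp only [hc.per_deriv x, hc.per_deriv_deriv x]

lemma continuous_curvature : Continuous fun x => (deriv (deriv c) x / deriv c x).im :=
  Complex.continuous_im.comp (hc.cont_deriv_deriv.div hc.cont_deriv hc.reg)

include hd in
lemma pot_const_arc {y₁ y₂ : ℝ} (h : ∀ x ∈ Ioo y₁ y₂, c x ∉ range d) :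
    ∃ k : ℝ, ∀ x ∈ Ioo y₁ y₂, pot d 0 (c x) = k := by
  by_cases hne : (Ioo y₁ y₂).Nonempty
  · obtain ⟨x₀, hx₀⟩ := hne
    refine ⟨pot d 0 (c x₀), fun x hx => ?_⟩
    refine eq_of_continuousOn_of_int (isPreconnected_Ioo (a := y₁) (b := y₂))
      (f := fun x => pot d 0 (c x)) ?_ ?_ hx hx₀
    · intro y hy
      exact ((hd.continuousAt_pot (h y hy)).comp hc.cont.continuousAt).continuousWithinAt
    · intro y hy
      obtain ⟨n, hn⟩ := hd.deg_int
      rcases hd.pot_eq_or (h y hy) with h | h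
      · exact ⟨0, by simpa using h⟩
      · exact ⟨n, by rw [h, hn]⟩
  · exact ⟨0, fun x hx => (hne ⟨x, hx⟩).elim⟩

include hd in
lemma integral_weight_arc {y₁ y₂ : ℝ} (h12 : y₁ ≤ y₂) (h2 : y₂ < y₁ + 2 * π)
    (h : ∀ x ∈ Ioo y₁ y₂, c x ∉ range d) (α γ : ℝ) :
    ∫ x in y₁..y₂, (α + γ * pot d 0 (c x)) * (deriv (deriv c) x / deriv c x).im =
      ∫ x in y₁..y₂, (α + γ * pot d 0 (c x)) * (kern c 0 (c y₁) x + kern c 0 (c y₂) x) := by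
  obtain ⟨k, hk⟩ := hc.pot_const_arc hd h
  have e : ∀ f : ℝ → ℝ, ∫ x in y₁..y₂, (α + γ * pot d 0 (c x)) * f x =
      (α + γ * k) * ∫ x in y₁..y₂, f x := by
    intro f
    rw [← intervalIntegral.integral_const_mul, intervalIntegral.integral_of_le h12,
      intervalIntegral.integral_of_le h12, integral_Ioc_eq_integral_Ioo,
      integral_Ioc_eq_integral_Ioo]
    exact setIntegral_congr_fun measurableSet_Ioo fun x hx => by simp only [hk x hx]
  rw [e, e, hc.integral_curvature_arc h12 h2]

include hd in
lemma integral_weight_curvature {y₁ y₂ : ℝ} (h12 : y₁ < y₂) (h2 : y₂ < y₁ + 2 * π)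
    (h : range c ∩ range d = {c y₁, c y₂}) (α γ : ℝ) :
    ∫ x in 0..2 * π, (α + γ * pot d 0 (c x)) * (deriv (deriv c) x / deriv c x).im =
      (∫ x in 0..2 * π, (α + γ * pot d 0 (c x)) * kern c 0 (c y₁) x) +
      ∫ x in 0..2 * π, (α + γ * pot d 0 (c x)) * kern c 0 (c y₂) x := by
  have hoff : ∀ x, c x ≠ c y₁ → c x ≠ c y₂ → c x ∉ range d := by
    intro x h1 h2 h3
    have : c x ∈ ({c y₁, c y₂} : Set ℂ) := h ▸ ⟨mem_range_self x, h3⟩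
    simp [h1, h2] at this
  have a1 : ∀ x ∈ Ioo y₁ y₂, c x ∉ range d := fun x hx => hoff x
    (fun e => hx.1.ne' (hc.inj _ _ (by rw [abs_lt]; constructor <;> linarith [hx.1, hx.2]) e))
    (fun e => hx.2.ne (hc.inj _ _ (by rw [abs_lt]; constructor <;> linarith [hx.1, hx.2]) e))
  have a2 : ∀ x ∈ Ioo y₂ (y₁ + 2 * π), c x ∉ range d := fun x hx => hoff x
    (fun e => hx.2.ne (hc.inj _ _ (by rw [abs_lt]; constructor <;> linarith [hx.1, hx.2])
      (e.trans (hc.per y₁).symm)))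
    (fun e => hx.1.ne' (hc.inj _ _ (by rw [abs_lt]; constructor <;> linarith [hx.1, hx.2]) e))
  obtain ⟨B, -, hB⟩ := hd.exists_pot_bound
  have hgm : Measurable fun x => α + γ * pot d 0 (c x) :=
    ((hd.measurable_pot_comp hc).const_mul γ).const_add α
  have hgb : ∀ x, |α + γ * pot d 0 (c x)| ≤ |α| + |γ| * B := fun x => by
    refine (abs_add_le _ _).trans ?_
    rw [abs_mul]
    gcongr
    exact hB 0 _
  have hi := hc.intervalIntegrable_mul_kern hgm hgb 0
  have hgp : Function.Periodic (fun x => α + γ * pot d 0 (c x)) (2 * π) := fun x => by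
    simp only [hc.per x]
  have hik : ∀ a b, IntervalIntegrable
      (fun x => (α + γ * pot d 0 (c x)) * (deriv (deriv c) x / deriv c x).im) volume a b := by
    intro a b
    refine ((hc.continuous_curvature.norm.const_mul (|α| + |γ| * B)).intervalIntegrable
      a b).mono_fun
      (hgm.mul hc.continuous_curvature.measurable).aestronglyMeasurable
      (Eventually.of_forall fun x => ?_)
    beta_reduce
    rw [norm_mul, norm_mul, norm_norm]
    gcongr
    exact (hgb x).trans (le_abs_self _)
  have hsum : ∀ a b, (∫ x in a..b, (α + γ * pot d 0 (c x)) *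
      (kern c 0 (c y₁) x + kern c 0 (c y₂) x)) =
      (∫ x in a..b, (α + γ * pot d 0 (c x)) * kern c 0 (c y₁) x) +
      ∫ x in a..b, (α + γ * pot d 0 (c x)) * kern c 0 (c y₂) x := by
    intro a b
    rw [← intervalIntegral.integral_add (hi _ a b) (hi _ a b)]
    exact intervalIntegral.integral_congr fun x _ => by ring
  have hsum' : ∀ a b, (∫ x in a..b, (α + γ * pot d 0 (c x)) *
      (kern c 0 (c y₂) x + kern c 0 (c y₁) x)) =
      (∫ x in a..b, (α + γ * pot d 0 (c x)) * kern c 0 (c y₁) x) +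
      ∫ x in a..b, (α + γ * pot d 0 (c x)) * kern c 0 (c y₂) x := by
    intro a b
    rw [← hsum]
    exact intervalIntegral.integral_congr fun x _ => by ring
  have per : ∀ {f : ℝ → ℝ}, Function.Periodic f (2 * π) →
      ∫ x in 0..2 * π, (α + γ * pot d 0 (c x)) * f x =
        ∫ x in y₁..(y₁ + 2 * π), (α + γ * pot d 0 (c x)) * f x := by
    intro f hf
    simpa using (hgp.mul hf).intervalIntegral_add_eq 0 y₁
  rw [per hc.curvature_periodic, per (hc.kern_periodic 0 (c y₁)),
    per (hc.kern_periodic 0 (c y₂)),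
    ← intervalIntegral.integral_add_adjacent_intervals (hik y₁ y₂) (hik _ _),
    hc.integral_weight_arc hd h12.le h2 a1, hc.integral_weight_arc hd h2.le (by linarith) a2,
    hc.per y₁, hsum, hsum',
    ← intervalIntegral.integral_add_adjacent_intervals (hi (c y₁) y₁ y₂) (hi _ y₂ (y₁ + 2 * π)),
    ← intervalIntegral.integral_add_adjacent_intervals (hi (c y₂) y₁ y₂) (hi _ y₂ (y₁ + 2 * π))]
  ring

include hd in
/-- A nonnegative combination of potentials decreases at a definite rate under curvature flow. -/
lemma weight_curvature_nonneg {α β γ : ℝ}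
    (hF : ∀ z, z ∉ range c → z ∉ range d →
      0 ≤ α * pot c 0 z + β * pot d 0 z + γ * (pot c 0 z * pot d 0 z))
    {P Q : ℂ} (hPQ : P ≠ Q) (h : range c ∩ range d = {P, Q}) :
    0 ≤ (∫ x in 0..2 * π, (α + γ * pot d 0 (c x)) * (deriv (deriv c) x / deriv c x).im) +
      ∫ x in 0..2 * π, (β + γ * pot c 0 (d x)) * (deriv (deriv d) x / deriv d x).im := by
  have key : ∀ p, 0 ≤ (∫ x in 0..2 * π, (α + γ * pot d 0 (c x)) * kern c 0 p x) +
      ∫ x in 0..2 * π, (β + γ * pot c 0 (d x)) * kern d 0 p x := by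
    intro p
    obtain ⟨B, -, hB⟩ := hc.exists_pot_bound
    obtain ⟨B', -, hB'⟩ := hd.exists_pot_bound
    have e1 : (∫ x in 0..2 * π, (α + γ * pot d 0 (c x)) * kern c 0 p x) =
        2 * π * α * pot c 0 p + γ * ∫ x in 0..2 * π, pot d 0 (c x) * kern c 0 p x := by
      simp_rw [add_mul, mul_assoc]
      rw [intervalIntegral.integral_add ((hc.intervalIntegrable_kern 0 p).const_mul α)
        ((hc.intervalIntegrable_mul_kern (hd.measurable_pot_comp hc) (fun x => hB' 0 (c x))
          0 p _ _).const_mul γ), intervalIntegral.integral_const_mul,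
          intervalIntegral.integral_const_mul]
      unfold pot
      field_simp
    have e2 : (∫ x in 0..2 * π, (β + γ * pot c 0 (d x)) * kern d 0 p x) =
        2 * π * β * pot d 0 p + γ * ∫ x in 0..2 * π, pot c 0 (d x) * kern d 0 p x := by
      simp_rw [add_mul, mul_assoc]
      rw [intervalIntegral.integral_add ((hd.intervalIntegrable_kern 0 p).const_mul β)
        ((hd.intervalIntegrable_mul_kern (hc.measurable_pot_comp hd) (fun x => hB 0 (d x))
          0 p _ _).const_mul γ), intervalIntegral.integral_const_mul,
          intervalIntegral.integral_const_mul]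
      unfold pot
      field_simp
    have hl := (((hc.tendsto_pot p).const_mul (2 * π * α)).add
      ((hd.tendsto_pot p).const_mul (2 * π * β))).add ((hc.tendsto_pair hd p).const_mul γ)
    rw [e1, e2]
    refine (ge_of_tendsto hl ?_).trans_eq (by ring)
    filter_upwards [self_mem_nhdsWithin] with δ hδ
    have hδ : 0 < δ := hδ
    rw [hc.pot_eq_integral hδ, hd.pot_eq_integral hδ]
    have hrc : Continuous fun y => (rho δ (y - p) : ℂ) := by
      have := continuous_rho hδ.ne'
      fun_prop
    have i1 : Integrable fun y => pot c 0 y * rho δ (y - p) :=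
      (hc.integrable_pot_mul hrc).re.congr (Eventually.of_forall fun y => by simp)
    have i2 : Integrable fun y => pot d 0 y * rho δ (y - p) :=
      (hd.integrable_pot_mul hrc).re.congr (Eventually.of_forall fun y => by simp)
    have i3 : Integrable fun y => pot c 0 y * pot d 0 y * rho δ (y - p) :=
      (hc.integrable_pot_mul_pot hd hrc).re.congr (Eventually.of_forall fun y => by simp)
    have e3 : 2 * π * α * (∫ y, pot c 0 y * rho δ (y - p)) +
        2 * π * β * (∫ y, pot d 0 y * rho δ (y - p)) +
        γ * (2 * π * ∫ y, pot c 0 y * pot d 0 y * rho δ (y - p)) =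
        ∫ z, 2 * π * ((α * pot c 0 z + β * pot d 0 z + γ * (pot c 0 z * pot d 0 z)) *
          rho δ (z - p)) := by
      rw [← mul_assoc γ, ← integral_const_mul, ← integral_const_mul, ← integral_const_mul,
        ← integral_add (i1.const_mul _) (i2.const_mul _)]
      refine (integral_add ((i1.const_mul _).add (i2.const_mul _)) (i3.const_mul _)).symm.trans ?_
      exact integral_congr_ae (Eventually.of_forall fun z => by simp only [Pi.add_apply]; ring)
    rw [e3]
    refine integral_nonneg_of_ae ?_
    filter_upwards [measure_eq_zero_iff_ae_notMem.1 hc.volume_range,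
      measure_eq_zero_iff_ae_notMem.1 hd.volume_range] with z h1 h2
    have := hF z h1 h2
    have := rho_nonneg δ (z - p)
    simp only [Pi.zero_apply]
    positivity
  have ends : ∀ {a : ℝ → ℂ}, IsSimpleClosed a → P ∈ range a → Q ∈ range a →
      ∃ y₁ y₂, y₁ < y₂ ∧ y₂ < y₁ + 2 * π ∧ a y₁ = P ∧ a y₂ = Q := by
    rintro a ha ⟨y₁, hy₁⟩ ⟨y, hy⟩
    obtain ⟨y₂, hy₂, he⟩ := ha.per.exists_mem_Ico (by positivity) y y₁
    refine ⟨y₁, y₂, lt_of_le_of_ne hy₂.1 ?_, hy₂.2, hy₁, by rw [← he, hy]⟩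
    rintro rfl
    exact hPQ (by rw [← hy₁, ← he, hy])
  have hP : P ∈ range c ∩ range d := by rw [h]; simp
  have hQ : Q ∈ range c ∩ range d := by rw [h]; simp
  obtain ⟨y₁, y₂, h1, h2, e1, e2⟩ := ends hc hP.1 hQ.1
  obtain ⟨z₁, z₂, h3, h4, e3, e4⟩ := ends hd hP.2 hQ.2
  rw [hc.integral_weight_curvature hd h1 h2 (by rw [e1, e2, h]) α γ,
    hd.integral_weight_curvature hc h3 h4 (by rw [e3, e4, inter_comm, h]) β γ, e1, e2, e3, e4]
  have := key P
  have := key Q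
  linarith

end IsSimpleClosed

/-- A smooth one-parameter family of simple closed curves. -/
structure IsFamily (c : ℝ → ℝ → ℂ) : Prop where
  smooth : ContDiff ℝ 3 (fun p : ℝ × ℝ => c p.1 p.2)
  simple : ∀ t, IsSimpleClosed (c t)

/-- The velocity of a family of curves. -/
def vel (c : ℝ → ℝ → ℂ) (t x : ℝ) : ℂ := deriv (fun s => c s x) t

/-- The mixed second derivative of a family of curves. -/
def mixed (c : ℝ → ℝ → ℂ) (t x : ℝ) : ℂ :=
  fderiv ℝ (fun p => fderiv ℝ (fun p : ℝ × ℝ => c p.1 p.2) p (0, 1)) (t, x) (1, 0)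

lemma hasDerivAt_slice_left {F : ℝ × ℝ → ℂ} {t x : ℝ} (hF : DifferentiableAt ℝ F (t, x)) :
    HasDerivAt (fun s => F (s, x)) (fderiv ℝ F (t, x) (1, 0)) t :=
  hF.hasFDerivAt.comp_hasDerivAt t ((hasDerivAt_id t).prodMk (hasDerivAt_const t x))

lemma hasDerivAt_slice_right {F : ℝ × ℝ → ℂ} {t x : ℝ} (hF : DifferentiableAt ℝ F (t, x)) :
    HasDerivAt (fun y => F (t, y)) (fderiv ℝ F (t, x) (0, 1)) x :=
  hF.hasFDerivAt.comp_hasDerivAt x ((hasDerivAt_const x t).prodMk (hasDerivAt_id x))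

namespace IsFamily
variable {c d : ℝ → ℝ → ℂ} (hc : IsFamily c) (hd : IsFamily d)
include hc

lemma vel_eq (t x : ℝ) : vel c t x = fderiv ℝ (fun p : ℝ × ℝ => c p.1 p.2) (t, x) (1, 0) :=
  (hasDerivAt_slice_left (F := fun p => c p.1 p.2)
    (hc.smooth.differentiable (by norm_num) (t, x))).deriv

lemma deriv_eq (t x : ℝ) :
    deriv (c t) x = fderiv ℝ (fun p : ℝ × ℝ => c p.1 p.2) (t, x) (0, 1) :=
  (hasDerivAt_slice_right (F := fun p => c p.1 p.2)
    (hc.smooth.differentiable (by norm_num) (t, x))).deriv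

lemma contDiff_vel : ContDiff ℝ 2 (fun p : ℝ × ℝ => vel c p.1 p.2) := by
  have : (fun p : ℝ × ℝ => vel c p.1 p.2) =
      fun p => fderiv ℝ (fun p : ℝ × ℝ => c p.1 p.2) p (1, 0) :=
    funext fun p => hc.vel_eq p.1 p.2
  rw [this]
  exact (hc.smooth.fderiv_right (m := 2) (by norm_num)).clm_apply contDiff_const

lemma contDiff_deriv : ContDiff ℝ 2 (fun p : ℝ × ℝ => deriv (c p.1) p.2) := by
  have : (fun p : ℝ × ℝ => deriv (c p.1) p.2) =
      fun p => fderiv ℝ (fun p : ℝ × ℝ => c p.1 p.2) p (0, 1) :=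
    funext fun p => hc.deriv_eq p.1 p.2
  rw [this]
  exact (hc.smooth.fderiv_right (m := 2) (by norm_num)).clm_apply contDiff_const

lemma hasDerivAt_time (t x : ℝ) : HasDerivAt (fun s => c s x) (vel c t x) t := by
  rw [hc.vel_eq]
  exact hasDerivAt_slice_left (F := fun p => c p.1 p.2)
    (hc.smooth.differentiable (by norm_num) (t, x))

lemma hasDerivAt_deriv_time (t x : ℝ) :
    HasDerivAt (fun s => deriv (c s) x) (mixed c t x) t := by
  have : (fun s => deriv (c s) x) =
      fun s => fderiv ℝ (fun p : ℝ × ℝ => c p.1 p.2) (s, x) (0, 1) :=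
    funext fun s => hc.deriv_eq s x
  rw [this]
  refine hasDerivAt_slice_left (F := fun p => fderiv ℝ (fun p : ℝ × ℝ => c p.1 p.2) p (0, 1)) ?_
  exact ((hc.smooth.fderiv_right (m := 2) (by norm_num)).clm_apply contDiff_const).differentiable
    (by norm_num) _

lemma hasDerivAt_vel (t x : ℝ) : HasDerivAt (vel c t) (mixed c t x) x := by
  have h1 : vel c t = fun y => fderiv ℝ (fun p : ℝ × ℝ => c p.1 p.2) (t, y) (1, 0) :=
    funext fun y => hc.vel_eq t y
  have hd : Differentiable ℝ (fderiv ℝ (fun p : ℝ × ℝ => c p.1 p.2)) :=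
    (hc.smooth.fderiv_right (m := 2) (by norm_num)).differentiable (by norm_num)
  have h2 := hasDerivAt_slice_right (F := fun p => fderiv ℝ (fun p : ℝ × ℝ => c p.1 p.2) p (1, 0))
    (t := t) (x := x) ((hd _).clm_apply (differentiableAt_const _))
  rw [h1]
  convert! h2 using 1
  unfold mixed
  have hs : IsSymmSndFDerivAt ℝ (fun p : ℝ × ℝ => c p.1 p.2) (t, x) :=
    (hc.smooth.contDiffAt).isSymmSndFDerivAt (by simp; norm_num)
  rw [fderiv_clm_apply (hd _) (differentiableAt_const _),
    fderiv_clm_apply (hd _) (differentiableAt_const _)]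
  simpa using hs.eq (1, 0) (0, 1)

lemma continuous : Continuous (fun p : ℝ × ℝ => c p.1 p.2) := hc.smooth.continuous

lemma continuous_vel : Continuous (fun p : ℝ × ℝ => vel c p.1 p.2) := hc.contDiff_vel.continuous

lemma continuous_deriv : Continuous (fun p : ℝ × ℝ => deriv (c p.1) p.2) :=
  hc.contDiff_deriv.continuous

lemma continuous_mixed : Continuous (fun p : ℝ × ℝ => mixed c p.1 p.2) := by
  have : (fun p : ℝ × ℝ => mixed c p.1 p.2) =
      fun p => fderiv ℝ (fun p : ℝ × ℝ => vel c p.1 p.2) p (0, 1) := by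
    funext p
    exact (hc.hasDerivAt_vel p.1 p.2).unique (hasDerivAt_slice_right
      (F := fun p : ℝ × ℝ => vel c p.1 p.2) (hc.contDiff_vel.differentiable (by norm_num) p))
  rw [this]
  exact (hc.contDiff_vel.continuous_fderiv (by norm_num)).clm_apply continuous_const

lemma vel_periodic (t : ℝ) : Function.Periodic (vel c t) (2 * π) := fun x => by
  unfold vel
  simp only [(hc.simple _).per x]

end IsFamily

lemma deriv_intervalIntegral {f : ℝ × ℝ → ℝ} (hf : ContDiff ℝ 1 f) (a b t : ℝ) :
    HasDerivAt (fun t => ∫ x in a..b, f (t, x)) (∫ x in a..b, deriv (fun s => f (s, x)) t) t := by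
  have h := ((contDiff_intervalIntegral hf a b).differentiable one_ne_zero t).hasFDerivAt.hasDerivAt
  rwa [fderiv_intervalIntegral_apply hf] at h

lemma integral_deriv_periodic {f f' : ℝ → ℝ} (hf : ∀ x, HasDerivAt f (f' x) x)
    (hf' : Continuous f') (hp : Function.Periodic f (2 * π)) : ∫ x in 0..2 * π, f' x = 0 := by
  rw [intervalIntegral.integral_eq_sub_of_hasDerivAt (fun x _ => hf x)
    (hf'.intervalIntegrable _ _)]
  simpa using sub_eq_zero.2 (hp 0)

lemma IsSimpleClosed.integral_pot {c : ℝ → ℂ} (hc : IsSimpleClosed c) :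
    ∫ z, pot c 0 z = 2⁻¹ * ∫ x in 0..2 * π, (conj (c x) * deriv c x).im := by
  have h := hc.green (contDiff_conj (n := 1))
  have h2 : ∀ z, dbar2 (fun z => conj z) z = 2 * Complex.I := by
    intro z
    unfold dbar2
    have : fderiv ℝ (fun z : ℂ => conj z) z = (Complex.conjCLE : ℂ →L[ℝ] ℂ) :=
      Complex.conjCLE.hasFDerivAt.fderiv
    rw [this]
    simp
    ring
  simp_rw [h2] at h
  rw [integral_mul_const, integral_complex_ofReal] at h
  have h3 := congrArg Complex.im h
  have hi : IntervalIntegrable (fun x => conj (c x) * deriv c x) volume 0 (2 * π) :=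
    ((Complex.continuous_conj.comp hc.cont).mul hc.cont_deriv).intervalIntegrable _ _
  have := Complex.imCLM.intervalIntegral_comp_comm hi
  simp only [Complex.imCLM_apply] at this
  rw [this, h3, Complex.im_ofReal_mul]
  simp
  ring

namespace IsFamily
variable {c d : ℝ → ℝ → ℂ} (hc : IsFamily c) (hd : IsFamily d)
include hc

/-- The normal flux density of a family of curves. -/
lemma continuous_flux :
    Continuous fun p : ℝ × ℝ => (conj (vel c p.1 p.2) * deriv (c p.1) p.2).im := by
  have := hc.continuous_vel
  have := hc.continuous_deriv
  fun_prop

lemma hasDerivAt_area (t : ℝ) : HasDerivAt (fun t => ∫ z, pot (c t) 0 z)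
    (∫ x in 0..2 * π, (conj (vel c t x) * deriv (c t) x).im) t := by
  have e : (fun t => ∫ z, pot (c t) 0 z) =
      fun t => 2⁻¹ * ∫ x in 0..2 * π, (conj (c t x) * deriv (c t) x).im :=
    funext fun t => (hc.simple t).integral_pot
  rw [e]
  have hG : ContDiff ℝ 1 fun p : ℝ × ℝ => (conj (c p.1 p.2) * deriv (c p.1) p.2).im :=
    Complex.imCLM.contDiff.comp (((contDiff_conj (n := 1)).comp (hc.smooth.of_le (by norm_num))).mul
      (hc.contDiff_deriv.of_le (by norm_num)))
  convert! (deriv_intervalIntegral hG 0 (2 * π) t).const_mul 2⁻¹ using 1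
  have e1 : ∀ x, deriv (fun s => (conj (c s x) * deriv (c s) x).im) t =
      2 * (conj (vel c t x) * deriv (c t) x).im +
        (conj (deriv (c t) x) * vel c t x + conj (c t x) * mixed c t x).im := by
    intro x
    have h1 : HasDerivAt (fun s => conj (c s x) * deriv (c s) x)
      (conj (vel c t x) * deriv (c t) x + conj (c t x) * mixed c t x) t :=
      (hc.hasDerivAt_time t x).star.mul (hc.hasDerivAt_deriv_time t x)
    have h2 := (Complex.imCLM.hasFDerivAt.comp_hasDerivAt t h1).deriv
    refine Eq.trans h2 ?_
    simp only [Complex.imCLM_apply, Complex.add_im, Complex.mul_im, Complex.conj_re,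
      Complex.conj_im]
    ring
  simp_rw [e1]
  have hcc := (hc.simple t).cont
  have hcd := (hc.simple t).cont_deriv
  have hcv : Continuous (vel c t) :=
    hc.continuous_vel.comp (by fun_prop : Continuous fun x => (t, x))
  have hcm : Continuous (mixed c t) :=
    hc.continuous_mixed.comp (by fun_prop : Continuous fun x => (t, x))
  have hz : ∫ x in 0..2 * π,
      (conj (deriv (c t) x) * vel c t x + conj (c t x) * mixed c t x).im = 0 := by
    refine integral_deriv_periodic (f := fun x => (conj (c t x) * vel c t x).im) (fun x => ?_)
      (by fun_prop) (fun x => by simp only [(hc.simple t).per x, hc.vel_periodic t x])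
    exact Complex.imCLM.hasFDerivAt.comp_hasDerivAt x
      (((hc.simple t).hasDerivAt x).star.mul (hc.hasDerivAt_vel t x))
  rw [intervalIntegral.integral_add (Continuous.intervalIntegrable (by fun_prop) _ _)
    (Continuous.intervalIntegrable (by fun_prop) _ _), hz, intervalIntegral.integral_const_mul]
  ring

end IsFamily

/-- The regularised logarithmic kernel. -/
def logK (ε : ℝ) (ζ : ℂ) : ℝ := Real.log (Complex.normSq ζ + ε ^ 2)

lemma contDiff_logK {ε : ℝ} (hε : ε ≠ 0) {n : WithTop ℕ∞} : ContDiff ℝ n (logK ε) :=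
  (contDiff_normSq.add contDiff_const).log fun ζ => (normSq_add_sq_pos hε ζ).ne'

lemma hasDerivAt_logK {ε : ℝ} (hε : ε ≠ 0) {u : ℝ → ℂ} {u' : ℂ} {t : ℝ} (hu : HasDerivAt u u' t) :
    HasDerivAt (fun s => logK ε (u s))
      (2 * (conj (u t) * u').re / (Complex.normSq (u t) + ε ^ 2)) t := by
  have h1 : HasDerivAt (fun s => Complex.normSq (u s)) (2 * (conj (u t) * u').re) t := by
    have hre := Complex.reCLM.hasFDerivAt.comp_hasDerivAt t hu
    have him := Complex.imCLM.hasFDerivAt.comp_hasDerivAt t hu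
    have := (hre.mul hre).add (him.mul him)
    refine this.congr_deriv ?_
    simp
    ring
  exact (h1.add_const _).log (normSq_add_sq_pos hε _).ne'

lemma dbar2_logK {ε : ℝ} (hε : ε ≠ 0) (w z : ℂ) :
    dbar2 (fun z => (logK ε (w - z) : ℂ)) z = -2 * Complex.I * conj (cauchyK ε z w) := by
  have hd : Differentiable ℝ fun z => logK ε (w - z) :=
    ((contDiff_logK hε (n := 1)).comp (contDiff_const.sub contDiff_id)).differentiable one_ne_zero
  have key : ∀ v, fderiv ℝ (fun z => logK ε (w - z)) z v =
      -(2 * (conj (w - z) * v).re / (Complex.normSq (w - z) + ε ^ 2)) := by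
    intro v
    have h0 : HasDerivAt (fun s : ℝ => z + s * v) v 0 := by
      simpa using ((Complex.ofRealCLM.hasDerivAt (x := (0 : ℝ))).mul_const v).const_add z
    have h1 : HasDerivAt (fun s : ℝ => logK ε (w - (z + s * v)))
        (fderiv ℝ (fun z => logK ε (w - z)) z v) 0 := by
      have := (hd (z + (0 : ℝ) * v)).hasFDerivAt.comp_hasDerivAt (0 : ℝ) h0
      simpa [Function.comp_def] using this
    have h2 := hasDerivAt_logK hε (h0.const_sub w)
    rw [h1.unique h2]
    simp
    ring
  rw [dbar2_ofReal (hd z), key, key]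
  unfold cauchyK
  have hD : ((Complex.normSq (w - z) + ε ^ 2 : ℝ) : ℂ) ≠ 0 :=
    Complex.ofReal_ne_zero.2 (normSq_add_sq_pos hε (w - z)).ne'
  rw [map_div₀, Complex.conj_conj, Complex.conj_ofReal]
  push_cast at hD ⊢
  field_simp
  apply Complex.ext <;> simp
  ring

lemma intervalIntegral_swap {f : ℝ → ℝ → ℝ} (hf : Continuous fun p : ℝ × ℝ => f p.1 p.2)
    (a b a' b' : ℝ) :
    ∫ x in a..b, ∫ y in a'..b', f x y = ∫ y in a'..b', ∫ x in a..b, f x y := by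
  refine intervalIntegral_intervalIntegral_swap (F := f)
    ((hf.continuousOn.integrableOn_compact
      (isCompact_uIcc.prod isCompact_uIcc (s := uIcc a b) (t := uIcc a' b'))).mono_set ?_)
  exact prod_mono uIoc_subset_uIcc uIoc_subset_uIcc

namespace IsSimpleClosed
variable {c d : ℝ → ℂ} (hc : IsSimpleClosed c) (hd : IsSimpleClosed d)
include hc hd

/-- The mutual energy of two curves represents the integral of the product of potentials. -/
lemma integral_logK {ε : ℝ} (hε : 0 < ε) :
    ∫ x in 0..2 * π, ∫ y in 0..2 * π, logK ε (c x - d y) * (conj (deriv c x) * deriv d y).re =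
      -(4 * π) * ∫ z, pot d 0 z * pot c ε z := by
  have h1 : ∀ x, ∫ y in 0..2 * π, logK ε (c x - d y) * (conj (deriv c x) * deriv d y).re =
      ∫ z, pot d 0 z * (-2 * kern c ε z x) := by
    intro x
    have hf : ContDiff ℝ 1 fun z => (logK ε (c x - z) : ℂ) :=
      Complex.ofRealCLM.contDiff.comp
        ((contDiff_logK hε.ne' (n := 1)).comp (contDiff_const.sub contDiff_id))
    have hg := hd.green hf
    simp_rw [dbar2_logK hε.ne'] at hg
    have hi : IntervalIntegrable (fun y => (logK ε (c x - d y) : ℂ) * deriv d y) volume 0 (2 * π) :=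
      ((hf.continuous.comp hd.cont).mul hd.cont_deriv).intervalIntegrable _ _
    have h2 := Complex.reCLM.intervalIntegral_comp_comm (hi.const_mul (conj (deriv c x)))
    rw [intervalIntegral.integral_const_mul, hg, ← integral_const_mul] at h2
    have e1 : ∫ y in 0..2 * π, logK ε (c x - d y) * (conj (deriv c x) * deriv d y).re =
        ∫ y in 0..2 * π,
          Complex.reCLM (conj (deriv c x) * ((logK ε (c x - d y) : ℂ) * deriv d y)) := by
      refine intervalIntegral.integral_congr fun y _ => ?_
      simp only [Complex.reCLM_apply]
      rw [← Complex.re_ofReal_mul]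
      congr 1
      ring
    have hK : Continuous fun z => -2 * Complex.I * conj (cauchyK ε z (c x)) := by
      have : Continuous fun z => cauchyK ε z (c x) :=
        (contDiff_cauchyK_uncurry hε.ne' (n := 1)).continuous.comp
          (by fun_prop : Continuous fun z : ℂ => (z, c x))
      fun_prop
    rw [e1, h2]
    have h3 := Complex.reCLM.integral_comp_comm
      ((hd.integrable_pot_mul hK).const_mul (conj (deriv c x)))
    rw [← h3]
    refine integral_congr_ae (Eventually.of_forall fun z => ?_)
    simp only [Complex.reCLM_apply]
    rw [← cauchyK_mul_im]
    rw [show conj (deriv c x) * ((pot d 0 z : ℂ) * (-2 * Complex.I * conj (cauchyK ε z (c x)))) =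
      ((pot d 0 z * (-2) : ℝ) : ℂ) * (Complex.I * conj (cauchyK ε z (c x) * deriv c x)) by
        push_cast [map_mul]; ring, Complex.re_ofReal_mul]
    simp
    ring
  simp_rw [h1]
  obtain ⟨M, hM0, hM⟩ := exists_bound_of_periodic hc.cont_deriv hc.per_deriv
  have hw := integral_swap_interval (hd.integrable_pot.ofReal (𝕜 := ℂ))
    (g := fun z x => ((-2 * kern c ε z x : ℝ) : ℂ)) (a := 0) (b := 2 * π)
    (Complex.continuous_ofReal.comp (continuous_const.mul (hc.continuous_kern hε.ne')))
    (C := 2 * (ε⁻¹ * M)) fun z x _ _ => by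
    rw [Complex.norm_real, norm_mul, ← cauchyK_mul_im]
    simp only [norm_neg, Real.norm_ofNat]
    gcongr
    refine (Complex.abs_im_le_norm _).trans ?_
    rw [norm_mul]
    gcongr
    · exact norm_cauchyK_le hε _ _
    · exact hM x
  have e3 : ∀ x, ∫ z, (pot d 0 z : ℂ) * ((-2 * kern c ε z x : ℝ) : ℂ) =
      ((∫ z, pot d 0 z * (-2 * kern c ε z x) : ℝ) : ℂ) := fun x => by
    rw [← integral_complex_ofReal]; simp
  have e4 : ∫ z, (pot d 0 z : ℂ) * ((∫ x in 0..2 * π, (-2 * kern c ε z x) : ℝ) : ℂ) =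
      ((∫ z, pot d 0 z * ∫ x in 0..2 * π, (-2 * kern c ε z x) : ℝ) : ℂ) := by
    rw [← integral_complex_ofReal]; simp
  have e5 : ∫ z, ((pot d 0 z : ℝ) : ℂ) * ((∫ x in 0..2 * π, (-2 * kern c ε z x) : ℝ) : ℂ) =
    ∫ x in 0..2 * π, ∫ z, (pot d 0 z : ℂ) * ((-2 * kern c ε z x : ℝ) : ℂ) := by
    convert! hw using 3
    exact congrArg _ intervalIntegral.integral_ofReal.symm
  rw [e4] at e5
  simp_rw [e3] at e5
  rw [intervalIntegral.integral_ofReal] at e5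
  have e6 := Complex.ofReal_injective e5
  rw [← e6, ← integral_const_mul]
  refine integral_congr_ae (Eventually.of_forall fun z => ?_)
  simp only
  rw [intervalIntegral.integral_const_mul]
  unfold pot
  field_simp
  ring

end IsSimpleClosed

/-- The normal flux density of a family of curves. -/
abbrev flux (c : ℝ → ℝ → ℂ) (t x : ℝ) : ℝ := (conj (vel c t x) * deriv (c t) x).im

lemma integral_add_exact {g T₁ T₂ T₃ T₄ : ℝ → ℝ → ℝ} (c₁ : Continuous fun p : ℝ × ℝ => T₁ p.1 p.2)
    (c₂ : Continuous fun p : ℝ × ℝ => T₂ p.1 p.2) (c₃ : Continuous fun p : ℝ × ℝ => T₃ p.1 p.2)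
    (c₄ : Continuous fun p : ℝ × ℝ => T₄ p.1 p.2) {a b : ℝ}
    (h₃ : ∀ y, ∫ x in a..b, T₃ x y = 0) (h₄ : ∀ x, ∫ y in a..b, T₄ x y = 0)
    (h : ∀ x y, g x y = -2 * T₁ x y + -2 * T₂ x y + T₃ x y + T₄ x y) :
    ∫ x in a..b, ∫ y in a..b, g x y =
      -2 * (∫ x in a..b, ∫ y in a..b, T₁ x y) + -2 * ∫ y in a..b, ∫ x in a..b, T₂ x y := by
  have cy : ∀ {T : ℝ → ℝ → ℝ}, (Continuous fun p : ℝ × ℝ => T p.1 p.2) → ∀ x,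
      Continuous fun y => T x y := fun h x =>
    h.comp (by fun_prop : Continuous fun y : ℝ => (x, y))
  have ci : ∀ {T : ℝ → ℝ → ℝ}, (Continuous fun p : ℝ × ℝ => T p.1 p.2) →
      Continuous fun x => ∫ y in a..b, T x y := fun h =>
    intervalIntegral.continuous_parametric_intervalIntegral_of_continuous' h a b
  have hcomb : ∀ {f₁ f₂ f₃ f₄ : ℝ → ℝ}, Continuous f₁ → Continuous f₂ → Continuous f₃ →
      Continuous f₄ → ∫ y in a..b, (-2 * f₁ y + -2 * f₂ y + f₃ y + f₄ y) =
        -2 * (∫ y in a..b, f₁ y) + -2 * (∫ y in a..b, f₂ y) + (∫ y in a..b, f₃ y) +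
          ∫ y in a..b, f₄ y := by
    intro f₁ f₂ f₃ f₄ k₁ k₂ k₃ k₄
    rw [intervalIntegral.integral_add (Continuous.intervalIntegrable (by fun_prop) _ _)
        (k₄.intervalIntegrable _ _),
      intervalIntegral.integral_add (Continuous.intervalIntegrable (by fun_prop) _ _)
        (k₃.intervalIntegrable _ _),
      intervalIntegral.integral_add (Continuous.intervalIntegrable (by fun_prop) _ _)
        (Continuous.intervalIntegrable (by fun_prop) _ _),
      intervalIntegral.integral_const_mul, intervalIntegral.integral_const_mul]
  have e : ∀ x, ∫ y in a..b, g x y = -2 * (∫ y in a..b, T₁ x y) + -2 * (∫ y in a..b, T₂ x y) +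
      ∫ y in a..b, T₃ x y := by
    intro x
    simp_rw [h]
    rw [hcomb (cy c₁ x) (cy c₂ x) (cy c₃ x) (cy c₄ x), h₄, add_zero]
  simp_rw [e]
  have h5 : ∫ x in a..b, ∫ y in a..b, T₃ x y = 0 := by
    rw [intervalIntegral_swap c₃]
    simp [h₃]
  have h6 := hcomb (ci c₁) (ci c₂) (ci c₃) (continuous_const (y := (0 : ℝ)))
  simp only [add_zero, intervalIntegral.integral_zero] at h6
  rw [h6, h5, add_zero, intervalIntegral_swap c₂]

namespace IsFamily
variable {c d : ℝ → ℝ → ℂ} (hc : IsFamily c) (hd : IsFamily d)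
include hc hd

lemma contDiff_logK_mul {ε : ℝ} (hε : ε ≠ 0) : ContDiff ℝ 1 fun p : (ℝ × ℝ) × ℝ =>
    logK ε (c p.1.1 p.1.2 - d p.1.1 p.2) *
      (conj (deriv (c p.1.1) p.1.2) * deriv (d p.1.1) p.2).re := by
  have e1 : ContDiff ℝ 1 fun p : (ℝ × ℝ) × ℝ => p.1 := contDiff_fst
  have e2 : ContDiff ℝ 1 fun p : (ℝ × ℝ) × ℝ => (p.1.1, p.2) := by fun_prop
  have h1 : ContDiff ℝ 1 fun p : (ℝ × ℝ) × ℝ => c p.1.1 p.1.2 :=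
    (hc.smooth.of_le (by norm_num)).comp e1
  have h2 : ContDiff ℝ 1 fun p : (ℝ × ℝ) × ℝ => d p.1.1 p.2 :=
    (hd.smooth.of_le (by norm_num)).comp e2
  have h3 : ContDiff ℝ 1 fun p : (ℝ × ℝ) × ℝ => deriv (c p.1.1) p.1.2 :=
    (hc.contDiff_deriv.of_le (by norm_num)).comp e1
  have h4 : ContDiff ℝ 1 fun p : (ℝ × ℝ) × ℝ => deriv (d p.1.1) p.2 :=
    (hd.contDiff_deriv.of_le (by norm_num)).comp e2
  exact ((contDiff_logK hε).comp (h1.sub h2)).mul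
    (Complex.reCLM.contDiff.comp ((contDiff_conj.comp h3).mul h4))

lemma hasDerivAt_logK_mul {ε : ℝ} (hε : ε ≠ 0) (t x y : ℝ) :
    HasDerivAt (fun s => logK ε (c s x - d s y) * (conj (deriv (c s) x) * deriv (d s) y).re)
      (2 * (conj (c t x - d t y) * (vel c t x - vel d t y)).re /
          (Complex.normSq (c t x - d t y) + ε ^ 2) *
          (conj (deriv (c t) x) * deriv (d t) y).re +
        logK ε (c t x - d t y) *
          ((conj (mixed c t x) * deriv (d t) y).re +
            (conj (deriv (c t) x) * mixed d t y).re)) t := by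
  have h1 := hasDerivAt_logK hε ((hc.hasDerivAt_time t x).sub (hd.hasDerivAt_time t y))
  have h2 := Complex.reCLM.hasFDerivAt.comp_hasDerivAt t
    (((Complex.conjCLE : ℂ →L[ℝ] ℂ).hasFDerivAt.comp_hasDerivAt t
      (hc.hasDerivAt_deriv_time t x)).mul (hd.hasDerivAt_deriv_time t y))
  refine (h1.mul h2).congr_deriv ?_
  simp

omit hd in
lemma hasDerivAt_exact_left {ε : ℝ} (hε : ε ≠ 0) (t x y : ℝ) :
    HasDerivAt (fun x => logK ε (c t x - d t y) * (conj (vel c t x) * deriv (d t) y).re)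
      (2 * (conj (c t x - d t y) * deriv (c t) x).re /
          (Complex.normSq (c t x - d t y) + ε ^ 2) * (conj (vel c t x) * deriv (d t) y).re +
        logK ε (c t x - d t y) * (conj (mixed c t x) * deriv (d t) y).re) x := by
  have h1 := hasDerivAt_logK hε (((hc.simple t).hasDerivAt x).sub_const (d t y))
  have h2 := Complex.reCLM.hasFDerivAt.comp_hasDerivAt x
    (((Complex.conjCLE : ℂ →L[ℝ] ℂ).hasFDerivAt.comp_hasDerivAt x
      (hc.hasDerivAt_vel t x)).mul_const (deriv (d t) y))
  refine (h1.mul h2).congr_deriv ?_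
  simp

omit hc in
lemma hasDerivAt_exact_right {ε : ℝ} (hε : ε ≠ 0) (t x y : ℝ) :
    HasDerivAt (fun y => logK ε (c t x - d t y) * (conj (deriv (c t) x) * vel d t y).re)
      (-(2 * (conj (c t x - d t y) * deriv (d t) y).re /
          (Complex.normSq (c t x - d t y) + ε ^ 2)) * (conj (deriv (c t) x) * vel d t y).re +
        logK ε (c t x - d t y) * (conj (deriv (c t) x) * mixed d t y).re) y := by
  have h1 := hasDerivAt_logK hε (((hd.simple t).hasDerivAt y).const_sub (c t x))
  have h2 := Complex.reCLM.hasFDerivAt.comp_hasDerivAt y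
    ((hd.hasDerivAt_vel t y).const_mul (conj (deriv (c t) x)))
  refine (h1.mul h2).congr_deriv ?_
  simp
  ring

omit hc hd in
lemma exact_identity (ε : ℝ) (t x y : ℝ) :
    2 * (conj (c t x - d t y) * (vel c t x - vel d t y)).re /
          (Complex.normSq (c t x - d t y) + ε ^ 2) *
          (conj (deriv (c t) x) * deriv (d t) y).re +
        logK ε (c t x - d t y) *
          ((conj (mixed c t x) * deriv (d t) y).re + (conj (deriv (c t) x) * mixed d t y).re) =
    -2 * (kern (d t) ε (c t x) y * flux c t x) + -2 * (kern (c t) ε (d t y) x * flux d t y) +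
      (2 * (conj (c t x - d t y) * deriv (c t) x).re /
          (Complex.normSq (c t x - d t y) + ε ^ 2) * (conj (vel c t x) * deriv (d t) y).re +
        logK ε (c t x - d t y) * (conj (mixed c t x) * deriv (d t) y).re) +
      (-(2 * (conj (c t x - d t y) * deriv (d t) y).re /
          (Complex.normSq (c t x - d t y) + ε ^ 2)) * (conj (deriv (c t) x) * vel d t y).re +
        logK ε (c t x - d t y) * (conj (deriv (c t) x) * mixed d t y).re) := by
  unfold kern flux
  rw [show Complex.normSq (d t y - c t x) = Complex.normSq (c t x - d t y) by
    rw [← Complex.normSq_neg, neg_sub]]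
  generalize Complex.normSq (c t x - d t y) = D
  simp only [div_eq_mul_inv, Complex.mul_re, Complex.mul_im, Complex.conj_re, Complex.conj_im,
    Complex.sub_re, Complex.sub_im, map_sub]
  ring

lemma continuous_exact_terms {ε : ℝ} (hε : ε ≠ 0) (t : ℝ) :
    (Continuous fun p : ℝ × ℝ => kern (d t) ε (c t p.1) p.2 * flux c t p.1) ∧
    (Continuous fun p : ℝ × ℝ => kern (c t) ε (d t p.2) p.1 * flux d t p.2) ∧
    (Continuous fun p : ℝ × ℝ => 2 * (conj (c t p.1 - d t p.2) * deriv (c t) p.1).re /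
          (Complex.normSq (c t p.1 - d t p.2) + ε ^ 2) * (conj (vel c t p.1) * deriv (d t) p.2).re +
        logK ε (c t p.1 - d t p.2) * (conj (mixed c t p.1) * deriv (d t) p.2).re) ∧
    (Continuous fun p : ℝ × ℝ => -(2 * (conj (c t p.1 - d t p.2) * deriv (d t) p.2).re /
          (Complex.normSq (c t p.1 - d t p.2) + ε ^ 2)) *
          (conj (deriv (c t) p.1) * vel d t p.2).re +
        logK ε (c t p.1 - d t p.2) * (conj (deriv (c t) p.1) * mixed d t p.2).re) := by
  have cvc : Continuous fun p : ℝ × ℝ => vel c t p.1 :=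
    hc.continuous_vel.comp (by fun_prop : Continuous fun p : ℝ × ℝ => (t, p.1))
  have cvd : Continuous fun p : ℝ × ℝ => vel d t p.2 :=
    hd.continuous_vel.comp (by fun_prop : Continuous fun p : ℝ × ℝ => (t, p.2))
  have cmc : Continuous fun p : ℝ × ℝ => mixed c t p.1 :=
    hc.continuous_mixed.comp (by fun_prop : Continuous fun p : ℝ × ℝ => (t, p.1))
  have cmd : Continuous fun p : ℝ × ℝ => mixed d t p.2 :=
    hd.continuous_mixed.comp (by fun_prop : Continuous fun p : ℝ × ℝ => (t, p.2))
  have cc : Continuous fun p : ℝ × ℝ => c t p.1 := (hc.simple t).cont.comp continuous_fst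
  have cd : Continuous fun p : ℝ × ℝ => d t p.2 := (hd.simple t).cont.comp continuous_snd
  have cdc : Continuous fun p : ℝ × ℝ => deriv (c t) p.1 :=
    (hc.simple t).cont_deriv.comp continuous_fst
  have cdd : Continuous fun p : ℝ × ℝ => deriv (d t) p.2 :=
    (hd.simple t).cont_deriv.comp continuous_snd
  have cL : Continuous fun p : ℝ × ℝ => logK ε (c t p.1 - d t p.2) :=
    (contDiff_logK hε (n := 1)).continuous.comp (cc.sub cd)
  have cD : Continuous fun p : ℝ × ℝ => Complex.normSq (c t p.1 - d t p.2) + ε ^ 2 :=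
    (Complex.continuous_normSq.comp (cc.sub cd)).add_const _
  have hD : ∀ p : ℝ × ℝ, Complex.normSq (c t p.1 - d t p.2) + ε ^ 2 ≠ 0 :=
    fun p => (normSq_add_sq_pos hε _).ne'
  have ckc : Continuous fun p : ℝ × ℝ => kern (c t) ε (d t p.2) p.1 :=
    ((hc.simple t).continuous_kern hε).comp (cd.prodMk continuous_fst)
  have ckd : Continuous fun p : ℝ × ℝ => kern (d t) ε (c t p.1) p.2 :=
    ((hd.simple t).continuous_kern hε).comp (cc.prodMk continuous_snd)
  have hre : ∀ {u v : ℝ × ℝ → ℂ}, Continuous u → Continuous v →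
      Continuous fun p => (conj (u p) * v p).re := fun hu hv =>
    Complex.continuous_re.comp ((Complex.continuous_conj.comp hu).mul hv)
  have him : ∀ {u v : ℝ × ℝ → ℂ}, Continuous u → Continuous v →
      Continuous fun p => (conj (u p) * v p).im := fun hu hv =>
    Complex.continuous_im.comp ((Complex.continuous_conj.comp hu).mul hv)
  refine ⟨ckd.mul (him cvc cdc), ckc.mul (him cvd cdd), ?_, ?_⟩
  · exact (((continuous_const.mul (hre (cc.sub cd) cdc)).div cD hD).mul (hre cvc cdd)).add
      (cL.mul (hre cmc cdd))
  · exact (((continuous_const.mul (hre (cc.sub cd) cdd)).div cD hD).neg.mul (hre cdc cvd)).add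
      (cL.mul (hre cdc cmd))

lemma integral_energy_density {ε : ℝ} (hε : ε ≠ 0) (t : ℝ) :
    ∫ x in 0..2 * π, ∫ y in 0..2 * π, deriv (fun s => logK ε (c s x - d s y) *
        (conj (deriv (c s) x) * deriv (d s) y).re) t =
      -2 * (∫ x in 0..2 * π, ∫ y in 0..2 * π, kern (d t) ε (c t x) y * flux c t x) +
      -2 * ∫ y in 0..2 * π, ∫ x in 0..2 * π, kern (c t) ε (d t y) x * flux d t y := by
  obtain ⟨c1, c2, c3, c4⟩ := hc.continuous_exact_terms hd hε t
  refine integral_add_exact (a := 0) (b := 2 * π)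
    (T₃ := fun x y => 2 * (conj (c t x - d t y) * deriv (c t) x).re /
          (Complex.normSq (c t x - d t y) + ε ^ 2) * (conj (vel c t x) * deriv (d t) y).re +
        logK ε (c t x - d t y) * (conj (mixed c t x) * deriv (d t) y).re)
    (T₄ := fun x y => -(2 * (conj (c t x - d t y) * deriv (d t) y).re /
          (Complex.normSq (c t x - d t y) + ε ^ 2)) * (conj (deriv (c t) x) * vel d t y).re +
        logK ε (c t x - d t y) * (conj (deriv (c t) x) * mixed d t y).re) c1 c2 c3 c4 ?_ ?_ ?_
  · intro y
    have h := c3.comp (by fun_prop : Continuous fun x : ℝ => (x, y))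
    simp only [Function.comp_def] at h
    exact integral_deriv_periodic (fun x => hc.hasDerivAt_exact_left hε t x y) h fun x => by
      rw [(hc.simple t).per x, hc.vel_periodic t x]
  · intro x
    have h := c4.comp (by fun_prop : Continuous fun y : ℝ => (x, y))
    simp only [Function.comp_def] at h
    exact integral_deriv_periodic (fun y => hd.hasDerivAt_exact_right hε t x y) h fun y => by
      rw [(hd.simple t).per y, hd.vel_periodic t y]
  · intro x y
    exact ((hc.hasDerivAt_logK_mul hd hε t x y).deriv).trans (exact_identity ε t x y)

lemma hasDerivAt_energy {ε : ℝ} (hε : 0 < ε) (t : ℝ) :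
    HasDerivAt (fun t => ∫ z, pot (d t) 0 z * pot (c t) ε z)
      ((∫ x in 0..2 * π, pot (d t) ε (c t x) * flux c t x) +
        ∫ y in 0..2 * π, pot (c t) ε (d t y) * flux d t y) t := by
  have hG := hc.contDiff_logK_mul hd hε.ne'
  have h1 := deriv_intervalIntegral (contDiff_intervalIntegral hG 0 (2 * π)) 0 (2 * π) t
  have h2 : (fun t => ∫ z, pot (d t) 0 z * pot (c t) ε z) = fun t => -(4 * π)⁻¹ *
      ∫ x in 0..2 * π, ∫ y in 0..2 * π, logK ε (c t x - d t y) *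
        (conj (deriv (c t) x) * deriv (d t) y).re := by
    funext s
    rw [(hc.simple s).integral_logK (hd.simple s) hε]
    field_simp
  rw [h2]
  refine (h1.const_mul (-(4 * π)⁻¹)).congr_deriv ?_
  have h3 : ∀ x, deriv (fun s => ∫ y in 0..2 * π, logK ε (c s x - d s y) *
        (conj (deriv (c s) x) * deriv (d s) y).re) t =
      ∫ y in 0..2 * π, deriv (fun s => logK ε (c s x - d s y) *
        (conj (deriv (c s) x) * deriv (d s) y).re) t := by
    intro x
    have hGx : ContDiff ℝ 1 fun q : ℝ × ℝ => logK ε (c q.1 x - d q.1 q.2) *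
        (conj (deriv (c q.1) x) * deriv (d q.1) q.2).re :=
      hG.comp (by fun_prop : ContDiff ℝ 1 fun q : ℝ × ℝ => (((q.1, x), q.2) : (ℝ × ℝ) × ℝ))
    exact (deriv_intervalIntegral hGx 0 (2 * π) t).deriv
  have h3' := intervalIntegral.integral_congr (a := 0) (b := 2 * π) (μ := volume) fun x _ => h3 x
  refine (congrArg (-(4 * π)⁻¹ * ·) h3').trans ?_
  clear h1 h3 h3'
  rw [hc.integral_energy_density hd hε.ne']
  have hpi := Real.pi_ne_zero
  have h7 : ∀ (k w : ℝ → ℂ) (v : ℝ → ℝ),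
      ∫ x in 0..2 * π, ∫ y in 0..2 * π, kern k ε (w x) y * v x =
      (2 * π) * ∫ x in 0..2 * π, pot k ε (w x) * v x := by
    intro k w v
    rw [← intervalIntegral.integral_const_mul]
    refine intervalIntegral.integral_congr fun x _ => ?_
    simp only [intervalIntegral.integral_mul_const, pot]
    field_simp
  rw [h7 (d t) (c t) (flux c t), h7 (c t) (d t) (flux d t)]
  field_simp
  ring

end IsFamily

namespace IsSimpleClosed
variable {c d : ℝ → ℂ} (hc : IsSimpleClosed c)
include hc

lemma abs_pot_le_deg (ε : ℝ) (hε : 0 < ε) (z : ℂ) : |pot c ε z| ≤ |deg c| := by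
  have h0 : ∀ z, |pot c 0 z| ≤ |deg c| := by
    intro z
    by_cases hz : z ∈ range c
    · obtain ⟨x, rfl⟩ := hz
      rw [hc.pot_curve, abs_div]
      have := abs_nonneg (deg c)
      norm_num
    · rcases hc.pot_eq_or hz with h | h <;> simp [h]
  rw [hc.pot_eq_integral hε]
  have h1 := norm_integral_le_of_norm_le (f := fun w => pot c 0 w * rho ε (w - z))
    ((integrable_rho hε z).const_mul |deg c|) (Eventually.of_forall fun w => by
      rw [norm_mul, Real.norm_eq_abs, Real.norm_eq_abs, abs_of_nonneg (rho_nonneg _ _)]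
      exact mul_le_mul_of_nonneg_right (h0 w) (rho_nonneg _ _))
  rw [integral_const_mul, integral_rho hε, mul_one] at h1
  exact h1

lemma tendsto_energy (hd : IsSimpleClosed d) :
    Tendsto (fun ε => ∫ z, pot d 0 z * pot c ε z) (𝓝[>] 0) (𝓝 (∫ z, pot d 0 z * pot c 0 z)) := by
  refine tendsto_integral_filter_of_dominated_convergence (fun z => |pot d 0 z| * |deg c|) ?_ ?_ ?_
    (Eventually.of_forall fun z => (hc.tendsto_pot z).const_mul _)
  · exact Eventually.of_forall fun ε =>
      ((hd.measurable_pot 0).mul (hc.measurable_pot ε)).aestronglyMeasurable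
  · filter_upwards [self_mem_nhdsWithin] with ε hε
    refine Eventually.of_forall fun z => ?_
    rw [norm_mul, Real.norm_eq_abs, Real.norm_eq_abs]
    exact mul_le_mul_of_nonneg_left (hc.abs_pot_le_deg ε hε z) (abs_nonneg _)
  · exact hd.integrable_pot.abs.mul_const _

lemma tendsto_integral_pot_mul {u : ℝ → ℂ} (hu : Continuous u) {v : ℝ → ℝ} (hv : Continuous v)
    (a b : ℝ) :
    Tendsto (fun ε => ∫ x in a..b, pot c ε (u x) * v x) (𝓝[>] 0)
      (𝓝 (∫ x in a..b, pot c 0 (u x) * v x)) := by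
  refine intervalIntegral.tendsto_integral_filter_of_dominated_convergence
    (fun x => |deg c| * |v x|) ?_ ?_ ?_ ?_
  · exact Eventually.of_forall fun ε =>
      (((hc.measurable_pot ε).comp hu.measurable).mul hv.measurable).aestronglyMeasurable
  · filter_upwards [self_mem_nhdsWithin] with ε hε
    refine Eventually.of_forall fun z _ => ?_
    rw [norm_mul, Real.norm_eq_abs, Real.norm_eq_abs]
    exact mul_le_mul_of_nonneg_right (hc.abs_pot_le_deg ε hε _) (abs_nonneg _)
  · exact Continuous.intervalIntegrable (by fun_prop) _ _
  · exact Eventually.of_forall fun x _ => (hc.tendsto_pot _).mul_const _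

end IsSimpleClosed

namespace IsFamily
variable {c d : ℝ → ℝ → ℂ} (hc : IsFamily c) (hd : IsFamily d)
include hc

lemma contDiff_area : ContDiff ℝ 1 fun t => ∫ z, pot (c t) 0 z := by
  have e : (fun t => ∫ z, pot (c t) 0 z) =
      fun t => 2⁻¹ * ∫ x in 0..2 * π, (conj (c t x) * deriv (c t) x).im :=
    funext fun t => (hc.simple t).integral_pot
  rw [e]
  have hG : ContDiff ℝ 1 fun p : ℝ × ℝ => (conj (c p.1 p.2) * deriv (c p.1) p.2).im :=
    Complex.imCLM.contDiff.comp (((contDiff_conj (n := 1)).comp (hc.smooth.of_le (by norm_num))).mul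
      (hc.contDiff_deriv.of_le (by norm_num)))
  exact contDiff_const.mul (contDiff_intervalIntegral hG 0 (2 * π))

lemma deg_eq (s t : ℝ) : deg (c s) = deg (c t) :=
  deg_const hc.continuous hc.continuous_deriv (s := univ) isPreconnected_univ
    (fun t _ => hc.simple t) (mem_univ _) (mem_univ _)

include hd

lemma contDiff_energy {ε : ℝ} (hε : 0 < ε) :
    ContDiff ℝ 1 fun t => ∫ z, pot (d t) 0 z * pot (c t) ε z := by
  have h2 : (fun t => ∫ z, pot (d t) 0 z * pot (c t) ε z) = fun t => -(4 * π)⁻¹ *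
      ∫ x in 0..2 * π, ∫ y in 0..2 * π, logK ε (c t x - d t y) *
        (conj (deriv (c t) x) * deriv (d t) y).re := by
    funext s
    rw [(hc.simple s).integral_logK (hd.simple s) hε]
    field_simp
  rw [h2]
  exact contDiff_const.mul (contDiff_intervalIntegral
    (contDiff_intervalIntegral (hc.contDiff_logK_mul hd hε.ne') 0 (2 * π)) 0 (2 * π))

/-- Under the curvature flow, the integral of an admissible combination of the potentials of two
curves with exactly two intersection points does not increase. -/
lemma integral_pot_le {α β γ a b : ℝ} (hab : a ≤ b)
    (hfc : ∀ t ∈ Icc a b, ∀ x, flux c t x = -(deriv (deriv (c t)) x / deriv (c t) x).im)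
    (hfd : ∀ t ∈ Icc a b, ∀ x, flux d t x = -(deriv (deriv (d t)) x / deriv (d t) x).im)
    (h2 : ∀ t ∈ Icc a b, ∃ P Q, P ≠ Q ∧ range (c t) ∩ range (d t) = {P, Q})
    (hF : ∀ t ∈ Icc a b, ∀ z ∉ range (c t), z ∉ range (d t) →
      0 ≤ α * pot (c t) 0 z + β * pot (d t) 0 z + γ * (pot (c t) 0 z * pot (d t) 0 z)) :
    α * (∫ z, pot (c b) 0 z) + β * (∫ z, pot (d b) 0 z) + γ * (∫ z, pot (d b) 0 z * pot (c b) 0 z) ≤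
    α * (∫ z, pot (c a) 0 z) + β * (∫ z, pot (d a) 0 z) +
      γ * (∫ z, pot (d a) 0 z * pot (c a) 0 z) := by
  set Φ : ℝ → ℝ → ℝ := fun ε t => α * (∫ z, pot (c t) 0 z) + β * (∫ z, pot (d t) 0 z) +
    γ * (∫ z, pot (d t) 0 z * pot (c t) ε z) with hΦ
  set R : ℝ → ℝ → ℝ := fun ε t => α * (∫ x in 0..2 * π, flux c t x) +
    β * (∫ x in 0..2 * π, flux d t x) + γ * ((∫ x in 0..2 * π, pot (d t) ε (c t x) * flux c t x) +
        ∫ y in 0..2 * π, pot (c t) ε (d t y) * flux d t y) with hR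
  have cfc : ∀ t, Continuous (flux c t) := fun t =>
    hc.continuous_flux.comp (by fun_prop : Continuous fun x : ℝ => (t, x))
  have cfd : ∀ t, Continuous (flux d t) := fun t =>
    hd.continuous_flux.comp (by fun_prop : Continuous fun x : ℝ => (t, x))
  have hder : ∀ ε > 0, ∀ t, HasDerivAt (Φ ε) (R ε t) t := fun ε hε t =>
    (((hc.hasDerivAt_area t).const_mul α).add ((hd.hasDerivAt_area t).const_mul β)).add
      ((hc.hasDerivAt_energy hd hε t).const_mul γ)
  have hcd : ∀ ε > 0, ContDiff ℝ 1 (Φ ε) := fun ε hε =>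
    ((contDiff_const.mul hc.contDiff_area).add (contDiff_const.mul hd.contDiff_area)).add
      (contDiff_const.mul (hc.contDiff_energy hd hε))
  have hRc : ∀ ε > 0, Continuous (R ε) := fun ε hε => by
    have h := (hcd ε hε).continuous_deriv le_rfl
    rwa [show deriv (Φ ε) = R ε from funext fun t => (hder ε hε t).deriv] at h
  have hInt : ∀ ε > 0, ∫ t in a..b, R ε t = Φ ε b - Φ ε a := fun ε hε =>
    intervalIntegral.integral_eq_sub_of_hasDerivAt (fun t _ => hder ε hε t)
      ((hRc ε hε).intervalIntegrable _ _)
  have hΦl : ∀ t, Tendsto (fun ε => Φ ε t) (𝓝[>] 0) (𝓝 (Φ 0 t)) := fun t =>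
    ((hc.simple t).tendsto_energy (hd.simple t)).const_mul γ |>.const_add _
  have hRl : ∀ t, Tendsto (fun ε => R ε t) (𝓝[>] 0) (𝓝 (R 0 t)) := fun t =>
    ((((hd.simple t).tendsto_integral_pot_mul (hc.simple t).cont (cfc t) _ _).add
      ((hc.simple t).tendsto_integral_pot_mul (hd.simple t).cont (cfd t)
        _ _)).const_mul γ).const_add _
  have hR0 : ∀ t ∈ Icc a b, R 0 t ≤ 0 := by
    intro t ht
    obtain ⟨P, Q, hPQ, h⟩ := h2 t ht
    have hw := (hc.simple t).weight_curvature_nonneg (hd.simple t) (hF t ht) hPQ h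
    have key : ∀ {u v : ℝ → ℂ} (hu : IsSimpleClosed u) (hv : IsSimpleClosed v) {f g : ℝ → ℝ}
        (hf : Continuous f) (hg : ∀ x, f x = - g x) (κ : ℝ),
        ∫ x in 0..2 * π, (κ + γ * pot v 0 (u x)) * g x =
        -(κ * (∫ x in 0..2 * π, f x) + γ * ∫ x in 0..2 * π, pot v 0 (u x) * f x) := by
      intro u v hu hv f g hf hg κ
      obtain ⟨B, -, hB⟩ := hv.exists_pot_bound
      have hi : IntervalIntegrable (fun x => pot v 0 (u x) * f x) volume 0 (2 * π) := by
        have := hf.intervalIntegrable (μ := volume) 0 (2 * π)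
        rw [intervalIntegrable_iff] at this ⊢
        exact this.bdd_mul (c := B) (hv.measurable_pot_comp hu).aestronglyMeasurable
          (Eventually.of_forall fun x => hB 0 _)
      rw [← intervalIntegral.integral_const_mul, ← intervalIntegral.integral_const_mul,
        ← intervalIntegral.integral_add ((hf.intervalIntegrable _ _).const_mul κ) (hi.const_mul γ),
        ← intervalIntegral.integral_neg]
      refine intervalIntegral.integral_congr fun x _ => ?_
      rw [hg x]
      ring
    rw [key (hc.simple t) (hd.simple t) (cfc t) (hfc t ht),
      key (hd.simple t) (hc.simple t) (cfd t) (hfd t ht)] at hw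
    simp only [hR]
    linarith
  obtain ⟨Mc, hMc⟩ := (isCompact_Icc (a := a) (b := b)).prod (isCompact_Icc (a := 0) (b := 2 * π))
    |>.exists_bound_of_continuousOn hc.continuous_flux.continuousOn
  obtain ⟨Md, hMd⟩ := (isCompact_Icc (a := a) (b := b)).prod (isCompact_Icc (a := 0) (b := 2 * π))
    |>.exists_bound_of_continuousOn hd.continuous_flux.continuousOn
  have hbnd : ∀ {f : ℝ → ℝ} {M : ℝ}, (∀ x ∈ Icc 0 (2 * π), |f x| ≤ M) →
      |∫ x in 0..2 * π, f x| ≤ M * (2 * π) := by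
    intro f M h
    have := intervalIntegral.norm_integral_le_of_norm_le_const (a := 0) (b := 2 * π) (f := f)
      (C := M) fun x hx => h x (by
        rw [uIoc_of_le (by positivity)] at hx
        exact Ioc_subset_Icc_self hx)
    rwa [sub_zero, abs_of_pos (by positivity : (0 : ℝ) < 2 * π)] at this
  have hRb : ∀ ε > 0, ∀ t ∈ Icc a b, |R ε t| ≤ |α| * (Mc * (2 * π)) + |β| * (Md * (2 * π)) +
      |γ| * (|deg (d a)| * Mc * (2 * π) + |deg (c a)| * Md * (2 * π)) := by
    intro ε hε t ht
    have b1 := hbnd fun x hx => hMc (t, x) ⟨ht, hx⟩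
    have b2 := hbnd fun x hx => hMd (t, x) ⟨ht, hx⟩
    have b3 : |∫ x in 0..2 * π, pot (d t) ε (c t x) * flux c t x| ≤
        |deg (d a)| * Mc * (2 * π) := hbnd fun x hx => by
      rw [abs_mul, hd.deg_eq a t]
      exact mul_le_mul ((hd.simple t).abs_pot_le_deg ε hε _) (hMc (t, x) ⟨ht, hx⟩)
        (abs_nonneg _) (abs_nonneg _)
    have b4 : |∫ x in 0..2 * π, pot (c t) ε (d t x) * flux d t x| ≤
        |deg (c a)| * Md * (2 * π) := hbnd fun x hx => by
      rw [abs_mul, hc.deg_eq a t]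
      exact mul_le_mul ((hc.simple t).abs_pot_le_deg ε hε _) (hMd (t, x) ⟨ht, hx⟩)
        (abs_nonneg _) (abs_nonneg _)
    simp only [hR]
    refine (abs_add_le _ _).trans (add_le_add ((abs_add_le _ _).trans (add_le_add ?_ ?_)) ?_)
    · rw [abs_mul]; exact mul_le_mul_of_nonneg_left b1 (abs_nonneg _)
    · rw [abs_mul]; exact mul_le_mul_of_nonneg_left b2 (abs_nonneg _)
    · rw [abs_mul]
      exact mul_le_mul_of_nonneg_left ((abs_add_le _ _).trans (add_le_add b3 b4)) (abs_nonneg _)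
  have hlim : Tendsto (fun ε => ∫ t in a..b, R ε t) (𝓝[>] 0) (𝓝 (∫ t in a..b, R 0 t)) := by
    refine intervalIntegral.tendsto_integral_filter_of_dominated_convergence
      (fun _ => |α| * (Mc * (2 * π)) + |β| * (Md * (2 * π)) +
      |γ| * (|deg (d a)| * Mc * (2 * π) + |deg (c a)| * Md * (2 * π))) ?_ ?_ ?_ ?_
    · filter_upwards [self_mem_nhdsWithin] with ε hε
      exact (hRc ε hε).aestronglyMeasurable
    · filter_upwards [self_mem_nhdsWithin] with ε hε
      refine Eventually.of_forall fun t ht => hRb ε hε t ?_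
      rw [uIoc_of_le hab] at ht
      exact Ioc_subset_Icc_self ht
    · exact intervalIntegrable_const
    · exact Eventually.of_forall fun t _ => hRl t
  have hlim2 : Tendsto (fun ε => ∫ t in a..b, R ε t) (𝓝[>] 0) (𝓝 (Φ 0 b - Φ 0 a)) := by
    refine ((hΦl b).sub (hΦl a)).congr' ?_
    filter_upwards [self_mem_nhdsWithin] with ε hε
    exact (hInt ε hε).symm
  have heq := tendsto_nhds_unique hlim hlim2
  have hle : 0 ≤ ∫ t in a..b, -R 0 t :=
    intervalIntegral.integral_nonneg hab fun t ht => neg_nonneg.2 (hR0 t ht)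
  rw [intervalIntegral.integral_neg, heq] at hle
  have : Φ 0 b ≤ Φ 0 a := by linarith
  exact this

end IsFamily

/-- The winding number of `c` around `z`, normalized to be `0` outside and `1` inside. -/
def chi (c : ℝ → ℂ) (z : ℂ) : ℝ := pot c 0 z / deg c

namespace IsSimpleClosed
variable {c d : ℝ → ℂ} (hc : IsSimpleClosed c)
include hc

lemma chi_eq_or {z : ℂ} (hz : z ∉ range c) : chi c z = 0 ∨ chi c z = 1 := by
  rcases hc.pot_eq_or hz with h | h
  · left; simp [chi, h]
  · right; rw [chi, h, div_self hc.deg_ne_zero]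

lemma chi_curve (x : ℝ) : chi c (c x) = 1 / 2 := by
  rw [chi, hc.pot_curve]; field_simp [hc.deg_ne_zero]

lemma chi_nonneg (z : ℂ) : 0 ≤ chi c z := by
  by_cases hz : z ∈ range c
  · obtain ⟨x, rfl⟩ := hz
    rw [hc.chi_curve]; norm_num
  · rcases hc.chi_eq_or hz with h | h <;> norm_num [h]

lemma chi_le_one (z : ℂ) : chi c z ≤ 1 := by
  by_cases hz : z ∈ range c
  · obtain ⟨x, rfl⟩ := hz
    rw [hc.chi_curve]; norm_num
  · rcases hc.chi_eq_or hz with h | h <;> norm_num [h]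

lemma measurable_chi : Measurable (chi c) := (hc.measurable_pot 0).div_const _

lemma continuousAt_chi {z : ℂ} (hz : z ∉ range c) : ContinuousAt (chi c) z :=
  (hc.continuousAt_pot hz).div_const _

lemma integrable_chi : Integrable (chi c) := hc.integrable_pot.div_const _

lemma integrable_chi_mul (hd : IsSimpleClosed d) : Integrable fun z => chi c z * chi d z := by
  refine hd.integrable_chi.bdd_mul (c := 1) hc.measurable_chi.aestronglyMeasurable
    (Eventually.of_forall fun z => ?_)
  rw [Real.norm_eq_abs, abs_of_nonneg (hc.chi_nonneg z)]
  exact hc.chi_le_one z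

lemma chi_eq_zero {R : ℝ} (hR : ∀ x, ‖c x‖ < R) {z : ℂ} (hz : R ≤ ‖z‖) : chi c z = 0 := by
  obtain ⟨R', -, h'⟩ := hc.exists_pot_eq_zero
  have hR0 : 0 < R := (norm_nonneg _).trans_lt (hR 0)
  have hz0 : 0 < ‖z‖ := hR0.trans_le hz
  have hoff : ∀ r ∈ Ici (1 : ℝ), (r : ℂ) * z ∉ range c := by
    rintro r hr ⟨x, hx⟩
    have h1 := hR x
    rw [hx, norm_mul, Complex.norm_real, Real.norm_eq_abs,
      abs_of_nonneg (by linarith [mem_Ici.1 hr])] at h1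
    nlinarith [mem_Ici.1 hr]
  have key := eq_of_continuousOn_of_int (s := Ici (1 : ℝ)) isPreconnected_Ici
    (f := fun r => chi c ((r : ℂ) * z))
    (fun r hr => ((hc.continuousAt_chi (hoff r hr)).comp (f := fun r : ℝ => (r : ℂ) * z)
      (by fun_prop)).continuousWithinAt)
    (fun r hr => by
      rcases hc.chi_eq_or (hoff r hr) with h | h
      · exact ⟨0, by simp [h]⟩
      · exact ⟨1, by simp [h]⟩) (x := 1) (y := max 1 (R' / ‖z‖)) (mem_Ici.2 le_rfl)
      (mem_Ici.2 (le_max_left _ _))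
  simp only [Complex.ofReal_one, one_mul] at key
  rw [key, chi, h', zero_div]
  rw [norm_mul, Complex.norm_real, Real.norm_eq_abs, abs_of_nonneg (by positivity)]
  calc R' = R' / ‖z‖ * ‖z‖ := by field_simp
    _ ≤ _ := by gcongr; exact le_max_right _ _

end IsSimpleClosed

/-- A closed embedded solution of the curve shortening flow on the time interval `(0, S)`. -/
structure IsFlow (c : ℝ → ℝ → ℂ) (S : ℝ) : Prop where
  smooth : ContDiffOn ℝ 3 (fun p : ℝ × ℝ => c p.1 p.2) (Ioo 0 S ×ˢ univ)
  simple : ∀ t ∈ Ioo 0 S, IsSimpleClosed (c t)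
  flow : ∀ t ∈ Ioo 0 S, ∀ x, flux c t x = -(deriv (deriv (c t)) x / deriv (c t) x).im

lemma exists_clamp {a b S : ℝ} (ha : 0 < a) (hab : a ≤ b) (hb : b < S) :
    ∃ τ : ℝ → ℝ, ContDiff ℝ 3 τ ∧ (∀ t, τ t ∈ Ioo 0 S) ∧
      ∃ η > 0, ∀ t ∈ Ioo (a - η) (b + η), τ t = t := by
  obtain ⟨η, hη, h1, h2⟩ : ∃ η > 0, 3 * η ≤ a ∧ 3 * η ≤ S - b :=
    ⟨min a (S - b) / 3, by have := lt_min ha (sub_pos.2 hb); positivity, by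
      linarith [min_le_left a (S - b)], by linarith [min_le_right a (S - b)]⟩
  let f : ContDiffBump ((a + b) / 2) :=
    ⟨(b - a) / 2 + η, (b - a) / 2 + 2 * η, by linarith, by linarith⟩
  refine ⟨fun t => (a + b) / 2 + (t - (a + b) / 2) * f t, ?_, fun t => ?_, η, hη, fun t ht => ?_⟩
  · have := f.contDiff (n := 3)
    fun_prop
  · have hlt : |(t - (a + b) / 2) * f t| < (b - a) / 2 + 2 * η := by
      by_cases h : |t - (a + b) / 2| < (b - a) / 2 + 2 * η
      · rw [abs_mul, abs_of_nonneg f.nonneg]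
        nlinarith [f.le_one (x := t), f.nonneg (x := t), abs_nonneg (t - (a + b) / 2)]
      · rw [f.zero_of_le_dist (by rw [Real.dist_eq]; exact not_lt.1 h)]
        rw [mul_zero, abs_zero]; linarith
    rw [abs_lt] at hlt
    constructor <;> linarith
  · have h := f.one_of_mem_closedBall (x := t) (by
      rw [mem_closedBall, Real.dist_eq, abs_le]
      constructor <;> (simp only [f]; linarith [ht.1, ht.2]))
    simp only [h]; ring

namespace IsFlow
variable {c d : ℝ → ℝ → ℂ} {S : ℝ} (hc : IsFlow c S) (hd : IsFlow d S)
include hc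

lemma exists_family {a b : ℝ} (ha : 0 < a) (hab : a ≤ b) (hb : b < S) :
    ∃ c', IsFamily c' ∧ ∃ η > 0, ∀ t ∈ Ioo (a - η) (b + η), c' t = c t := by
  obtain ⟨τ, h1, h2, η, hη, h3⟩ := exists_clamp ha hab hb
  refine ⟨fun t => c (τ t), ⟨?_, fun t => hc.simple _ (h2 t)⟩, η, hη,
    fun t ht => by simp only [h3 t ht]⟩
  have := hc.smooth.comp_contDiff (f := fun p : ℝ × ℝ => (τ p.1, p.2))
    ((h1.comp contDiff_fst).prodMk contDiff_snd) (fun p => ⟨h2 _, mem_univ _⟩)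
  exact this

lemma deg_eq {s t : ℝ} (hs : s ∈ Ioo 0 S) (ht : t ∈ Ioo 0 S) : deg (c s) = deg (c t) := by
  wlog hst : s ≤ t generalizing s t
  · exact (this ht hs (le_of_not_ge hst)).symm
  obtain ⟨c', hc', η, hη, h⟩ := hc.exists_family hs.1 hst ht.2
  rw [← h s ⟨by linarith, by linarith⟩, ← h t ⟨by linarith, by linarith⟩]
  exact hc'.deg_eq s t

lemma continuousAt_uncurry {t : ℝ} (ht : t ∈ Ioo 0 S) (x : ℝ) :
    ContinuousAt (fun p : ℝ × ℝ => c p.1 p.2) (t, x) :=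
  hc.smooth.continuousOn.continuousAt
    ((isOpen_Ioo.prod isOpen_univ).mem_nhds ⟨ht, mem_univ _⟩)

lemma continuousAt_chi {t : ℝ} (ht : t ∈ Ioo 0 S) {z : ℂ} (hz : z ∉ range (c t)) :
    ContinuousAt (fun p : ℝ × ℂ => chi (c p.1) p.2) (t, z) := by
  obtain ⟨c', hc', η, hη, h⟩ := hc.exists_family ht.1 le_rfl ht.2
  have h1 : ContinuousAt (fun p : ℝ × ℂ => pot (c' p.1) 0 p.2 / deg (c t)) (t, z) := by
    refine ContinuousAt.div_const (PlaneCurve.continuousAt_pot hc'.continuous hc'.continuous_deriv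
      (p := (t, z)) ?_) _
    rw [h t ⟨by linarith, by linarith⟩]; exact hz
  refine h1.congr ?_
  have h2 : ∀ᶠ s in 𝓝 t, s ∈ Ioo (t - η) (t + η) ∧ s ∈ Ioo 0 S :=
    inter_mem (Ioo_mem_nhds (by linarith) (by linarith)) (Ioo_mem_nhds ht.1 ht.2)
  filter_upwards [(continuous_fst (X := ℝ) (Y := ℂ)).tendsto (t, z) |>.eventually h2] with p hp
  rw [chi, h p.1 hp.1, hc.deg_eq hp.2 ht]

lemma chi_const {V : Set (ℝ × ℂ)} (hV : IsPreconnected V) (hV' : ∀ p ∈ V, p.1 ∈ Ioo 0 S)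
    (hoff : ∀ p ∈ V, p.2 ∉ range (c p.1)) {p q : ℝ × ℂ} (hp : p ∈ V) (hq : q ∈ V) :
    chi (c p.1) p.2 = chi (c q.1) q.2 :=
  eq_of_continuousOn_of_int hV (f := fun p : ℝ × ℂ => chi (c p.1) p.2)
    (fun r hr => (hc.continuousAt_chi (hV' r hr) (hoff r hr)).continuousWithinAt)
    (fun r hr => by
      rcases (hc.simple _ (hV' r hr)).chi_eq_or (hoff r hr) with h | h
      · exact ⟨0, by simp [h]⟩
      · exact ⟨1, by simp [h]⟩) hp hq

omit hc in
lemma flux_congr {c' : ℝ → ℝ → ℂ} {t : ℝ} (h : ∀ᶠ s in 𝓝 t, c' s = c s) (x : ℝ) :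
    flux c' t x = flux c t x := by
  have h1 : vel c' t x = vel c t x :=
    Filter.EventuallyEq.deriv_eq (h.mono fun s hs => by simp only [hs])
  simp only [flux, h1, h.self_of_nhds]

lemma integral_chi_le (hd : IsFlow d S) {A B C a b : ℝ} (ha : 0 < a) (hab : a ≤ b) (hb : b < S)
    (h2 : ∀ t ∈ Icc a b, ∃ P Q, P ≠ Q ∧ range (c t) ∩ range (d t) = {P, Q})
    (hA : 0 ≤ A) (hB : 0 ≤ B) (hC : 0 ≤ A + B + C) :
    ∫ z, (A * chi (c b) z + B * chi (d b) z + C * (chi (c b) z * chi (d b) z)) ≤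
      ∫ z, (A * chi (c a) z + B * chi (d a) z + C * (chi (c a) z * chi (d a) z)) := by
  have hIcc : ∀ t ∈ Icc a b, t ∈ Ioo 0 S := fun t ht => ⟨ha.trans_le ht.1, ht.2.trans_lt hb⟩
  have haS := hIcc a (left_mem_Icc.2 hab)
  obtain ⟨c', hc', η, hη, hcc⟩ := hc.exists_family ha hab hb
  obtain ⟨d', hd', η', hη', hdd⟩ := hd.exists_family ha hab hb
  have hcc' : ∀ t ∈ Icc a b, c' t = c t := fun t ht =>
    hcc t ⟨by linarith [ht.1], by linarith [ht.2]⟩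
  have hdd' : ∀ t ∈ Icc a b, d' t = d t := fun t ht =>
    hdd t ⟨by linarith [ht.1], by linarith [ht.2]⟩
  set p := deg (c a) with hp
  set q := deg (d a) with hq
  have hp0 : p ≠ 0 := (hc.simple a haS).deg_ne_zero
  have hq0 : q ≠ 0 := (hd.simple a haS).deg_ne_zero
  have key := hc'.integral_pot_le hd' (α := A / p) (β := B / q) (γ := C / (p * q)) hab
    (fun t ht x => by
      rw [flux_congr (Filter.eventually_of_mem (Ioo_mem_nhds (by linarith [ht.1])
        (by linarith [ht.2])) hcc), hcc' t ht]
      exact hc.flow t (hIcc t ht) x)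
    (fun t ht x => by
      rw [flux_congr (Filter.eventually_of_mem (Ioo_mem_nhds (by linarith [ht.1])
        (by linarith [ht.2])) hdd), hdd' t ht]
      exact hd.flow t (hIcc t ht) x)
    (fun t ht => by rw [hcc' t ht, hdd' t ht]; exact h2 t ht)
    (fun t ht z hz hz' => by
      rw [hcc' t ht] at hz ⊢
      rw [hdd' t ht] at hz' ⊢
      have hpt : deg (c t) = p := hc.deg_eq (hIcc t ht) haS
      have hqt : deg (d t) = q := hd.deg_eq (hIcc t ht) haS
      rcases (hc.simple t (hIcc t ht)).pot_eq_or hz with h | h <;>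
        rcases (hd.simple t (hIcc t ht)).pot_eq_or hz' with h' | h' <;>
        rw [h, h'] <;> simp only [hpt, hqt, mul_zero, zero_mul, add_zero, zero_add, le_refl,
          div_mul_cancel₀ _ hp0, div_mul_cancel₀ _ hq0, div_mul_cancel₀ _ (mul_ne_zero hp0 hq0),
          hA, hB, hC])
  have conv : ∀ t ∈ Icc a b,
      ∫ z, (A * chi (c t) z + B * chi (d t) z + C * (chi (c t) z * chi (d t) z)) =
      A / p * (∫ z, pot (c' t) 0 z) + B / q * (∫ z, pot (d' t) 0 z) +
        C / (p * q) * ∫ z, pot (d' t) 0 z * pot (c' t) 0 z := by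
    intro t ht
    have sc := hc.simple t (hIcc t ht)
    have sd := hd.simple t (hIcc t ht)
    have hpt : deg (c t) = p := hc.deg_eq (hIcc t ht) haS
    have hqt : deg (d t) = q := hd.deg_eq (hIcc t ht) haS
    have i1 : Integrable fun z => A * chi (c t) z := sc.integrable_chi.const_mul _
    have i2 : Integrable fun z => B * chi (d t) z := sd.integrable_chi.const_mul _
    have i3 : Integrable fun z => C * (chi (c t) z * chi (d t) z) :=
      (sc.integrable_chi_mul sd).const_mul _
    have i12 : Integrable fun z => A * chi (c t) z + B * chi (d t) z := i1.add i2
    rw [integral_add i12 i3, integral_add i1 i2, hcc' t ht, hdd' t ht, ← integral_const_mul,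
      ← integral_const_mul, ← integral_const_mul]
    simp only [chi, hpt, hqt]
    congr 2
    · congr 1; ext z; ring
    · congr 1; ext z; ring
    · ext z; field_simp
  rw [conv b (right_mem_Icc.2 hab), conv a (left_mem_Icc.2 hab)]
  exact key

end IsFlow

lemma combo_nonneg {A B C u v : ℝ} (hA : 0 ≤ A) (hB : 0 ≤ B) (hC : 0 ≤ A + B + C)
    (hu : 0 ≤ u) (hu' : u ≤ 1) (hv : 0 ≤ v) (hv' : v ≤ 1) : 0 ≤ A * u + B * v + C * (u * v) := by
  have h1 := mul_nonneg hA (mul_nonneg hu (sub_nonneg.2 hv'))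
  have h2 := mul_nonneg hB (mul_nonneg hv (sub_nonneg.2 hu'))
  have h3 := mul_nonneg hC (mul_nonneg hu hv)
  linarith

namespace IsSimpleClosed
variable {c d : ℝ → ℂ} (hc : IsSimpleClosed c)
include hc

lemma exists_chi_eq (x : ℝ) {U : Set ℂ} (hU : U ∈ 𝓝 (c x)) {κ : ℝ} (hκ : κ = 0 ∨ κ = 1) :
    ∃ z ∈ U, z ∉ range c ∧ chi c z = κ := by
  classical
  by_contra! hno
  have hval : ∀ z ∈ U, z ∉ range c → pot c 0 z = (1 - κ) * deg c := by
    intro z hz hzc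
    have h1 := hno z hz hzc
    have h2 := hc.chi_eq_or hzc
    have h3 : chi c z = 1 - κ := by
      rcases hκ with rfl | rfl <;> rcases h2 with h | h <;> simp_all
    rw [← h3, chi, div_mul_cancel₀ _ hc.deg_ne_zero]
  let g : ℂ → ℝ := fun z => if z ∈ range c then (1 - κ) * deg c else pot c 0 z
  have hg : g =ᵐ[volume] pot c 0 := by
    have : ∀ᵐ z : ℂ, z ∉ range c := measure_eq_zero_iff_ae_notMem.1 hc.volume_range
    filter_upwards [this] with z hz
    simp only [g, if_neg hz]
  have hgU : ∀ z ∈ U, g z = (1 - κ) * deg c := by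
    intro z hz
    by_cases h : z ∈ range c
    · simp only [g, if_pos h]
    · simp only [g, if_neg h, hval z hz h]
  have hgc : ContinuousAt g (c x) := by
    refine (continuousAt_const (y := (1 - κ) * deg c)).congr ?_
    filter_upwards [hU] with z hz using (hgU z hz).symm
  have h1 := tendsto_integral_rho (hc.integrable_pot.congr hg.symm) hgc
  have h2 := hc.tendsto_pot (c x)
  rw [hc.pot_curve] at h2
  have h3 := tendsto_nhds_unique (h2.congr' (?_ : _ =ᶠ[_] fun ε => ∫ z, rho ε (z - c x) • g z)) h1
  · rw [hgU _ (mem_of_mem_nhds hU)] at h3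
    have := hc.deg_ne_zero
    rcases hκ with rfl | rfl
    · apply this; linarith
    · apply this; linarith
  · filter_upwards [self_mem_nhdsWithin] with ε hε
    rw [hc.pot_eq_integral hε]
    refine integral_congr_ae ?_
    filter_upwards [hg] with z hz
    rw [hz, smul_eq_mul, mul_comm]

end IsSimpleClosed

namespace IsFlow
variable {c d : ℝ → ℝ → ℂ} {S : ℝ} (hc : IsFlow c S) (hd : IsFlow d S)
include hc

lemma combo_eq_zero (hd : IsFlow d S) {A B C t₀ T R : ℝ} (h0 : 0 ≤ t₀) (hT : T ≤ S)
    (h2 : ∀ t ∈ Ioo t₀ T, ∃ P Q, P ≠ Q ∧ range (c t) ∩ range (d t) = {P, Q})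
    (hA : 0 ≤ A) (hB : 0 ≤ B) (hC : 0 ≤ A + B + C)
    (hR : ∀ᶠ t in 𝓝[>] t₀, ∀ x, ‖c t x‖ < R ∧ ‖d t x‖ < R)
    (hlim : ∀ᵐ z, ∀ᶠ t in 𝓝[>] t₀,
      A * chi (c t) z + B * chi (d t) z + C * (chi (c t) z * chi (d t) z) = 0)
    {t : ℝ} (ht : t ∈ Ioo t₀ T) {z : ℂ} (hz : z ∉ range (c t)) (hz' : z ∉ range (d t)) :
    A * chi (c t) z + B * chi (d t) z + C * (chi (c t) z * chi (d t) z) = 0 := by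
  set F : ℝ → ℂ → ℝ := fun t z =>
    A * chi (c t) z + B * chi (d t) z + C * (chi (c t) z * chi (d t) z) with hF
  have hI : ∀ s ∈ Ioo t₀ T, s ∈ Ioo 0 S := fun s hs => ⟨h0.trans_lt hs.1, hs.2.trans_le hT⟩
  have hnhds : ∀ᶠ s in 𝓝[>] t₀, s ∈ Ioo t₀ t := Ioo_mem_nhdsGT ht.1
  have hInt : ∀ s ∈ Ioo t₀ T, Integrable (F s) := fun s hs => by
    have sc := hc.simple s (hI s hs)
    have sd := hd.simple s (hI s hs)
    exact ((sc.integrable_chi.const_mul _).add (sd.integrable_chi.const_mul _)).add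
      ((sc.integrable_chi_mul sd).const_mul _)
  have hnn : ∀ s ∈ Ioo t₀ T, ∀ z, 0 ≤ F s z := fun s hs z => by
    have sc := hc.simple s (hI s hs)
    have sd := hd.simple s (hI s hs)
    exact combo_nonneg hA hB hC (sc.chi_nonneg z) (sc.chi_le_one z)
      (sd.chi_nonneg z) (sd.chi_le_one z)
  have htend : Tendsto (fun s => ∫ z, F s z) (𝓝[>] t₀) (𝓝 (∫ _ : ℂ, (0 : ℝ))) := by
    refine tendsto_integral_filter_of_dominated_convergence
      ((closedBall (0 : ℂ) R).indicator fun _ => A + B + |C|) ?_ ?_ ?_ ?_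
    · filter_upwards [hnhds] with s hs
      exact (hInt s ⟨hs.1, hs.2.trans ht.2⟩).aestronglyMeasurable
    · filter_upwards [hnhds, hR] with s hs hRs
      have hs' : s ∈ Ioo t₀ T := ⟨hs.1, hs.2.trans ht.2⟩
      have sc := hc.simple s (hI s hs')
      have sd := hd.simple s (hI s hs')
      refine Eventually.of_forall fun z => ?_
      by_cases hzR : z ∈ closedBall (0 : ℂ) R
      · rw [indicator_of_mem hzR, Real.norm_eq_abs, abs_of_nonneg (hnn s hs' z)]
        have e1 := sc.chi_nonneg z
        have e2 := sc.chi_le_one z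
        have e3 := sd.chi_nonneg z
        have e4 := sd.chi_le_one z
        have e5 : C * (chi (c s) z * chi (d s) z) ≤ |C| * 1 :=
          mul_le_mul (le_abs_self C) (mul_le_one₀ e2 e3 e4) (mul_nonneg e1 e3) (abs_nonneg _)
        simp only [hF]
        nlinarith
      · rw [indicator_of_notMem hzR]
        rw [mem_closedBall, dist_zero_right, not_le] at hzR
        simp only [hF, sc.chi_eq_zero (fun x => (hRs x).1) hzR.le,
          sd.chi_eq_zero (fun x => (hRs x).2) hzR.le]
        simp
    · exact (integrableOn_const (by
        exact (isCompact_closedBall (0:ℂ) R).measure_lt_top.ne)).integrable_indicator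
        isClosed_closedBall.measurableSet
    · filter_upwards [hlim] with z hz
      exact tendsto_const_nhds.congr' (hz.mono fun s hs => hs.symm)
  have hle : ∫ z, F t z ≤ 0 := by
    rw [integral_zero] at htend
    refine ge_of_tendsto htend ?_
    filter_upwards [hnhds] with s hs
    exact hc.integral_chi_le hd (h0.trans_lt hs.1) hs.2.le (ht.2.trans_le hT)
      (fun r hr => h2 r ⟨hs.1.trans_le hr.1, hr.2.trans_lt ht.2⟩) hA hB hC
  have hzero : F t =ᵐ[volume] 0 :=
    (integral_eq_zero_iff_of_nonneg (hnn t ht) (hInt t ht)).1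
      (le_antisymm hle (integral_nonneg (hnn t ht)))
  have hcont : ContinuousAt (F t) z := by
    have c1 := (hc.simple t (hI t ht)).continuousAt_chi hz
    have c2 := (hd.simple t (hI t ht)).continuousAt_chi hz'
    exact ((c1.const_mul _).add (c2.const_mul _)).add ((c1.mul c2).const_mul _)
  by_contra hne
  have hmem : {w | F t w ≠ 0} ∈ 𝓝 z := hcont.eventually_ne hne
  exact (Measure.measure_pos_of_mem_nhds volume hmem).ne' hzero

end IsFlow

lemma second_deriv_nonneg_of_isLocalMin {g g₁ : ℝ → ℝ} {g₂ x : ℝ} (h : IsLocalMin g x)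
    (h1 : ∀ᶠ y in 𝓝 x, HasDerivAt g (g₁ y) y) (h2 : HasDerivAt g₁ g₂ x) : 0 ≤ g₂ := by
  by_contra! hneg
  have e1 : deriv g =ᶠ[𝓝 x] g₁ := h1.mono fun y hy => hy.deriv
  have e2 : deriv (deriv g) x = g₂ := by rw [e1.deriv_eq, h2.deriv]
  have hmax := isLocalMax_of_deriv_deriv_neg (f := g) (x₀ := x) (by rw [e2]; exact hneg)
    h.deriv_eq_zero h1.self_of_nhds.continuousAt
  have hconst : g =ᶠ[𝓝 x] fun _ => g x := by
    filter_upwards [h, hmax] with y hy hy' using le_antisymm hy' hy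
  have e3 : deriv g =ᶠ[𝓝 x] fun _ => 0 := by
    filter_upwards [hconst.eventually_nhds] with y hy
    rw [Filter.EventuallyEq.deriv_eq hy, deriv_const]
  have : deriv (deriv g) x = 0 := by rw [e3.deriv_eq, deriv_const]
  linarith

lemma deriv_nonpos_of_left_min {h : ℝ → ℝ} {h' s τ : ℝ} (hs : s < τ)
    (hmin : ∀ t ∈ Icc s τ, h τ ≤ h t) (hd : HasDerivAt h h' τ) : h' ≤ 0 := by
  have h1 : Tendsto (slope h τ) (𝓝[<] τ) (𝓝 h') :=
    (hasDerivAt_iff_tendsto_slope.1 hd).mono_left (nhdsWithin_mono _ fun y hy => ne_of_lt hy)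
  refine le_of_tendsto h1 ?_
  filter_upwards [Ioo_mem_nhdsLT hs] with y hy
  rw [slope_def_field]
  exact div_nonpos_of_nonneg_of_nonpos (sub_nonneg.2 (hmin y ⟨hy.1.le, hy.2.le⟩))
    (by linarith [hy.2])

/-- Local data of a graph `ξ ↦ u t ξ` moving by curve shortening, near `(t₁, ξ₁)`. -/
structure IsGraphFlow (u u₁ u₂ uₜ : ℝ → ℝ → ℝ) (t₁ ξ₁ : ℝ) : Prop where
  cont : ∀ᶠ p : ℝ × ℝ in 𝓝 (t₁, ξ₁), ContinuousAt (fun p : ℝ × ℝ => u p.1 p.2) p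
  deriv₁ : ∀ᶠ p : ℝ × ℝ in 𝓝 (t₁, ξ₁), HasDerivAt (u p.1) (u₁ p.1 p.2) p.2
  deriv₂ : ∀ᶠ p : ℝ × ℝ in 𝓝 (t₁, ξ₁), HasDerivAt (u₁ p.1) (u₂ p.1 p.2) p.2
  derivₜ : ∀ᶠ p : ℝ × ℝ in 𝓝 (t₁, ξ₁), HasDerivAt (fun s => u s p.2) (uₜ p.1 p.2) p.1
  cont₁ : ContinuousAt (fun p : ℝ × ℝ => u₁ p.1 p.2) (t₁, ξ₁)
  cont₂ : ContinuousAt (fun p : ℝ × ℝ => u₂ p.1 p.2) (t₁, ξ₁)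
  eqn : ∀ᶠ p : ℝ × ℝ in 𝓝 (t₁, ξ₁), uₜ p.1 p.2 = u₂ p.1 p.2 / (1 + u₁ p.1 p.2 ^ 2)

/-- The comparison inequality behind the strong maximum principle. -/
lemma graph_ineq {M a₁ b₁ a₂ b₂ f₁ f₂ fₜ : ℝ} (ha : |a₁| ≤ M) (hb : |b₁| ≤ M)
    (hb2 : |b₂| ≤ M) (h1 : a₁ - b₁ = f₁) (h2 : f₂ ≤ a₂ - b₂)
    (ht : a₂ / (1 + a₁ ^ 2) - b₂ / (1 + b₁ ^ 2) ≤ fₜ) (hf1 : 0 ≤ f₁) (hf2 : 0 ≤ f₂) :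
    f₂ / (1 + M ^ 2) ≤ fₜ + 2 * M ^ 2 * f₁ := by
  have hM : 0 ≤ M := (abs_nonneg _).trans ha
  have p1 : 0 < 1 + a₁ ^ 2 := by positivity
  have p2 : 0 < 1 + b₁ ^ 2 := by positivity
  have e : a₂ / (1 + a₁ ^ 2) - b₂ / (1 + b₁ ^ 2) =
      (a₂ - b₂) / (1 + a₁ ^ 2) - b₂ * (a₁ + b₁) / ((1 + a₁ ^ 2) * (1 + b₁ ^ 2)) * f₁ := by
    rw [← h1]; field_simp; ring
  have e1 : f₂ / (1 + M ^ 2) ≤ (a₂ - b₂) / (1 + a₁ ^ 2) := by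
    have : a₁ ^ 2 ≤ M ^ 2 := sq_le_sq' (by linarith [abs_le.1 ha]) (abs_le.1 ha).2
    have h0 : 0 ≤ a₂ - b₂ := hf2.trans h2
    gcongr
  have e2 : b₂ * (a₁ + b₁) / ((1 + a₁ ^ 2) * (1 + b₁ ^ 2)) * f₁ ≤ 2 * M ^ 2 * f₁ := by
    refine mul_le_mul_of_nonneg_right ?_ hf1
    rw [div_le_iff₀ (by positivity)]
    have q1 : |b₂ * (a₁ + b₁)| ≤ M * (M + M) := by
      rw [abs_mul]
      exact mul_le_mul hb2 ((abs_add_le _ _).trans (add_le_add ha hb)) (abs_nonneg _) hM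
    have q2 : 1 ≤ (1 + a₁ ^ 2) * (1 + b₁ ^ 2) := by
      nlinarith [sq_nonneg a₁, sq_nonneg b₁, mul_nonneg (sq_nonneg a₁) (sq_nonneg b₁)]
    have q3 : 2 * M ^ 2 * 1 ≤ 2 * M ^ 2 * ((1 + a₁ ^ 2) * (1 + b₁ ^ 2)) := by gcongr
    linarith [le_abs_self (b₂ * (a₁ + b₁))]
  linarith

lemma eventually_abs_le {f : ℝ × ℝ → ℝ} {p : ℝ × ℝ} (hf : ContinuousAt f p) :
    ∀ᶠ q in 𝓝 p, |f q| ≤ |f p| + 1 :=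
  (hf.abs.eventually_lt continuousAt_const (by linarith)).mono fun _ h => le_of_lt h

set_option maxHeartbeats 1000000 in
/-- Strong maximum principle for two graphs moving by curve shortening. -/
lemma graph_touch_false {u u₁ u₂ uₜ v v₁ v₂ vₜ : ℝ → ℝ → ℝ} {t₁ ξ₁ : ℝ}
    (hu : IsGraphFlow u u₁ u₂ uₜ t₁ ξ₁) (hv : IsGraphFlow v v₁ v₂ vₜ t₁ ξ₁)
    (hle : ∀ᶠ p : ℝ × ℝ in 𝓝 (t₁, ξ₁), v p.1 p.2 ≤ u p.1 p.2)
    (heq : u t₁ ξ₁ = v t₁ ξ₁) (hne : ∀ᶠ ξ in 𝓝[≠] ξ₁, u t₁ ξ ≠ v t₁ ξ) : False := by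
  obtain ⟨M, hM0, hM⟩ : ∃ M > 0, ∀ᶠ p : ℝ × ℝ in 𝓝 (t₁, ξ₁),
      |u₁ p.1 p.2| ≤ M ∧ |v₁ p.1 p.2| ≤ M ∧ |v₂ p.1 p.2| ≤ M := by
    refine ⟨|u₁ t₁ ξ₁| + 1 + (|v₁ t₁ ξ₁| + 1) + (|v₂ t₁ ξ₁| + 1), by positivity, ?_⟩
    filter_upwards [eventually_abs_le hu.cont₁, eventually_abs_le hv.cont₁,
      eventually_abs_le hv.cont₂] with p h1 h2 h3
    have := abs_nonneg (u₁ t₁ ξ₁)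
    have := abs_nonneg (v₁ t₁ ξ₁)
    have := abs_nonneg (v₂ t₁ ξ₁)
    refine ⟨?_, ?_, ?_⟩ <;> linarith
  obtain ⟨R, hR, hall⟩ := Metric.eventually_nhds_iff_ball.1 (hM.and (hle.and
    (((hu.cont.and hu.deriv₁).and (hu.deriv₂.and (hu.derivₜ.and hu.eqn))).and
    ((hv.cont.and hv.deriv₁).and (hv.deriv₂.and (hv.derivₜ.and hv.eqn))))))
  have hbox : ∀ t ξ, |t - t₁| < R → |ξ - ξ₁| < R → (t, ξ) ∈ ball (t₁, ξ₁) R := by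
    intro t ξ h1 h2
    rw [mem_ball, Prod.dist_eq, Real.dist_eq, Real.dist_eq]
    exact max_lt h1 h2
  obtain ⟨R', hR', hne'⟩ := Metric.eventually_nhds_iff_ball.1 (eventually_nhdsWithin_iff.1 hne)
  obtain ⟨r, hr, hrR, hrR'⟩ : ∃ r > 0, r < R ∧ r < R' :=
    ⟨min R R' / 2, by positivity, by linarith [min_le_left R R', lt_min hR hR'],
      by linarith [min_le_right R R', lt_min hR hR']⟩
  let w : ℝ × ℝ → ℝ := fun p => u p.1 p.2 - v p.1 p.2
  have hwc : ∀ p ∈ ball (t₁, ξ₁) R, ContinuousAt w p := fun p hp =>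
    (hall p hp).2.2.1.1.1.sub (hall p hp).2.2.2.1.1
  have hw0 : ∀ p ∈ ball (t₁, ξ₁) R, 0 ≤ w p := fun p hp => sub_nonneg.2 (hall p hp).2.1
  have hwpos : ∀ ξ, ξ ≠ ξ₁ → |ξ - ξ₁| < R → |ξ - ξ₁| < R' → 0 < w (t₁, ξ) := by
    intro ξ h0 h1 h2
    refine lt_of_le_of_ne (hw0 _ (hbox _ _ (by simpa using hR) h1)) (Ne.symm ?_)
    exact sub_ne_zero.2 (hne' ξ (by rwa [mem_ball, Real.dist_eq]) h0)
  have habs : |ξ₁ + r - ξ₁| = r ∧ |ξ₁ - r - ξ₁| = r := by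
    constructor
    · rw [add_sub_cancel_left, abs_of_pos hr]
    · rw [sub_sub_cancel_left, abs_neg, abs_of_pos hr]
  have hp1 := hwpos (ξ₁ + r) (by linarith) (by rw [habs.1]; exact hrR) (by rw [habs.1]; exact hrR')
  have hp2 := hwpos (ξ₁ - r) (by linarith) (by rw [habs.2]; exact hrR) (by rw [habs.2]; exact hrR')
  obtain ⟨δ, hδ, hδ1, hδ2⟩ : ∃ δ > 0, δ < w (t₁, ξ₁ + r) ∧ δ < w (t₁, ξ₁ - r) :=
    ⟨min (w (t₁, ξ₁ + r)) (w (t₁, ξ₁ - r)) / 2, by have := lt_min hp1 hp2; positivity,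
      by linarith [min_le_left (w (t₁, ξ₁ + r)) (w (t₁, ξ₁ - r)), lt_min hp1 hp2],
      by linarith [min_le_right (w (t₁, ξ₁ + r)) (w (t₁, ξ₁ - r)), lt_min hp1 hp2]⟩
  have ev : ∀ ξ, |ξ - ξ₁| < R → δ < w (t₁, ξ) → ∀ᶠ t in 𝓝 t₁, δ < w (t, ξ) := by
    intro ξ hξ h
    have := (hwc (t₁, ξ) (hbox _ _ (by simpa using hR) hξ)).comp (f := fun t => (t, ξ)) (x := t₁)
      (by fun_prop)
    exact this.eventually_const_lt h
  obtain ⟨R'', hR'', hside⟩ := Metric.eventually_nhds_iff_ball.1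
    ((ev _ (by rw [habs.1]; exact hrR) hδ1).and (ev _ (by rw [habs.2]; exact hrR) hδ2))
  obtain ⟨s, hs, hsR, hsR''⟩ : ∃ s > 0, s < R ∧ s < R'' :=
    ⟨min R R'' / 2, by positivity, by linarith [min_le_left R R'', lt_min hR hR''],
      by linarith [min_le_right R R'', lt_min hR hR'']⟩
  set k := 2 * r / s with hk
  have hk0 : 0 < k := by positivity
  set l := (k + 2 * M ^ 2 + 1) * (1 + M ^ 2) with hl
  have hl0 : 0 < l := by positivity
  set δ' := δ / exp (l * (k * s)) with hδ'
  have hδ'0 : 0 < δ' := by positivity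
  let E : ℝ × ℝ → ℝ := fun p => exp (l * (p.2 - ξ₁ - r + k * (p.1 - (t₁ - s))))
  let g : ℝ × ℝ → ℝ := fun p => w p - δ' * (E p - 1)
  have hE : Continuous E := by fun_prop
  set K := Icc (t₁ - s) t₁ ×ˢ Icc (ξ₁ - r) (ξ₁ + r) with hK
  have hKball : ∀ p ∈ K, p ∈ ball (t₁, ξ₁) R := by
    rintro ⟨t, ξ⟩ ⟨⟨h1, h2⟩, h3, h4⟩
    refine hbox t ξ ?_ ?_ <;> rw [abs_lt] <;> constructor <;> simp only at h1 h2 h3 h4 <;> linarith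
  have hgc : ContinuousOn g K := fun p hp =>
    ((hwc p (hKball p hp)).sub (by fun_prop)).continuousWithinAt
  have hK1 : (t₁, ξ₁) ∈ K :=
    ⟨⟨by simp only; linarith, le_rfl⟩, ⟨by simp only; linarith, by simp only; linarith⟩⟩
  obtain ⟨⟨τ, σ⟩, hmem, hmin⟩ := (isCompact_Icc.prod isCompact_Icc).exists_isMinOn ⟨_, hK1⟩ hgc
  have hg1 : g (t₁, ξ₁) < 0 := by
    have e1 : w (t₁, ξ₁) = 0 := sub_eq_zero.2 heq
    have e2 : 1 < E (t₁, ξ₁) := by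
      refine Real.one_lt_exp_iff.2 ?_
      have : k * (t₁ - (t₁ - s)) = 2 * r := by rw [hk]; field_simp; ring
      rw [this]
      have : 0 < l * r := by positivity
      simp only; nlinarith
    simp only [g, e1]
    nlinarith
  have hneg : g (τ, σ) < 0 := (hmin hK1).trans_lt hg1
  obtain ⟨⟨hτ1, hτ2⟩, hσ1, hσ2⟩ := hmem
  simp only at hτ1 hτ2 hσ1 hσ2
  have hEle : ∀ p ∈ K, δ' * (E p - 1) ≤ δ := by
    rintro ⟨t, ξ⟩ ⟨⟨h1, h2⟩, h3, h4⟩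
    simp only at h1 h2 h3 h4
    have e1 : E (t, ξ) ≤ exp (l * (k * s)) := by
      refine Real.exp_le_exp.2 ?_
      refine mul_le_mul_of_nonneg_left ?_ hl0.le
      have : k * (t - (t₁ - s)) ≤ k * s := mul_le_mul_of_nonneg_left (by linarith) hk0.le
      simp only; linarith
    calc δ' * (E (t, ξ) - 1) ≤ δ' * exp (l * (k * s)) := by
          refine mul_le_mul_of_nonneg_left (by linarith) hδ'0.le
      _ = δ := by rw [hδ']; field_simp
  have hτK : τ ∈ ball t₁ R'' := by
    rw [mem_ball, Real.dist_eq, abs_lt]; constructor <;> linarith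
  have hτ : t₁ - s < τ := by
    refine lt_of_le_of_ne hτ1 fun h => ?_
    have e1 := hw0 _ (hKball (τ, σ) ⟨⟨hτ1, hτ2⟩, hσ1, hσ2⟩)
    have e2 : E (τ, σ) ≤ 1 := by
      refine Real.exp_le_one_iff.2 ?_
      simp only [← h, sub_self, mul_zero, add_zero]
      exact mul_nonpos_of_nonneg_of_nonpos hl0.le (by linarith)
    simp only [g] at hneg
    nlinarith
  have hσr : σ < ξ₁ + r := by
    refine lt_of_le_of_ne hσ2 fun h => ?_
    have e1 := hEle (τ, σ) ⟨⟨hτ1, hτ2⟩, hσ1, hσ2⟩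
    have e2 := (hside τ hτK).1
    rw [← h] at e2
    simp only [g] at hneg
    linarith
  have hσl : ξ₁ - r < σ := by
    refine lt_of_le_of_ne hσ1 fun h => ?_
    have e1 := hEle (τ, σ) ⟨⟨hτ1, hτ2⟩, hσ1, hσ2⟩
    have e2 := (hside τ hτK).2
    rw [h] at e2
    simp only [g] at hneg
    linarith
  have hB := hKball (τ, σ) ⟨⟨hτ1, hτ2⟩, hσ1, hσ2⟩
  obtain ⟨⟨m1, m2, m3⟩, -, ⟨⟨-, au1⟩, au2, aut, aue⟩, ⟨-, av1⟩, av2, avt, ave⟩ := hall _ hB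
  simp only at m1 m2 m3 au1 au2 aut aue av1 av2 avt ave
  have dE1 : ∀ y, HasDerivAt (fun y => E (τ, y)) (E (τ, y) * l) y := fun y => by
    have h := (((((hasDerivAt_id y).sub_const ξ₁).sub_const r).add_const
      (k * (τ - (t₁ - s)))).const_mul l).exp
    convert! h using 1
    simp [E]
  have dEt : HasDerivAt (fun s' => E (s', σ)) (E (τ, σ) * (l * k)) τ := by
    have h := (((((hasDerivAt_id τ).sub_const (t₁ - s)).const_mul k).const_add
      (σ - ξ₁ - r)).const_mul l).exp
    convert! h using 1
    simp [E]
  have ht : uₜ τ σ - vₜ τ σ - δ' * (E (τ, σ) * (l * k)) ≤ 0 := by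
    refine deriv_nonpos_of_left_min (h := fun s' => g (s', σ)) hτ (fun t ht' => ?_) ?_
    · exact hmin (show (t, σ) ∈ K from ⟨⟨ht'.1, ht'.2.trans hτ2⟩, hσ1, hσ2⟩)
    · exact (aut.sub avt).sub ((dEt.sub_const 1).const_mul δ')
  have hloc : IsLocalMin (fun y => g (τ, y)) σ := by
    filter_upwards [Icc_mem_nhds hσl hσr] with y hy
    exact hmin (show (τ, y) ∈ K from ⟨⟨hτ1, hτ2⟩, hy⟩)
  have d1 : ∀ᶠ y in 𝓝 σ,
      HasDerivAt (fun y => g (τ, y)) (u₁ τ y - v₁ τ y - δ' * (E (τ, y) * l)) y := by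
    filter_upwards [Icc_mem_nhds hσl hσr] with y hy
    have hy' := hall _ (hKball (τ, y) ⟨⟨hτ1, hτ2⟩, hy⟩)
    exact (hy'.2.2.1.1.2.sub hy'.2.2.2.1.2).sub (((dE1 y).sub_const 1).const_mul δ')
  have d2 : HasDerivAt (fun y => u₁ τ y - v₁ τ y - δ' * (E (τ, y) * l))
      (u₂ τ σ - v₂ τ σ - δ' * (E (τ, σ) * l * l)) σ :=
    (au2.sub av2).sub (((dE1 σ).mul_const l).const_mul δ')
  have z1 : u₁ τ σ - v₁ τ σ - δ' * (E (τ, σ) * l) = 0 :=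
    hloc.hasDerivAt_eq_zero d1.self_of_nhds
  have z2 := second_deriv_nonneg_of_isLocalMin hloc d1 d2
  have hEpos : 0 < E (τ, σ) := Real.exp_pos _
  have hfin := graph_ineq (f₁ := δ' * (E (τ, σ) * l)) (f₂ := δ' * (E (τ, σ) * l * l))
    (fₜ := δ' * (E (τ, σ) * (l * k))) m1 m2 m3 (sub_eq_zero.1 z1) (sub_nonneg.1 z2)
    (by rw [← aue, ← ave]; linarith) (by positivity) (by positivity)
  have e3 : δ' * (E (τ, σ) * l * l) / (1 + M ^ 2) = δ' * (E (τ, σ) * l) * (k + 2 * M ^ 2 + 1) := by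
    have : (1 + M ^ 2) ≠ 0 := by positivity
    conv_lhs => rw [show δ' * (E (τ, σ) * l * l) = δ' * (E (τ, σ) * l) * l by ring]
    rw [mul_div_assoc]
    congr 1
    rw [hl]; field_simp
  rw [e3] at hfin
  have : 0 < δ' * (E (τ, σ) * l) := by positivity
  nlinarith

namespace IsFamily
variable {c d : ℝ → ℝ → ℂ} (hc : IsFamily c) (hd : IsFamily d)
include hc

lemma continuous_deriv_deriv : Continuous (fun p : ℝ × ℝ => deriv (deriv (c p.1)) p.2) := by
  have : (fun p : ℝ × ℝ => deriv (deriv (c p.1)) p.2) =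
      fun p => fderiv ℝ (fun p : ℝ × ℝ => deriv (c p.1) p.2) p (0, 1) :=
    funext fun p => (hasDerivAt_slice_right (F := fun p => deriv (c p.1) p.2)
      (hc.contDiff_deriv.differentiable (by norm_num) p)).deriv
  rw [this]
  exact ((hc.contDiff_deriv.fderiv_right (m := 1) (by norm_num)).clm_apply
    contDiff_const).continuous

lemma hasDerivAt_comp {X : ℝ → ℝ} {X' t : ℝ} (hX : HasDerivAt X X' t) :
    HasDerivAt (fun s => c s (X s)) (vel c t (X t) + X' * deriv (c t) (X t)) t := by
  have h := ((hc.smooth.differentiable (by norm_num) (t, X t)).hasFDerivAt).comp_hasDerivAt t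
    ((hasDerivAt_id t).prodMk hX)
  convert! h using 1
  rw [hc.vel_eq, hc.deriv_eq, ← Complex.real_smul, ← map_smul, ← map_add]
  congr 1
  ext <;> simp

lemma exists_inverse {t₁ x₁ : ℝ} (hre : (deriv (c t₁) x₁).re ≠ 0) :
    ∃ X : ℝ → ℝ → ℝ, ContDiffAt ℝ 3 (fun p : ℝ × ℝ => X p.1 p.2) (t₁, (c t₁ x₁).re) ∧
      X t₁ (c t₁ x₁).re = x₁ ∧
      (∀ᶠ p : ℝ × ℝ in 𝓝 (t₁, (c t₁ x₁).re), (c p.1 (X p.1 p.2)).re = p.2) ∧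
      ∀ᶠ q : ℝ × ℝ in 𝓝 (t₁, x₁), X q.1 (c q.1 q.2).re = q.2 := by
  let F : ℝ × ℝ → ℝ × ℝ := fun p => (p.1, (c p.1 p.2).re)
  have hF : ContDiff ℝ 3 F := contDiff_fst.prodMk (Complex.reCLM.contDiff.comp hc.smooth)
  let A : ℝ × ℝ →L[ℝ] ℝ × ℝ := fderiv ℝ F (t₁, x₁)
  have hA : HasFDerivAt F A (t₁, x₁) := (hF.differentiable (by norm_num) _).hasFDerivAt
  have hA' : ∀ q, A q = (q.1, q.1 * (vel c t₁ x₁).re + q.2 * (deriv (c t₁) x₁).re) := by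
    intro q
    have h1 : HasFDerivAt F ((ContinuousLinearMap.fst ℝ ℝ ℝ).prod
      (Complex.reCLM.comp (fderiv ℝ (fun p : ℝ × ℝ => c p.1 p.2) (t₁, x₁)))) (t₁, x₁) :=
      hasFDerivAt_fst.prodMk (Complex.reCLM.hasFDerivAt.comp _
        (hc.smooth.differentiable (by norm_num) _).hasFDerivAt)
    rw [hA.unique h1, hc.vel_eq, hc.deriv_eq]
    have : ∀ L : ℝ × ℝ →L[ℝ] ℂ, L q = q.1 • L (1, 0) + q.2 • L (0, 1) := fun L => by
      rw [← map_smul, ← map_smul, ← map_add]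
      congr 1
      ext <;> simp
    simp [this (fderiv ℝ (fun p : ℝ × ℝ => c p.1 p.2) (t₁, x₁))]
  have hinj : Function.Injective (A : ℝ × ℝ →ₗ[ℝ] ℝ × ℝ) := by
    rw [injective_iff_map_eq_zero]
    intro q hq
    have h1 : A q = 0 := hq
    rw [hA', Prod.mk_eq_zero] at h1
    obtain ⟨h1, h2⟩ := h1
    rw [h1, zero_mul, zero_add, mul_eq_zero] at h2
    exact Prod.ext h1 (h2.resolve_right hre)
  let A' : (ℝ × ℝ) ≃L[ℝ] (ℝ × ℝ) := (LinearEquiv.ofInjectiveEndo _ hinj).toContinuousLinearEquiv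
  have hA'' : HasFDerivAt F (A' : ℝ × ℝ →L[ℝ] ℝ × ℝ) (t₁, x₁) := by
    convert! hA using 1
  have hn : (3 : WithTop ℕ∞) ≠ 0 := by norm_num
  have hs := (hF.contDiffAt (x := (t₁, x₁))).hasStrictFDerivAt' hA'' hn
  have hG := (hF.contDiffAt (x := (t₁, x₁))).to_localInverse hA'' hn
  set G := (hF.contDiffAt (x := (t₁, x₁))).localInverse hA'' hn with hGdef
  have hG1 : G (F (t₁, x₁)) = (t₁, x₁) :=
    (hF.contDiffAt (x := (t₁, x₁))).localInverse_apply_image hA'' hn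
  have hr : ∀ᶠ p in 𝓝 (F (t₁, x₁)), F (G p) = p := hs.eventually_right_inverse
  have hl : ∀ᶠ q in 𝓝 (t₁, x₁), G (F q) = q := hs.eventually_left_inverse
  refine ⟨fun t ξ => (G (t, ξ)).2, contDiff_snd.contDiffAt.comp _ hG, ?_, ?_, ?_⟩
  · exact congrArg Prod.snd hG1
  · filter_upwards [hr] with p hp
    have h1 := congrArg Prod.fst hp
    have h2 := congrArg Prod.snd hp
    simp only [F] at h1 h2
    rw [h1] at h2
    exact h2
  · filter_upwards [hl] with q hq
    exact congrArg Prod.snd hq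

lemma exists_graph {t₁ x₁ : ℝ} (hre : (deriv (c t₁) x₁).re ≠ 0)
    (hfc : ∀ᶠ t in 𝓝 t₁, ∀ x, flux c t x = -(deriv (deriv (c t)) x / deriv (c t) x).im) :
    ∃ u u₁ u₂ uₜ : ℝ → ℝ → ℝ, IsGraphFlow u u₁ u₂ uₜ t₁ (c t₁ x₁).re ∧
      ∀ᶠ p : ℝ × ℂ in 𝓝 (t₁, c t₁ x₁), p.2 ∈ range (c p.1) ↔ p.2.im = u p.1 p.2.re := by
  obtain ⟨X, hX, hX1, hr, hl⟩ := hc.exists_inverse hre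
  have hXd : ∀ᶠ p : ℝ × ℝ in 𝓝 (t₁, (c t₁ x₁).re), ContDiffAt ℝ 3 (fun p : ℝ × ℝ => X p.1 p.2) p :=
    hX.eventually (by norm_num)
  have hgood : ∀ᶠ p : ℝ × ℝ in 𝓝 (t₁, (c t₁ x₁).re),
      ContinuousAt (fun p : ℝ × ℝ => X p.1 p.2) p ∧ (deriv (c p.1) (X p.1 p.2)).re ≠ 0 ∧
      HasDerivAt (X p.1) (1 / (deriv (c p.1) (X p.1 p.2)).re) p.2 ∧
      HasDerivAt (fun s => X s p.2)
        (-(vel c p.1 (X p.1 p.2)).re / (deriv (c p.1) (X p.1 p.2)).re) p.1 := by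
    filter_upwards [hXd, hr.eventually_nhds] with ⟨t, ξ⟩ h1 h2
    have hd := h1.differentiableAt (by norm_num)
    have d1 : HasDerivAt (X t) (deriv (X t) ξ) ξ :=
      (DifferentiableAt.comp (g := fun p : ℝ × ℝ => X p.1 p.2) (f := fun y => (t, y)) ξ hd
        (by fun_prop)).hasDerivAt
    have d2 : HasDerivAt (fun s => X s ξ) (deriv (fun s => X s ξ) t) t :=
      (DifferentiableAt.comp (g := fun p : ℝ × ℝ => X p.1 p.2) (f := fun y => (y, ξ)) t hd
        (by fun_prop)).hasDerivAt
    have e1 : (deriv (c t) (X t ξ)).re * deriv (X t) ξ = 1 := by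
      have k1 : HasDerivAt (fun y => (c t (X t y)).re) (deriv (X t) ξ • deriv (c t) (X t ξ)).re ξ :=
        Complex.reCLM.hasFDerivAt.comp_hasDerivAt ξ (((hc.simple t).hasDerivAt (X t ξ)).scomp ξ d1)
      have k2 : (fun y => (c t (X t y)).re) =ᶠ[𝓝 ξ] fun y => y :=
        (by fun_prop : Continuous fun y : ℝ => (t, y)).continuousAt.eventually h2
      have k3 := (k1.congr_of_eventuallyEq k2.symm).unique (hasDerivAt_id ξ)
      rw [← k3]; simp; ring
    have hre' : (deriv (c t) (X t ξ)).re ≠ 0 := left_ne_zero_of_mul_eq_one e1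
    have e2 : (vel c t (X t ξ)).re + deriv (fun s => X s ξ) t * (deriv (c t) (X t ξ)).re = 0 := by
      have k1 := Complex.reCLM.hasFDerivAt.comp_hasDerivAt t (hc.hasDerivAt_comp d2)
      have k2 : (fun s => (c s (X s ξ)).re) =ᶠ[𝓝 t] fun _ => ξ :=
        (by fun_prop : Continuous fun y : ℝ => (y, ξ)).continuousAt.eventually h2
      have k3 := (k1.congr_of_eventuallyEq k2.symm).unique (hasDerivAt_const t ξ)
      simpa using k3
    refine ⟨h1.continuousAt, hre', ?_, ?_⟩
    · convert! d1 using 1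
      simp only; field_simp; linarith
    · convert! d2 using 1
      simp only; field_simp; linarith
  have hpt : ContinuousAt (fun p : ℝ × ℝ => (p.1, X p.1 p.2)) (t₁, (c t₁ x₁).re) :=
    continuousAt_fst.prodMk hX.continuousAt
  have hre0 : (deriv (c t₁) (X t₁ (c t₁ x₁).re)).re ≠ 0 := by rw [hX1]; exact hre
  have cx : ContinuousAt (fun p : ℝ × ℝ => deriv (c p.1) (X p.1 p.2)) (t₁, (c t₁ x₁).re) :=
    ContinuousAt.comp (g := fun p : ℝ × ℝ => deriv (c p.1) p.2) hc.continuous_deriv.continuousAt hpt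
  have cxx : ContinuousAt (fun p : ℝ × ℝ => deriv (deriv (c p.1)) (X p.1 p.2)) (t₁, (c t₁ x₁).re) :=
    ContinuousAt.comp (g := fun p : ℝ × ℝ => deriv (deriv (c p.1)) p.2)
      hc.continuous_deriv_deriv.continuousAt hpt
  have cre := Complex.continuous_re.continuousAt.comp cx
  have cim := Complex.continuous_im.continuousAt.comp cx
  refine ⟨fun t ξ => (c t (X t ξ)).im,
    fun t ξ => (deriv (c t) (X t ξ)).im / (deriv (c t) (X t ξ)).re,
    fun t ξ => (conj (deriv (c t) (X t ξ)) * deriv (deriv (c t)) (X t ξ)).im /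
      (deriv (c t) (X t ξ)).re ^ 3,
    fun t ξ => (conj (deriv (c t) (X t ξ)) * vel c t (X t ξ)).im / (deriv (c t) (X t ξ)).re,
    ⟨?_, ?_, ?_, ?_, ?_, ?_, ?_⟩, ?_⟩
  · filter_upwards [hgood] with p hp
    exact Complex.continuous_im.continuousAt.comp (ContinuousAt.comp
      (g := fun p : ℝ × ℝ => c p.1 p.2) hc.continuous.continuousAt (continuousAt_fst.prodMk hp.1))
  · filter_upwards [hgood] with ⟨t, ξ⟩ ⟨_, h1, h2, _⟩
    have k1 := Complex.imCLM.hasFDerivAt.comp_hasDerivAt ξ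
      (((hc.simple t).hasDerivAt (X t ξ)).scomp ξ h2)
    convert! k1 using 1
    simp; ring
  · filter_upwards [hgood] with ⟨t, ξ⟩ ⟨_, h1, h2, _⟩
    have k0 := ((hc.simple t).hasDerivAt_deriv (X t ξ)).scomp ξ h2
    have k1 := Complex.imCLM.hasFDerivAt.comp_hasDerivAt ξ k0
    have k2 := Complex.reCLM.hasFDerivAt.comp_hasDerivAt ξ k0
    convert! k1.div k2 h1 using 1
    simp only at h1 ⊢
    simp only [Complex.mul_im, Complex.conj_re, Complex.conj_im, Function.comp_apply,
      Complex.imCLM_apply, Complex.reCLM_apply, Complex.smul_re, Complex.smul_im, smul_eq_mul]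
    field_simp
    ring
  · filter_upwards [hgood] with ⟨t, ξ⟩ ⟨_, h1, _, h2⟩
    have k1 := Complex.imCLM.hasFDerivAt.comp_hasDerivAt t (hc.hasDerivAt_comp h2)
    convert! k1 using 1
    simp only at h1 ⊢
    simp [Complex.mul_im]
    field_simp
  · exact cim.div cre hre0
  · exact (Complex.continuous_im.continuousAt.comp
      ((Complex.continuous_conj.continuousAt.comp cx).mul cxx)).div (cre.pow 3)
      (pow_ne_zero _ hre0)
  · have hfc' : ∀ᶠ p : ℝ × ℝ in 𝓝 (t₁, (c t₁ x₁).re), ∀ x, flux c p.1 x =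
        -(deriv (deriv (c p.1)) x / deriv (c p.1) x).im :=
      (continuous_fst (X := ℝ) (Y := ℝ)).continuousAt.eventually
        (p := fun t => ∀ x, flux c t x = -(deriv (deriv (c t)) x / deriv (c t) x).im) hfc
    filter_upwards [hgood, hfc'] with ⟨t, ξ⟩ ⟨_, h1, _, _⟩ h2
    have h3 := h2 (X t ξ)
    simp only at h1 h3 ⊢
    simp only [flux, Complex.mul_im, Complex.conj_re, Complex.conj_im, Complex.div_im,
      Complex.normSq_apply] at h3 ⊢
    set a := (deriv (c t) (X t ξ)).re
    set b := (deriv (c t) (X t ξ)).im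
    have hab : a * a + b * b ≠ 0 := by rw [← sq, ← sq]; positivity
    have hab' : a ^ 2 + b ^ 2 ≠ 0 := by positivity
    have hab3 : 1 + (b / a) ^ 2 ≠ 0 := by positivity
    have h4 : a * (vel c t (X t ξ)).im + -b * (vel c t (X t ξ)).re =
        (a * (deriv (deriv (c t)) (X t ξ)).im + -b * (deriv (deriv (c t)) (X t ξ)).re) /
          (a ^ 2 + b ^ 2) := by
      rw [eq_div_iff hab']
      field_simp at h3
      linarith
    rw [h4]
    field_simp
  · have left : ∀ᶠ p : ℝ × ℂ in 𝓝 (t₁, c t₁ x₁), p.2.im = (c p.1 (X p.1 p.2.re)).im →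
        p.2 ∈ range (c p.1) := by
      have hmap : ContinuousAt (fun p : ℝ × ℂ => (p.1, p.2.re)) (t₁, c t₁ x₁) := by fun_prop
      filter_upwards [hmap.eventually hr] with p hp h
      exact ⟨X p.1 p.2.re, Complex.ext hp h.symm⟩
    obtain ⟨ρ, hρ, hl'⟩ := Metric.eventually_nhds_iff_ball.1 hl
    obtain ⟨ε, hε, hερ, hεπ⟩ : ∃ ε > 0, ε < ρ ∧ ε < π :=
      ⟨min ρ π / 2, by positivity, by linarith [min_le_left ρ π, lt_min hρ pi_pos],
        by linarith [min_le_right ρ π, lt_min hρ pi_pos]⟩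
    have hfar : c t₁ x₁ ∉ c t₁ '' Icc (x₁ + ε) (x₁ + 2 * π - ε) := by
      rintro ⟨y, hy, h⟩
      have := (hc.simple t₁).inj y x₁ (by rw [abs_lt]; constructor <;> linarith [hy.1, hy.2]) h
      linarith [hy.1]
    have hnot := eventually_notMem_image hc.continuous (p := (t₁, c t₁ x₁)) isCompact_Icc hfar
    have htime : ∀ᶠ p : ℝ × ℂ in 𝓝 (t₁, c t₁ x₁), |p.1 - t₁| < ρ :=
      (continuous_fst (X := ℝ) (Y := ℂ)).continuousAt.eventually
        (p := fun t => |t - t₁| < ρ) (Metric.ball_mem_nhds t₁ hρ)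
    filter_upwards [left, hnot, htime] with p h1 h2 h3
    refine ⟨?_, h1⟩
    rintro ⟨y, hy⟩
    obtain ⟨y', hy', hyy⟩ := (hc.simple p.1).per.exists_mem_Ico (by positivity) y (x₁ - ε)
    rw [hyy] at hy
    have hlt : y' < x₁ + ε := by
      by_contra! hge
      exact h2 ⟨y', ⟨hge, by linarith [hy'.2]⟩, hy⟩
    have hXy : X p.1 (c p.1 y').re = y' := hl' (p.1, y') (by
      rw [mem_ball, Prod.dist_eq, Real.dist_eq, Real.dist_eq]
      refine max_lt h3 (lt_of_le_of_lt ?_ hερ)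
      rw [abs_le]; constructor <;> simp only <;> linarith [hy'.1])
    rw [← hy]
    simp only [hXy]

end IsFamily

lemma continuous_complex_mk : Continuous fun q : ℝ × ℝ => (⟨q.1, q.2⟩ : ℂ) :=
  Complex.equivRealProdCLM.symm.continuous

namespace IsFlow
variable {c d : ℝ → ℝ → ℂ} {S : ℝ} (hc : IsFlow c S) (hd : IsFlow d S)
include hc

lemma exists_graph {t₁ x₁ : ℝ} (ht : t₁ ∈ Ioo 0 S) (hre : (deriv (c t₁) x₁).re ≠ 0) :
    ∃ u u₁ u₂ uₜ : ℝ → ℝ → ℝ, IsGraphFlow u u₁ u₂ uₜ t₁ (c t₁ x₁).re ∧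
      ∀ᶠ p : ℝ × ℂ in 𝓝 (t₁, c t₁ x₁), p.2 ∈ range (c p.1) ↔ p.2.im = u p.1 p.2.re := by
  obtain ⟨c', hc', η, hη, h⟩ := hc.exists_family ht.1 le_rfl ht.2
  have hη' : ∀ᶠ t in 𝓝 t₁, t ∈ Ioo (t₁ - η) (t₁ + η) ∧ t ∈ Ioo 0 S :=
    inter_mem (Ioo_mem_nhds (by linarith) (by linarith)) (Ioo_mem_nhds ht.1 ht.2)
  have h1 : c' t₁ = c t₁ := h t₁ ⟨by linarith, by linarith⟩
  obtain ⟨u, u₁, u₂, uₜ, hu, hiff⟩ :=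
    hc'.exists_graph (t₁ := t₁) (x₁ := x₁) (by rw [h1]; exact hre) (by
    filter_upwards [hη', hη'.eventually_nhds] with t ht1 ht2 x
    rw [flux_congr (ht2.mono fun s hs => h s hs.1), h t ht1.1]
    exact hc.flow t ht1.2 x)
  rw [h1] at hu hiff
  refine ⟨u, u₁, u₂, uₜ, hu, ?_⟩
  filter_upwards [hiff, (continuous_fst (X := ℝ) (Y := ℂ)).continuousAt.eventually
    (p := fun t => t ∈ Ioo (t₁ - η) (t₁ + η) ∧ t ∈ Ioo 0 S) hη'] with p hp hp'
  rw [← h p.1 hp'.1]; exact hp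

lemma exists_sides {t₁ x₁ : ℝ} (ht : t₁ ∈ Ioo 0 S) {u : ℝ → ℝ → ℝ}
    (hu : ∀ᶠ p : ℝ × ℝ in 𝓝 (t₁, (c t₁ x₁).re), ContinuousAt (fun p : ℝ × ℝ => u p.1 p.2) p)
    (hiff : ∀ᶠ p : ℝ × ℂ in 𝓝 (t₁, c t₁ x₁), p.2 ∈ range (c p.1) ↔ p.2.im = u p.1 p.2.re) :
    ∃ κ : ℝ, (κ = 0 ∨ κ = 1) ∧ ∀ᶠ q : ℝ × ℝ × ℝ in 𝓝 (t₁, (c t₁ x₁).re, (c t₁ x₁).im),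
      (u q.1 q.2.1 < q.2.2 → chi (c q.1) ⟨q.2.1, q.2.2⟩ = κ) ∧
      (q.2.2 < u q.1 q.2.1 → chi (c q.1) ⟨q.2.1, q.2.2⟩ = 1 - κ) := by
  set ξ₁ := (c t₁ x₁).re with hξ
  set η₁ := (c t₁ x₁).im with hη
  have hP : c t₁ x₁ = ⟨ξ₁, η₁⟩ := rfl
  have hu1 : η₁ = u t₁ ξ₁ := hiff.self_of_nhds.1 ⟨x₁, rfl⟩
  have hmk : Continuous fun q : ℝ × ℝ × ℝ => (q.1, (⟨q.2.1, q.2.2⟩ : ℂ)) :=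
    continuous_fst.prodMk (continuous_complex_mk.comp continuous_snd)
  have htime : ∀ᶠ q : ℝ × ℝ × ℝ in 𝓝 (t₁, ξ₁, η₁), q.1 ∈ Ioo 0 S :=
    continuous_fst.continuousAt.eventually (p := fun t => t ∈ Ioo 0 S) (Ioo_mem_nhds ht.1 ht.2)
  obtain ⟨r, hr, hball⟩ := Metric.eventually_nhds_iff_ball.1
    ((hmk.continuousAt (x := (t₁, ξ₁, η₁))).eventually hiff |>.and htime)
  have hclose : ∀ᶠ p : ℝ × ℝ in 𝓝 (t₁, ξ₁), |u p.1 p.2 - η₁| < r := by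
    have h1 : ContinuousAt (fun p : ℝ × ℝ => |u p.1 p.2 - η₁|) (t₁, ξ₁) :=
      (hu.self_of_nhds.sub continuousAt_const).abs
    refine h1.eventually_lt continuousAt_const ?_
    simp only [← hu1, sub_self, abs_zero, hr]
  obtain ⟨ρ', hρ', hbox'⟩ := Metric.eventually_nhds_iff_ball.1 (hu.and hclose)
  set ρ := min r ρ' with hρdef
  have hρ : 0 < ρ := lt_min hr hρ'
  have hbox : ∀ t ∈ Ioo (t₁ - ρ) (t₁ + ρ), ∀ ξ ∈ Ioo (ξ₁ - ρ) (ξ₁ + ρ),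
      ContinuousAt (fun p : ℝ × ℝ => u p.1 p.2) (t, ξ) ∧ |u t ξ - η₁| < r := by
    intro t h1 ξ h2
    refine hbox' (t, ξ) ?_
    rw [mem_ball, Prod.dist_eq, Real.dist_eq, Real.dist_eq]
    refine (max_lt ?_ ?_).trans_le (min_le_right r ρ') <;> rw [abs_lt]
    · constructor <;> linarith [h1.1, h1.2]
    · constructor <;> linarith [h2.1, h2.2]
  have hgood : ∀ t ∈ Ioo (t₁ - ρ) (t₁ + ρ), ∀ ξ ∈ Ioo (ξ₁ - ρ) (ξ₁ + ρ), ∀ y, |y - η₁| < r →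
      ((⟨ξ, y⟩ : ℂ) ∈ range (c t) ↔ y = u t ξ) ∧ t ∈ Ioo 0 S := by
    intro t h1 ξ h2 y h3
    refine hball (t, ξ, y) ?_
    rw [mem_ball, Prod.dist_eq, Prod.dist_eq, Real.dist_eq, Real.dist_eq, Real.dist_eq]
    refine max_lt (lt_of_lt_of_le ?_ (min_le_left r ρ')) (max_lt
      (lt_of_lt_of_le ?_ (min_le_left r ρ')) h3) <;> rw [abs_lt]
    · constructor <;> linarith [h1.1, h1.2]
    · constructor <;> linarith [h2.1, h2.2]
  have ht1 : t₁ ∈ Ioo (t₁ - ρ) (t₁ + ρ) := ⟨by linarith, by linarith⟩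
  have hξ1 : ξ₁ ∈ Ioo (ξ₁ - ρ) (ξ₁ + ρ) := ⟨by linarith, by linarith⟩
  have side : ∀ e, |e - η₁| = r → ∀ t ∈ Ioo (t₁ - ρ) (t₁ + ρ), ∀ ξ ∈ Ioo (ξ₁ - ρ) (ξ₁ + ρ),
      ∀ s ∈ Ioo (0 : ℝ) 1, chi (c t) ⟨ξ, u t ξ + s * (e - u t ξ)⟩ =
        chi (c t₁) ⟨ξ₁, η₁ + 1 / 2 * (e - η₁)⟩ := by
    intro e he t ht ξ hξ s hs
    set B := Ioo (t₁ - ρ) (t₁ + ρ) ×ˢ Ioo (ξ₁ - ρ) (ξ₁ + ρ) ×ˢ Ioo (0 : ℝ) 1 with hB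
    let φ : ℝ × ℝ × ℝ → ℝ × ℂ := fun q =>
      (q.1, ⟨q.2.1, u q.1 q.2.1 + q.2.2 * (e - u q.1 q.2.1)⟩)
    have hφ : ContinuousOn φ B := by
      rintro ⟨t, ξ, s⟩ ⟨h1, h2, h3⟩
      have hu' : ContinuousAt (fun q : ℝ × ℝ × ℝ => u q.1 q.2.1) (t, ξ, s) :=
        ContinuousAt.comp (g := fun p : ℝ × ℝ => u p.1 p.2) (f := fun q : ℝ × ℝ × ℝ => (q.1, q.2.1))
          (hbox t h1 ξ h2).1 (by fun_prop)
      have h4 : ContinuousAt (fun q : ℝ × ℝ × ℝ =>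
          (q.2.1, u q.1 q.2.1 + q.2.2 * (e - u q.1 q.2.1))) (t, ξ, s) :=
        ContinuousAt.prodMk (by fun_prop)
          (hu'.add (ContinuousAt.mul (by fun_prop) (continuousAt_const.sub hu')))
      exact (continuousAt_fst.prodMk
        (continuous_complex_mk.continuousAt.comp h4)).continuousWithinAt
    have hBc : IsPreconnected B :=
      isPreconnected_Ioo.prod (isPreconnected_Ioo.prod isPreconnected_Ioo)
    have hin : ∀ q ∈ B, |u q.1 q.2.1 + q.2.2 * (e - u q.1 q.2.1) - η₁| < r ∧
        u q.1 q.2.1 + q.2.2 * (e - u q.1 q.2.1) ≠ u q.1 q.2.1 := by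
      rintro ⟨t, ξ, s⟩ ⟨h1, h2, h3⟩
      have h4 := (hbox t h1 ξ h2).2
      simp only at h3 ⊢
      constructor
      · calc |u t ξ + s * (e - u t ξ) - η₁| = |(1 - s) * (u t ξ - η₁) + s * (e - η₁)| := by ring_nf
          _ ≤ (1 - s) * |u t ξ - η₁| + s * |e - η₁| := by
            refine (abs_add_le _ _).trans_eq ?_
            rw [abs_mul, abs_mul, abs_of_pos h3.1, abs_of_pos (sub_pos.2 h3.2)]
          _ < r := by rw [he]; nlinarith [h3.1, h3.2]
      · intro h5
        have h6 : e - u t ξ = 0 := by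
          have : s * (e - u t ξ) = 0 := by linarith
          exact (mul_eq_zero.1 this).resolve_left h3.1.ne'
        rw [sub_eq_zero] at h6
        rw [← h6, he] at h4
        exact lt_irrefl _ h4
    have key := hc.chi_const (hBc.image φ hφ) (by
        rintro _ ⟨q, hq, rfl⟩
        exact (hgood _ hq.1 _ hq.2.1 _ (hin q hq).1).2) (by
        rintro _ ⟨q, hq, rfl⟩
        rw [(hgood _ hq.1 _ hq.2.1 _ (hin q hq).1).1]
        exact (hin q hq).2) (p := φ (t, ξ, s)) (q := φ (t₁, ξ₁, 1 / 2))
      ⟨_, ⟨ht, hξ, hs⟩, rfl⟩ ⟨_, ⟨ht1, hξ1, by norm_num, by norm_num⟩, rfl⟩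
    simp only [φ] at key
    rw [key, ← hu1]
  set κ := chi (c t₁) ⟨ξ₁, η₁ + 1 / 2 * (η₁ + r - η₁)⟩ with hκ
  set κ' := chi (c t₁) ⟨ξ₁, η₁ + 1 / 2 * (η₁ - r - η₁)⟩ with hκ'
  have up : ∀ t ∈ Ioo (t₁ - ρ) (t₁ + ρ), ∀ ξ ∈ Ioo (ξ₁ - ρ) (ξ₁ + ρ), ∀ y, |y - η₁| < r →
      u t ξ < y → chi (c t) ⟨ξ, y⟩ = κ := by
    intro t ht ξ hξ y hy hlt
    have h4 := abs_lt.1 (hbox t ht ξ hξ).2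
    have h5 := abs_lt.1 hy
    have hpos : 0 < η₁ + r - u t ξ := by linarith
    have := side (η₁ + r) (by simp [abs_of_pos hr]) t ht ξ hξ ((y - u t ξ) / (η₁ + r - u t ξ))
      ⟨div_pos (by linarith) hpos, by rw [div_lt_one hpos]; linarith⟩
    rw [div_mul_cancel₀ _ hpos.ne', add_sub_cancel] at this
    exact this
  have down : ∀ t ∈ Ioo (t₁ - ρ) (t₁ + ρ), ∀ ξ ∈ Ioo (ξ₁ - ρ) (ξ₁ + ρ), ∀ y, |y - η₁| < r →
      y < u t ξ → chi (c t) ⟨ξ, y⟩ = κ' := by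
    intro t ht ξ hξ y hy hlt
    have h4 := abs_lt.1 (hbox t ht ξ hξ).2
    have h5 := abs_lt.1 hy
    have hpos : 0 < u t ξ - (η₁ - r) := by linarith
    have := side (η₁ - r) (by simp [abs_of_pos hr]) t ht ξ hξ ((u t ξ - y) / (u t ξ - (η₁ - r)))
      ⟨div_pos (by linarith) hpos, by rw [div_lt_one hpos]; linarith⟩
    rw [← neg_sub (u t ξ) (η₁ - r), mul_neg, div_mul_cancel₀ _ hpos.ne', neg_sub,
      add_sub_cancel] at this
    exact this
  have hκ01 : κ = 0 ∨ κ = 1 := by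
    refine (hc.simple t₁ ht).chi_eq_or ?_
    rw [(hgood t₁ ht1 ξ₁ hξ1 _ _).1, ← hu1]
    · linarith
    · rw [abs_lt]; constructor <;> linarith
  have hκκ : κ' = 1 - κ := by
    have hU : {z : ℂ | z.re ∈ Ioo (ξ₁ - ρ) (ξ₁ + ρ) ∧ |z.im - η₁| < r} ∈ 𝓝 (c t₁ x₁) := by
      have h1 : Continuous fun z : ℂ => |z.im - η₁| := by fun_prop
      refine inter_mem (Complex.continuous_re.continuousAt.preimage_mem_nhds
        (Ioo_mem_nhds hξ1.1 hξ1.2)) (h1.continuousAt.preimage_mem_nhds (Iio_mem_nhds ?_))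
      rw [← hη, sub_self, abs_zero]; exact hr
    obtain ⟨z, ⟨hz1, hz2⟩, hz3, hz4⟩ := (hc.simple t₁ ht).exists_chi_eq x₁ hU (κ := 1 - κ)
      (by rcases hκ01 with h | h <;> simp [h])
    have hz : z = ⟨z.re, z.im⟩ := rfl
    rw [hz, (hgood t₁ ht1 _ hz1 _ hz2).1] at hz3
    rcases lt_or_gt_of_ne hz3 with h | h
    · rw [← down t₁ ht1 _ hz1 _ hz2 h]; exact hz4
    · have h5 := up t₁ ht1 _ hz1 _ hz2 h
      rw [show (⟨z.re, z.im⟩ : ℂ) = z from rfl, hz4] at h5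
      rcases hκ01 with h6 | h6 <;> rw [h6] at h5 <;> norm_num at h5
  refine ⟨κ, hκ01, ?_⟩
  have hopen : Ioo (t₁ - ρ) (t₁ + ρ) ×ˢ Ioo (ξ₁ - ρ) (ξ₁ + ρ) ×ˢ Ioo (η₁ - r) (η₁ + r) ∈
      𝓝 (t₁, ξ₁, η₁) :=
    prod_mem_nhds (Ioo_mem_nhds ht1.1 ht1.2) (prod_mem_nhds (Ioo_mem_nhds hξ1.1 hξ1.2)
      (Ioo_mem_nhds (by linarith) (by linarith)))
  filter_upwards [hopen] with q hq
  have hy : |q.2.2 - η₁| < r := by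
    rw [abs_lt]; constructor <;> linarith [hq.2.2.1, hq.2.2.2]
  exact ⟨up _ hq.1 _ hq.2.1 _ hy, fun h => by rw [down _ hq.1 _ hq.2.1 _ hy h, hκκ]⟩

end IsFlow

section Rotation
variable {e : ℂ}

lemma kern_rotate (he : Complex.normSq e = 1) (c : ℝ → ℂ) (ε : ℝ) (z : ℂ) (x : ℝ) :
    kern (fun y => e * c y) ε (e * z) x = kern c ε z x := by
  unfold kern
  rw [deriv_const_mul_field, ← mul_sub, map_mul, map_mul, he, one_mul,
    show conj e * conj (c x - z) * (e * deriv c x) = (e * conj e) * (conj (c x - z) * deriv c x) by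
      ring, Complex.mul_conj, he, Complex.ofReal_one, one_mul]

lemma chi_rotate (he : Complex.normSq e = 1) (c : ℝ → ℂ) (z : ℂ) :
    chi (fun y => e * c y) (e * z) = chi c z := by
  simp only [chi, deg, pot, kern_rotate he]

lemma IsSimpleClosed.rotate {c : ℝ → ℂ} (hc : IsSimpleClosed c) (he : e ≠ 0) :
    IsSimpleClosed fun y => e * c y where
  smooth := contDiff_const.mul hc.smooth
  per x := by simp only [hc.per x]
  reg x := by rw [deriv_const_mul_field]; exact mul_ne_zero he (hc.reg x)
  inj x y h hxy := hc.inj x y h (mul_left_cancel₀ he hxy)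

lemma IsFlow.rotate {c : ℝ → ℝ → ℂ} {S : ℝ} (hc : IsFlow c S) (he : Complex.normSq e = 1) :
    IsFlow (fun t x => e * c t x) S where
  smooth := contDiffOn_const.mul hc.smooth
  simple t ht := (hc.simple t ht).rotate (by rintro rfl; simp at he)
  flow t ht x := by
    have he0 : e ≠ 0 := by rintro rfl; simp at he
    have h1 : deriv (fun y => e * c t y) = fun y => e * deriv (c t) y := by
      funext y; exact deriv_const_mul_field _
    have h2 : flux (fun t x => e * c t x) t x = flux c t x := by
      unfold flux vel
      rw [deriv_const_mul_field, deriv_const_mul_field, map_mul,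
        show ∀ a b : ℂ, conj e * a * (e * b) = (e * conj e) * (a * b) by intros; ring,
        Complex.mul_conj, he, Complex.ofReal_one, one_mul]
    rw [h2, h1, deriv_const_mul_field, mul_div_mul_left _ _ he0]
    exact hc.flow t ht x

/-- Two nonzero vectors can be made non-vertical by a common rotation. -/
lemma exists_rotation {a b : ℂ} (ha : a ≠ 0) (hb : b ≠ 0) :
    ∃ e : ℂ, Complex.normSq e = 1 ∧ (e * a).re ≠ 0 ∧ (e * b).re ≠ 0 := by
  have key : ∃ f : ℂ, f ≠ 0 ∧ (f * a).re ≠ 0 ∧ (f * b).re ≠ 0 := by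
    by_contra! h
    have ha' : a.re ≠ 0 ∨ a.im ≠ 0 := by
      by_contra! h'; exact ha (Complex.ext h'.1 h'.2)
    have hb' : b.re ≠ 0 ∨ b.im ≠ 0 := by
      by_contra! h'; exact hb (Complex.ext h'.1 h'.2)
    have h1 := h 1 one_ne_zero
    have h2 := h Complex.I Complex.I_ne_zero
    have h3 := h (1 + Complex.I) (by intro h; simpa using congrArg Complex.re h)
    have h4 := h (1 + 2 * Complex.I) (by intro h; simpa using congrArg Complex.re h)
    simp at h1 h2 h3 h4
    grind
  obtain ⟨f, hf, h1, h2⟩ := key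
  have hf' : ‖f‖ ≠ 0 := norm_ne_zero_iff.2 hf
  refine ⟨((‖f‖⁻¹ : ℝ) : ℂ) * f, ?_, ?_, ?_⟩
  · rw [map_mul, Complex.normSq_ofReal, Complex.normSq_eq_norm_sq]; field_simp
  · rw [mul_assoc, Complex.re_ofReal_mul]; exact mul_ne_zero (inv_ne_zero hf') h1
  · rw [mul_assoc, Complex.re_ofReal_mul]; exact mul_ne_zero (inv_ne_zero hf') h2

end Rotation

namespace IsFlow
variable {c d : ℝ → ℝ → ℂ} {S : ℝ} (hc : IsFlow c S) (hd : IsFlow d S)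
include hc hd

lemma not_touch_of_re_ne_zero {t₁ x₁ y₁ p q : ℝ} (ht : t₁ ∈ Ioo 0 S) (hxy : c t₁ x₁ = d t₁ y₁)
    (hfin : ∀ᶠ z in 𝓝[≠] (c t₁ x₁), ¬(z ∈ range (c t₁) ∧ z ∈ range (d t₁)))
    (hp : p = 0 ∨ p = 1) (hq : q = 0 ∨ q = 1)
    (habs : ∀ᶠ t in 𝓝 t₁, ∀ z, z ∉ range (c t) → z ∉ range (d t) →
      ¬(chi (c t) z = p ∧ chi (d t) z = q))
    (hre : (deriv (c t₁) x₁).re ≠ 0) (hre' : (deriv (d t₁) y₁).re ≠ 0) : False := by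
  obtain ⟨u, u₁, u₂, uₜ, hu, hu'⟩ := hc.exists_graph ht hre
  obtain ⟨v, v₁, v₂, vₜ, hv, hv'⟩ := hd.exists_graph ht hre'
  obtain ⟨κ, hκ, hκs⟩ := hc.exists_sides ht hu.cont hu'
  obtain ⟨l, hl, hls⟩ := hd.exists_sides ht hv.cont hv'
  rw [← hxy] at hv hv' hls
  set ξ₁ := (c t₁ x₁).re with hξ
  set η₁ := (c t₁ x₁).im with hη
  have hP : c t₁ x₁ = ⟨ξ₁, η₁⟩ := rfl
  have hu1 : η₁ = u t₁ ξ₁ := (hu'.self_of_nhds).1 ⟨x₁, rfl⟩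
  have hv1 : η₁ = v t₁ ξ₁ := (hv'.self_of_nhds).1 ⟨y₁, hxy.symm⟩
  have hmk : Continuous fun q : ℝ × ℝ × ℝ => (q.1, (⟨q.2.1, q.2.2⟩ : ℂ)) :=
    continuous_fst.prodMk (continuous_complex_mk.comp continuous_snd)
  have habs' : ∀ᶠ q' : ℝ × ℝ × ℝ in 𝓝 (t₁, ξ₁, η₁), q'.2.2 ≠ u q'.1 q'.2.1 →
      q'.2.2 ≠ v q'.1 q'.2.1 →
      ¬(chi (c q'.1) ⟨q'.2.1, q'.2.2⟩ = p ∧ chi (d q'.1) ⟨q'.2.1, q'.2.2⟩ = q) := by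
    filter_upwards [(hmk.tendsto (t₁, ξ₁, η₁)).eventually hu',
      (hmk.tendsto (t₁, ξ₁, η₁)).eventually hv',
      ((continuous_fst (X := ℝ) (Y := ℝ × ℝ)).tendsto (t₁, ξ₁, η₁)).eventually habs]
      with r h1 h2 h3 h4 h5
    exact h3 _ (fun h => h4 (h1.1 h)) (fun h => h5 (h2.1 h))
  have hne : ∀ᶠ ξ in 𝓝[≠] ξ₁, u t₁ ξ ≠ v t₁ ξ := by
    have hcu : ContinuousAt (u t₁) ξ₁ :=
      ContinuousAt.comp (g := fun p : ℝ × ℝ => u p.1 p.2) (f := fun ξ => (t₁, ξ))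
        hu.cont.self_of_nhds (by fun_prop)
    have hcz : ContinuousAt (fun ξ => (⟨ξ, u t₁ ξ⟩ : ℂ)) ξ₁ :=
      ContinuousAt.comp (g := fun q : ℝ × ℝ => (⟨q.1, q.2⟩ : ℂ)) (f := fun ξ => (ξ, u t₁ ξ))
        continuous_complex_mk.continuousAt (continuousAt_id.prodMk hcu)
    have hcz' : Tendsto (fun ξ => (⟨ξ, u t₁ ξ⟩ : ℂ)) (𝓝[≠] ξ₁) (𝓝[≠] (c t₁ x₁)) := by
      refine tendsto_nhdsWithin_iff.2 ⟨?_, ?_⟩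
      · have := hcz.tendsto.mono_left (nhdsWithin_le_nhds (s := {ξ₁}ᶜ))
        rwa [← hu1] at this
      · filter_upwards [self_mem_nhdsWithin] with ξ hξ' h
        exact hξ' (congrArg Complex.re h)
    have hcz2 : Tendsto (fun ξ => (t₁, (⟨ξ, u t₁ ξ⟩ : ℂ))) (𝓝[≠] ξ₁) (𝓝 (t₁, c t₁ x₁)) :=
      tendsto_const_nhds.prodMk_nhds (hcz'.mono_right nhdsWithin_le_nhds)
    filter_upwards [hcz'.eventually hfin, hcz2.eventually hu', hcz2.eventually hv']
      with ξ h1 h2 h3 h4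
    exact h1 ⟨h2.2 rfl, h3.2 h4⟩
  have hline : ContinuousAt (fun η : ℝ => (t₁, ξ₁, η)) η₁ := by fun_prop
  have hmid : Tendsto (fun r : ℝ × ℝ => (r.1, r.2, (u r.1 r.2 + v r.1 r.2) / 2)) (𝓝 (t₁, ξ₁))
      (𝓝 (t₁, ξ₁, η₁)) := by
    have h := (hu.cont.self_of_nhds.add hv.cont.self_of_nhds).div_const 2
    have h2 := (continuousAt_fst (p := (t₁, ξ₁))).prodMk
      ((continuousAt_snd (p := (t₁, ξ₁))).prodMk h)
    have h3 : (u t₁ ξ₁ + v t₁ ξ₁) / 2 = η₁ := by linarith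
    have h4 := h2.tendsto
    simp only [Pi.add_apply, h3] at h4
    exact h4
  have not_both : ∀ {κ l p q : ℝ}, (κ = 0 ∨ κ = 1) → (l = 0 ∨ l = 1) → (p = 0 ∨ p = 1) →
      (q = 0 ∨ q = 1) → (κ = p ∧ l = q) ∨ (1 - κ = p ∧ 1 - l = q) ∨ (κ = p ∧ 1 - l = q) ∨
        (1 - κ = p ∧ l = q) := by
    intro κ l p q h1 h2 h3 h4
    rcases h1 with rfl | rfl <;> rcases h2 with rfl | rfl <;> rcases h3 with rfl | rfl <;>
      rcases h4 with rfl | rfl <;> norm_num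
  rcases not_both hκ hl hp hq with h | h | h | h
  · have := (hline.tendsto.mono_left (nhdsWithin_le_nhds (s := Ioi η₁))).eventually
      (habs'.and (hκs.and hls))
    obtain ⟨η, ⟨h1, h2, h3⟩, h4⟩ := (this.and self_mem_nhdsWithin).exists
    simp only at h1 h2 h3
    replace h4 : η₁ < η := h4
    rw [← hu1] at h1 h2
    rw [← hv1] at h1 h3
    exact h1 h4.ne' h4.ne' ⟨(h2.1 h4).trans h.1, (h3.1 h4).trans h.2⟩
  · have := (hline.tendsto.mono_left (nhdsWithin_le_nhds (s := Iio η₁))).eventually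
      (habs'.and (hκs.and hls))
    obtain ⟨η, ⟨h1, h2, h3⟩, h4⟩ := (this.and self_mem_nhdsWithin).exists
    simp only at h1 h2 h3
    replace h4 : η < η₁ := h4
    rw [← hu1] at h1 h2
    rw [← hv1] at h1 h3
    exact h1 h4.ne h4.ne ⟨(h2.2 h4).trans h.1, (h3.2 h4).trans h.2⟩
  · refine graph_touch_false hu hv ?_ (hu1.symm.trans hv1) hne
    filter_upwards [hmid.eventually (habs'.and (hκs.and hls))] with r hr
    obtain ⟨h1, h2, h3⟩ := hr
    by_contra! hlt
    have e1 : u r.1 r.2 < (u r.1 r.2 + v r.1 r.2) / 2 := by linarith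
    have e2 : (u r.1 r.2 + v r.1 r.2) / 2 < v r.1 r.2 := by linarith
    exact h1 e1.ne' e2.ne ⟨(h2.1 e1).trans h.1, (h3.2 e2).trans h.2⟩
  · refine graph_touch_false hv hu ?_ (hv1.symm.trans hu1) (hne.mono fun _ h => h.symm)
    filter_upwards [hmid.eventually (habs'.and (hκs.and hls))] with r hr
    obtain ⟨h1, h2, h3⟩ := hr
    by_contra! hlt
    have e1 : (u r.1 r.2 + v r.1 r.2) / 2 < u r.1 r.2 := by linarith
    have e2 : v r.1 r.2 < (u r.1 r.2 + v r.1 r.2) / 2 := by linarith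
    exact h1 e1.ne e2.ne' ⟨(h2.2 e1).trans h.1, (h3.1 e2).trans h.2⟩

/-- Two flows meeting at an isolated point cannot omit, around the time of contact, one of the four
combinations of sides. -/
theorem not_touch {t₁ x₁ y₁ p q : ℝ} (ht : t₁ ∈ Ioo 0 S) (hxy : c t₁ x₁ = d t₁ y₁)
    (hfin : ∀ᶠ z in 𝓝[≠] (c t₁ x₁), ¬(z ∈ range (c t₁) ∧ z ∈ range (d t₁)))
    (hp : p = 0 ∨ p = 1) (hq : q = 0 ∨ q = 1)
    (habs : ∀ᶠ t in 𝓝 t₁, ∀ z, z ∉ range (c t) → z ∉ range (d t) →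
      ¬(chi (c t) z = p ∧ chi (d t) z = q)) : False := by
  obtain ⟨e, he, h1, h2⟩ := exists_rotation ((hc.simple t₁ ht).reg x₁) ((hd.simple t₁ ht).reg y₁)
  have he0 : e ≠ 0 := by rintro rfl; simp at he
  have hmem : ∀ (f : ℝ → ℂ) (z : ℂ), e * z ∈ range (fun x => e * f x) ↔ z ∈ range f := by
    intro f z
    simp only [mem_range, mul_right_inj' he0]
  refine (hc.rotate he).not_touch_of_re_ne_zero (hd.rotate he) (x₁ := x₁) (y₁ := y₁) ht
    (by rw [hxy]) ?_ hp hq ?_ (by rw [deriv_const_mul_field]; exact h1)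
    (by rw [deriv_const_mul_field]; exact h2)
  · have ht' : Tendsto (fun z => e⁻¹ * z) (𝓝[≠] (e * c t₁ x₁)) (𝓝[≠] (c t₁ x₁)) := by
      refine tendsto_nhdsWithin_iff.2 ⟨?_, ?_⟩
      · have : ContinuousAt (fun z => e⁻¹ * z) (e * c t₁ x₁) := by fun_prop
        have := this.tendsto.mono_left (nhdsWithin_le_nhds (s := {e * c t₁ x₁}ᶜ))
        rwa [inv_mul_cancel_left₀ he0] at this
      · filter_upwards [self_mem_nhdsWithin] with z hz h
        exact hz (by rw [mem_singleton_iff, ← h, mul_inv_cancel_left₀ he0])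
    filter_upwards [ht'.eventually hfin] with z hz
    rw [← mul_inv_cancel_left₀ he0 z, hmem, hmem]
    exact hz
  · filter_upwards [habs] with t h z
    rw [← mul_inv_cancel_left₀ he0 z, hmem, hmem, chi_rotate he, chi_rotate he]
    exact h _

end IsFlow

/-- The simple closed curve `φ` is the limit of the curves `c t`, as `t ∈ (0, S)` tends to `t₀`. -/
structure IsLimitCurve (c : ℝ → ℝ → ℂ) (S t₀ : ℝ) (φ : ℝ → ℂ) : Prop where
  cont : Continuous φ
  per : Function.Periodic φ (2 * π)
  inj : ∀ x y, |x - y| < 2 * π → φ x = φ y → x = y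
  approx : ∀ δ > 0, ∀ᶠ t in 𝓝[Ioo 0 S] t₀, ∃ φ' : ℝ → ℂ, Continuous φ' ∧
    range φ' = range (c t) ∧ ∀ θ, ‖φ' θ - φ θ‖ < δ

/-- Near the point `z`, the side of the curves `c t` is eventually `κ` as `t` tends to `t₀`. -/
def HasSide (c : ℝ → ℝ → ℂ) (S t₀ : ℝ) (z : ℂ) (κ : ℝ) : Prop :=
  ∀ᶠ p : ℝ × ℂ in 𝓝[Ioo 0 S] t₀ ×ˢ 𝓝 z, p.2 ∉ range (c p.1) ∧ chi (c p.1) p.2 = κ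

section HasSide
variable {c : ℝ → ℝ → ℂ} {S t₀ : ℝ} {z : ℂ} {κ κ' : ℝ}

lemma HasSide.eventually (h : HasSide c S t₀ z κ) :
    ∀ᶠ t in 𝓝[Ioo 0 S] t₀, z ∉ range (c t) ∧ chi (c t) z = κ := by
  obtain ⟨pa, ha, pb, hb, H⟩ := eventually_prod_iff.1 h
  exact ha.mono fun t ht => H ht hb.self_of_nhds

lemma HasSide.eventually_nhds (h : HasSide c S t₀ z κ) : ∀ᶠ w in 𝓝 z, HasSide c S t₀ w κ := by
  obtain ⟨pa, ha, pb, hb, H⟩ := eventually_prod_iff.1 h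
  exact hb.eventually_nhds.mono fun w hw => eventually_prod_iff.2 ⟨pa, ha, pb, hw, H⟩

lemma HasSide.unique [NeBot (𝓝[Ioo 0 S] t₀)] (h : HasSide c S t₀ z κ) (h' : HasSide c S t₀ z κ') :
    κ = κ' := by
  obtain ⟨t, h1, h2⟩ := (h.eventually.and h'.eventually).exists
  exact h1.2.symm.trans h2.2

end HasSide

/-- A function on an interval that is locally constant off one point, and constant in a punctured
neighbourhood of that point, is constant off that point. -/
lemma eq_of_locally_const {f : ℝ → ℝ} (hf : ∀ x, f x = 0 ∨ f x = 1) {α β b : ℝ}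
    (h : ∀ x ∈ Ioo α β, x ≠ b → ∀ᶠ y in 𝓝 x, f y = f x)
    (hb : ∃ r > 0, ∀ y ∈ Ioo (b - r) (b + r), ∀ y' ∈ Ioo (b - r) (b + r), y ≠ b → y' ≠ b →
      f y = f y') {x y : ℝ} (hx : x ∈ Ioo α β) (hy : y ∈ Ioo α β) (hxb : x ≠ b) (hyb : y ≠ b) :
    f x = f y := by
  obtain ⟨r, hr, hb⟩ := hb
  classical
  set g : ℝ → ℝ := fun x => if x = b then f (b + r / 2) else f x with hg
  have hg1 : ∀ x, x ≠ b → g x = f x := fun x hx => if_neg hx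
  have hgc : ContinuousOn g (Ioo α β) := by
    intro x hx
    refine ContinuousAt.continuousWithinAt (EventuallyEq.continuousAt (y := g x) ?_)
    by_cases hxb : x = b
    · subst hxb
      filter_upwards [Ioo_mem_nhds (show x - r < x by linarith) (show x < x + r by linarith)]
        with y hy
      by_cases hyx : y = x
      · rw [hyx]
      · rw [hg1 y hyx]
        simp only [hg, if_true]
        exact hb y hy _ ⟨by linarith, by linarith⟩ hyx (by linarith)
    · filter_upwards [h x hx hxb, isOpen_ne.mem_nhds hxb] with y h1 h2
      rw [hg1 y h2, hg1 x hxb, h1]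
  have := eq_of_continuousOn_of_int isPreconnected_Ioo hgc (fun x _ => by
    have : ∃ z, g x = f z := by
      by_cases hxb : x = b
      · exact ⟨_, if_pos hxb⟩
      · exact ⟨x, hg1 x hxb⟩
    obtain ⟨z, hz⟩ := this
    rw [hz]
    rcases hf z with h | h
    · exact ⟨0, by simp [h]⟩
    · exact ⟨1, by simp [h]⟩) hx hy
  rwa [hg1 x hxb, hg1 y hyb] at this

namespace IsLimitCurve
variable {c d : ℝ → ℝ → ℂ} {S t₀ : ℝ} {φ ψ : ℝ → ℂ} (hφ : IsLimitCurve c S t₀ φ)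
include hφ

lemma isCompact_range : IsCompact (range φ) := by
  rw [← hφ.per.image_Icc (by positivity : (0 : ℝ) < 2 * π) 0]
  exact isCompact_Icc.image hφ.cont

lemma exists_ne (a b : ℂ) : ∃ z ∈ range φ, z ≠ a ∧ z ≠ b := by
  have hpi := Real.pi_gt_three
  have h01 : φ 0 ≠ φ 1 := fun h => by
    have := hφ.inj 0 1 (by norm_num; linarith) h; norm_num at this
  have h02 : φ 0 ≠ φ 2 := fun h => by
    have := hφ.inj 0 2 (by norm_num; linarith) h; norm_num at this
  have h12 : φ 1 ≠ φ 2 := fun h => by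
    have := hφ.inj 1 2 (by norm_num; linarith) h; norm_num at this
  by_contra! h
  have h0 := h _ ⟨0, rfl⟩
  have h1 := h _ ⟨1, rfl⟩
  have h2 := h _ ⟨2, rfl⟩
  by_cases ha0 : φ 0 = a
  · exact h12 ((h1 fun e => h01 (ha0.trans e.symm)).trans (h2 fun e => h02 (ha0.trans e.symm)).symm)
  · by_cases ha1 : φ 1 = a
    · exact h02 ((h0 ha0).trans (h2 fun e => h12 (ha1.trans e.symm)).symm)
    · exact h01 ((h0 ha0).trans (h1 ha1).symm)

lemma exists_bound : ∃ R, ∀ᶠ t in 𝓝[Ioo 0 S] t₀, ∀ x, ‖c t x‖ < R := by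
  obtain ⟨R, hR⟩ := hφ.isCompact_range.isBounded.exists_norm_le
  refine ⟨R + 1, ?_⟩
  filter_upwards [hφ.approx 1 one_pos] with t ht x
  obtain ⟨φ', -, h1, h2⟩ := ht
  obtain ⟨θ, hθ⟩ : c t x ∈ range φ' := h1 ▸ mem_range_self x
  rw [← hθ]
  have h3 := hR _ (mem_range_self θ)
  have h4 := h2 θ
  have h5 := norm_le_norm_add_norm_sub' (φ' θ) (φ θ)
  rw [norm_sub_rev] at h5
  have h6 : ‖φ θ - φ' θ‖ = ‖φ' θ - φ θ‖ := norm_sub_rev _ _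
  linarith

lemma exists_hasSide (hc : IsFlow c S) [NeBot (𝓝[Ioo 0 S] t₀)] {z : ℂ} (hz : z ∉ range φ) :
    ∃ κ, (κ = 0 ∨ κ = 1) ∧ HasSide c S t₀ z κ := by
  obtain ⟨ρ, hρ, hball⟩ := Metric.isOpen_iff.1 hφ.isCompact_range.isClosed.isOpen_compl z hz
  have h1 := hφ.approx (ρ / 2) (by linarith)
  obtain ⟨δ, hδ, h2⟩ := Metric.mem_nhdsWithin_iff.1 h1
  have hoff : ∀ t ∈ ball t₀ δ ∩ Ioo 0 S, ∀ w ∈ ball z (ρ / 2), w ∉ range (c t) := by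
    intro t ht w hw hwc
    obtain ⟨φ', -, h3, h4⟩ := h2 ht
    rw [← h3] at hwc
    obtain ⟨θ, rfl⟩ := hwc
    have : φ θ ∈ ball z ρ := by
      rw [mem_ball] at hw ⊢
      have h5 := h4 θ
      rw [← dist_eq_norm, dist_comm] at h5
      linarith [dist_triangle (φ θ) (φ' θ) z]
    exact hball this ⟨θ, rfl⟩
  have hmem : ball t₀ δ ∩ Ioo 0 S ∈ 𝓝[Ioo 0 S] t₀ :=
    Metric.mem_nhdsWithin_iff.2 ⟨δ, hδ, subset_rfl⟩
  obtain ⟨s, hs⟩ := Filter.nonempty_of_mem hmem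
  refine ⟨chi (c s) z, (hc.simple s hs.2).chi_eq_or (hoff s hs z (mem_ball_self (by linarith))), ?_⟩
  have hpre : IsPreconnected ((ball t₀ δ ∩ Ioo 0 S) ×ˢ ball z (ρ / 2)) := by
    refine IsPreconnected.prod ?_ (convex_ball _ _).isPreconnected
    rw [Real.ball_eq_Ioo]
    exact (ordConnected_Ioo.inter ordConnected_Ioo).isPreconnected
  filter_upwards [prod_mem_prod hmem (ball_mem_nhds z (by linarith : 0 < ρ / 2))] with p hp
  exact ⟨hoff _ hp.1 _ hp.2, hc.chi_const hpre (fun p hp => hp.1.2) (fun p hp => hoff _ hp.1 _ hp.2)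
    hp (q := (s, z)) ⟨hs, mem_ball_self (by linarith)⟩⟩

lemma exists_sides (hc : IsFlow c S) [NeBot (𝓝[Ioo 0 S] t₀)] :
    ∃ W : ℂ → ℝ, (∀ z, W z = 0 ∨ W z = 1) ∧ (∀ z ∉ range φ, HasSide c S t₀ z (W z)) ∧
      ∀ z ∉ range φ, ∀ᶠ w in 𝓝 z, w ∉ range φ ∧ W w = W z := by
  have h : ∀ z, ∃ κ, (κ = 0 ∨ κ = 1) ∧ (z ∉ range φ → HasSide c S t₀ z κ) := by
    intro z
    by_cases hz : z ∈ range φ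
    · exact ⟨0, Or.inl rfl, fun h => absurd hz h⟩
    · obtain ⟨κ, h1, h2⟩ := hφ.exists_hasSide hc hz
      exact ⟨κ, h1, fun _ => h2⟩
  choose W hW hW' using h
  refine ⟨W, hW, hW', fun z hz => ?_⟩
  filter_upwards [(hW' z hz).eventually_nhds,
    hφ.isCompact_range.isClosed.isOpen_compl.mem_nhds hz] with w h1 h2
  exact ⟨h2, (hW' w h2).unique h1⟩

omit hφ in
/-- If the curves `d t` and `c t` do not meet near `b`, for a sequence of times tending to `t₀`,
then the limit of `d t` stays on a single side of the limit of `c t`. -/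
lemma side_const (hc : IsFlow c S) (hψ : IsLimitCurve d S t₀ ψ) {W : ℂ → ℝ}
    (hW : ∀ z, W z = 0 ∨ W z = 1) (hWs : ∀ z ∉ range φ, HasSide c S t₀ z (W z))
    (hWc : ∀ z ∉ range φ, ∀ᶠ w in 𝓝 z, w ∉ range φ ∧ W w = W z) {a b : ℂ}
    (hab : a ≠ b)
    (hX : range φ ∩ range ψ = {a, b}) {ε : ℝ} (hε : 0 < ε)
    (hfreq : ∃ᶠ t in 𝓝[Ioo 0 S] t₀, ∀ z ∈ range (c t), z ∈ range (d t) → ε ≤ dist z b) :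
    ∃ k, (k = 0 ∨ k = 1) ∧ ∀ z ∈ range ψ, z ≠ a → z ≠ b → W z = k := by
  have ha : a ∈ range ψ := (hX.symm ▸ mem_insert a {b} : a ∈ range φ ∩ range ψ).2
  obtain ⟨θa, hθa⟩ := ha
  have hbm : b ∈ range ψ := (hX.symm ▸ mem_insert_of_mem a rfl : b ∈ range φ ∩ range ψ).2
  have h2pi : (0 : ℝ) < 2 * π := by positivity
  obtain ⟨θb, hθb, hθb'⟩ : ∃ θ ∈ Ico θa (θa + 2 * π), ψ θ = b := by
    obtain ⟨θ, hθ⟩ := hbm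
    obtain ⟨θ', h1, h2⟩ := hψ.per.exists_mem_Ico h2pi θ θa
    exact ⟨θ', h1, h2.symm.trans hθ⟩
  have hoff : ∀ θ, ψ θ ≠ a → ψ θ ≠ b → ψ θ ∉ range φ := by
    intro θ h1 h2 h3
    have : ψ θ ∈ range φ ∩ range ψ := ⟨h3, θ, rfl⟩
    rw [hX] at this
    rcases this with h | h
    · exact h1 h
    · exact h2 h
  have hna : ∀ θ ∈ Ioo θa (θa + 2 * π), ψ θ ≠ a := by
    intro θ hθ h
    have := hψ.inj θ θa (by rw [abs_lt]; constructor <;> linarith [hθ.1, hθ.2]) (h.trans hθa.symm)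
    linarith [hθ.1]
  have hnb : ∀ θ ∈ Ioo θa (θa + 2 * π), θ ≠ θb → ψ θ ≠ b := by
    intro θ hθ hne h
    refine hne (hψ.inj θ θb ?_ (h.trans hθb'.symm))
    rw [abs_lt]; constructor <;> linarith [hθ.1, hθ.2, hθb.1, hθb.2]
  have key : ∃ r > 0, ∀ y ∈ Ioo (θb - r) (θb + r), ∀ y' ∈ Ioo (θb - r) (θb + r),
      ψ y ∉ range φ → ψ y' ∉ range φ → W (ψ y) = W (ψ y') := by
    obtain ⟨r, hr, hball⟩ := Metric.continuousAt_iff.1 (hψ.cont.continuousAt (x := θb)) (ε / 2)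
      (by linarith)
    refine ⟨r, hr, fun y hy y' hy' hz hz' => ?_⟩
    obtain ⟨pa, ha, pb, hb, H⟩ := eventually_prod_iff.1 (hWs _ hz)
    obtain ⟨pa', ha', pb', hb', H'⟩ := eventually_prod_iff.1 (hWs _ hz')
    obtain ⟨δ, hδ, hδ1⟩ := Metric.eventually_nhds_iff.1 hb
    obtain ⟨δ', hδ', hδ1'⟩ := Metric.eventually_nhds_iff.1 hb'
    have hmin : 0 < min (ε / 2) (min δ δ') := lt_min (by linarith) (lt_min hδ hδ')
    obtain ⟨t, h1, ⟨ψ', hc', hr', hd'⟩, h3, h4, h5⟩ := (hfreq.and_eventually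
      ((hψ.approx _ hmin).and (ha.and (ha'.and self_mem_nhdsWithin)))).exists
    have hoff' : ∀ θ ∈ Ioo (θb - r) (θb + r), ψ' θ ∉ range (c t) := by
      intro θ hθ hmem
      have h6 := h1 _ hmem (hr' ▸ mem_range_self θ)
      have h7 : dist (ψ θ) b < ε / 2 := by
        rw [← hθb']
        refine hball ?_
        rw [Real.dist_eq, abs_lt]; constructor <;> linarith [hθ.1, hθ.2]
      have h8 : dist (ψ' θ) (ψ θ) < ε / 2 := by
        rw [dist_eq_norm]; exact (hd' θ).trans_le (min_le_left _ _)
      linarith [dist_triangle (ψ' θ) (ψ θ) b]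
    have h9 := hc.chi_const (V := (fun θ => (t, ψ' θ)) '' Ioo (θb - r) (θb + r))
      (isPreconnected_Ioo.image _ (by fun_prop))
      (by rintro _ ⟨θ, -, rfl⟩; exact h5) (by rintro _ ⟨θ, hθ, rfl⟩; exact hoff' θ hθ)
      (mem_image_of_mem _ hy) (mem_image_of_mem _ hy')
    have e1 := (H h3 (hδ1 (y := ψ' y) (by
      rw [dist_eq_norm]
      exact (hd' y).trans_le ((min_le_right _ _).trans (min_le_left _ _))))).2
    have e2 := (H' h4 (hδ1' (y := ψ' y') (by
      rw [dist_eq_norm]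
      exact (hd' y').trans_le ((min_le_right _ _).trans (min_le_right _ _))))).2
    exact e1.symm.trans (h9.trans e2)
  have hconst : ∀ x ∈ Ioo θa (θa + 2 * π), ∀ y ∈ Ioo θa (θa + 2 * π), x ≠ θb → y ≠ θb →
      W (ψ x) = W (ψ y) := by
    obtain ⟨r, hr, hr'⟩ := key
    have hab' : θa < θb := lt_of_le_of_ne hθb.1 fun h => hab (by rw [← hθa, h, hθb'])
    set ρ := min r (min (θb - θa) (θa + 2 * π - θb)) with hρ
    have h1 : ρ ≤ r := min_le_left _ _
    have h2 : ρ ≤ θb - θa := (min_le_right _ _).trans (min_le_left _ _)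
    have h3 : ρ ≤ θa + 2 * π - θb := (min_le_right _ _).trans (min_le_right _ _)
    have h4 : ∀ y ∈ Ioo (θb - ρ) (θb + ρ), y ≠ θb → ψ y ∉ range φ := by
      intro y hy hne
      have hy' : y ∈ Ioo θa (θa + 2 * π) := ⟨by linarith [hy.1], by linarith [hy.2]⟩
      exact hoff y (hna y hy') (hnb y hy' hne)
    intro x hx y hy hxb hyb
    refine eq_of_locally_const (f := fun θ => W (ψ θ)) (fun x => hW _) (b := θb) ?_
      ⟨ρ, lt_min hr (lt_min (by linarith) (by linarith [hθb.2])), ?_⟩ hx hy hxb hyb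
    · intro x hx hxb
      exact (hψ.cont.continuousAt.eventually (hWc _ (hoff x (hna x hx) (hnb x hx hxb)))).mono
        fun y hy => hy.2
    · intro y hy y' hy' hne hne'
      exact hr' y ⟨by linarith [hy.1], by linarith [hy.2]⟩ y'
        ⟨by linarith [hy'.1], by linarith [hy'.2]⟩ (h4 y hy hne) (h4 y' hy' hne')
  have hrep : ∀ z ∈ range ψ, z ≠ a → z ≠ b → ∃ θ ∈ Ioo θa (θa + 2 * π), θ ≠ θb ∧ ψ θ = z := by
    intro z hz h1 h2
    obtain ⟨θ', rfl⟩ := hz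
    obtain ⟨θ, hθ, he⟩ := hψ.per.exists_mem_Ico h2pi θ' θa
    rw [he] at h1 h2 ⊢
    refine ⟨θ, ⟨lt_of_le_of_ne hθ.1 ?_, hθ.2⟩, ?_, rfl⟩
    · rintro rfl; exact h1 hθa
    · rintro rfl; exact h2 hθb'
  obtain ⟨z₀, hz₀, hza, hzb⟩ := hψ.exists_ne a b
  obtain ⟨θ₀, hθ₀, hθ₀b, rfl⟩ := hrep z₀ hz₀ hza hzb
  refine ⟨W (ψ θ₀), hW _, fun z hz h1 h2 => ?_⟩
  obtain ⟨θ, hθ, hθb, rfl⟩ := hrep z hz h1 h2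
  exact hconst _ hθ _ hθ₀ hθb hθ₀b

end IsLimitCurve

/-- If the limit of each of two families of curves stays on one side of the limit of the other one,
then one of the four combinations of sides does not occur. -/
lemma not_both_opposite_sides {K L : Set ℂ} {W V : ℂ → ℝ}
    (hWc : ∀ z ∉ K, ∀ᶠ w in 𝓝 z, w ∉ K ∧ W w = W z)
    (hVc : ∀ z ∉ L, ∀ᶠ w in 𝓝 z, w ∉ L ∧ V w = V z) {a b : ℂ} (hX : K ∩ L = {a, b})
    {k l : ℝ} (hWk : ∀ z ∈ L, z ≠ a → z ≠ b → W z = k) (hVl : ∀ z ∈ K, z ≠ a → z ≠ b → V z = l)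
    (hne : ∃ z ∈ K, z ≠ a ∧ z ≠ b) (hk : k ≠ 1 - k) (hl : l ≠ 1 - l) {z : ℂ} (hzK : z ∉ K)
    (hzL : z ∉ L) : ¬(W z = 1 - k ∧ V z = 1 - l) := by
  classical
  intro hz
  set U : Set ℂ := {z | z ∉ K ∧ z ∉ L ∧ W z = 1 - k ∧ V z = 1 - l} with hU
  set g : ℂ → ℝ := fun z => if z ∈ U then 1 else 0 with hg
  have hpre : IsPreconnected ({a, b}ᶜ : Set ℂ) :=
    ((Set.toFinite {a, b}).countable.isPathConnected_compl_of_one_lt_rank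
      (by simp)).isConnected.isPreconnected
  have hgc : ContinuousOn g {a, b}ᶜ := by
    intro w hw
    have hwa : w ≠ a := fun h => hw (Or.inl h)
    have hwb : w ≠ b := fun h => hw (Or.inr h)
    refine ContinuousAt.continuousWithinAt (EventuallyEq.continuousAt (y := g w) ?_)
    have hcases : w ∉ K ∨ w ∉ L := by
      by_contra! h
      exact hw (hX ▸ (⟨h.1, h.2⟩ : w ∈ K ∩ L))
    by_cases hwK : w ∈ K
    · have hwL : w ∉ L := hcases.resolve_left (not_not.2 hwK)
      have h0 : g w = 0 := if_neg fun h => h.1 hwK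
      rw [h0]
      filter_upwards [hVc w hwL] with w' hw'
      refine if_neg fun h => hl ?_
      rw [← h.2.2.2, hw'.2, hVl w hwK hwa hwb]
    · by_cases hwL : w ∈ L
      · have h0 : g w = 0 := if_neg fun h => h.2.1 hwL
        rw [h0]
        filter_upwards [hWc w hwK] with w' hw'
        refine if_neg fun h => hk ?_
        rw [← h.2.2.1, hw'.2, hWk w hwL hwa hwb]
      · filter_upwards [hWc w hwK, hVc w hwL] with w' h1 h2
        simp only [hg, hU, mem_ofPred_eq, h1, h2, hwK, hwL]
  obtain ⟨z₀, h0, h0a, h0b⟩ := hne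
  have hza : z ∈ ({a, b}ᶜ : Set ℂ) := by
    intro h
    rw [← hX] at h
    exact hzK h.1
  have hz0 : z₀ ∈ ({a, b}ᶜ : Set ℂ) := by
    rintro (h | h)
    · exact h0a h
    · exact h0b h
  have := eq_of_continuousOn_of_int hpre hgc (fun w _ => by
    by_cases h : w ∈ U
    · exact ⟨1, by simp [hg, h]⟩
    · exact ⟨0, by simp [hg, h]⟩) hza hz0
  rw [show g z = 1 from if_pos ⟨hzK, hzL, hz.1, hz.2⟩,
    show g z₀ = 0 from if_neg fun h => h.1 h0] at this
  exact one_ne_zero this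

/-- Intersection points of two flows, meeting in two points at all times, persist. -/
theorem IsFlow.eventually_exists_mem {c d : ℝ → ℝ → ℂ} {S T t₀ : ℝ} (hc : IsFlow c S)
    (hd : IsFlow d S) (hT : T ≤ S)
    (h2 : ∀ t ∈ Ioo t₀ T, ∃ P Q, P ≠ Q ∧ range (c t) ∩ range (d t) = {P, Q})
    (ht₀ : t₀ ∈ Ico 0 T) {φ ψ : ℝ → ℂ} (hφ : IsLimitCurve c S t₀ φ) (hψ : IsLimitCurve d S t₀ ψ)
    (hφ0 : volume (range φ) = 0) (hψ0 : volume (range ψ) = 0) {a b : ℂ} (hab : a ≠ b)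
    (hX : range φ ∩ range ψ = {a, b}) {ε : ℝ} (hε : 0 < ε) :
    ∀ᶠ t in 𝓝[Ioo 0 S] t₀, ∃ z ∈ range (c t) ∩ range (d t), dist z b < ε := by
  by_contra hcon
  have hfreq : ∃ᶠ t in 𝓝[Ioo 0 S] t₀, ∀ z ∈ range (c t), z ∈ range (d t) → ε ≤ dist z b := by
    refine (not_eventually.1 hcon).mono fun t ht z h1 h2 => ?_
    by_contra! h
    exact ht ⟨z, ⟨h1, h2⟩, h⟩
  have hS : t₀ < S := ht₀.2.trans_le hT
  have hle : 𝓝[>] t₀ ≤ 𝓝[Ioo 0 S] t₀ := by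
    rw [← nhdsWithin_Ioo_eq_nhdsGT hS]
    exact nhdsWithin_mono _ (Ioo_subset_Ioo_left ht₀.1)
  have hbot : NeBot (𝓝[Ioo 0 S] t₀) := NeBot.mono inferInstance hle
  obtain ⟨W, hW, hWs, hWc⟩ := hφ.exists_sides hc
  obtain ⟨V, hV, hVs, hVc⟩ := hψ.exists_sides hd
  obtain ⟨k, hk, hWk⟩ := IsLimitCurve.side_const hc hψ hW hWs hWc hab hX hε hfreq
  obtain ⟨l, hl, hVl⟩ := IsLimitCurve.side_const hd hφ hV hVs hVc hab (by rw [inter_comm, hX]) hε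
    (hfreq.mono fun t ht z h1 h2 => ht z h2 h1)
  have hmiss : ∀ z ∉ range φ, z ∉ range ψ → ¬(W z = 1 - k ∧ V z = 1 - l) := by
    intro z
    refine not_both_opposite_sides hWc hVc hX
      hWk hVl (hφ.exists_ne a b) ?_ ?_
    · rcases hk with rfl | rfl <;> norm_num
    · rcases hl with rfl | rfl <;> norm_num
  set p := 1 - k with hp
  set q := 1 - l with hq
  have hp01 : p = 0 ∨ p = 1 := by rcases hk with h | h <;> simp [hp, h]
  have hq01 : q = 0 ∨ q = 1 := by rcases hl with h | h <;> simp [hq, h]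
  obtain ⟨R₁, hR₁⟩ := hφ.exists_bound
  obtain ⟨R₂, hR₂⟩ := hψ.exists_bound
  obtain ⟨B₁, hB₁⟩ := hφ.isCompact_range.isBounded.exists_norm_le
  obtain ⟨B₂, hB₂⟩ := hψ.isCompact_range.isBounded.exists_norm_le
  have hpq : ¬(p = 0 ∧ q = 0) := by
    rintro ⟨hp0, hq0⟩
    set M : ℝ := |R₁| + |R₂| + |B₁| + |B₂| + 1 with hM
    have hM' : ‖(M : ℂ)‖ = M := by
      rw [Complex.norm_real, Real.norm_of_nonneg (by positivity)]
    have n1 := abs_nonneg R₁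
    have n2 := abs_nonneg R₂
    have n3 := abs_nonneg B₁
    have n4 := abs_nonneg B₂
    have hMφ : (M : ℂ) ∉ range φ := fun h => by
      have := hB₁ _ h
      rw [hM'] at this
      linarith [le_abs_self B₁]
    have hMψ : (M : ℂ) ∉ range ψ := fun h => by
      have := hB₂ _ h
      rw [hM'] at this
      linarith [le_abs_self B₂]
    obtain ⟨t, e1, e2, e3, e4, ht⟩ := ((hWs _ hMφ).eventually.and ((hVs _ hMψ).eventually.and
      (hR₁.and (hR₂.and self_mem_nhdsWithin)))).exists
    refine hmiss _ hMφ hMψ ⟨?_, ?_⟩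
    · rw [← e1.2, hp0]
      exact (hc.simple t ht).chi_eq_zero e3 (by rw [hM']; linarith [le_abs_self R₁])
    · rw [← e2.2, hq0]
      exact (hd.simple t ht).chi_eq_zero e4 (by rw [hM']; linarith [le_abs_self R₂])
  have hcombo : ∀ t ∈ Ioo t₀ T, ∀ z, z ∉ range (c t) → z ∉ range (d t) →
      ¬(chi (c t) z = p ∧ chi (d t) z = q) := by
    intro t ht z hz hz' ⟨h3, h4⟩
    have := hc.combo_eq_zero hd (A := p * (1 - q)) (B := q * (1 - p)) (C := 3 * p * q - p - q)
      (R := max R₁ R₂) ht₀.1 hT h2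
      (by rcases hp01 with h | h <;> rcases hq01 with h' | h' <;> rw [h, h'] <;> norm_num)
      (by rcases hp01 with h | h <;> rcases hq01 with h' | h' <;> rw [h, h'] <;> norm_num)
      (by rcases hp01 with h | h <;> rcases hq01 with h' | h' <;> rw [h, h'] <;> norm_num)
      (by
        filter_upwards [hle hR₁, hle hR₂] with t h1 h2 x
        exact ⟨(h1 x).trans_le (le_max_left _ _), (h2 x).trans_le (le_max_right _ _)⟩)
      (by
        filter_upwards [measure_eq_zero_iff_ae_notMem.1 hφ0, measure_eq_zero_iff_ae_notMem.1 hψ0]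
          with z h1 h2
        filter_upwards [hle (hWs z h1).eventually, hle (hVs z h2).eventually] with t h3 h4
        rw [h3.2, h4.2]
        have h5 := hmiss z h1 h2
        rcases hp01 with h | h <;> rcases hq01 with h' | h' <;> rcases hW z with h6 | h6 <;>
          rcases hV z with h7 | h7 <;> rw [h, h', h6, h7] at h5 <;> rw [h, h', h6, h7] <;>
          revert h5 <;> norm_num)
      ht hz hz'
    rw [h3, h4] at this
    rcases hp01 with h | h <;> rcases hq01 with h' | h' <;> rw [h, h'] at this hpq <;>
      revert this hpq <;> norm_num
  set t₁ := (t₀ + T) / 2 with ht₁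
  have ht₁' : t₁ ∈ Ioo t₀ T := ⟨by linarith [ht₀.2], by linarith [ht₀.2]⟩
  obtain ⟨P, Q, -, hPQ⟩ := h2 t₁ ht₁'
  obtain ⟨⟨x₁, hx₁⟩, y₁, hy₁⟩ : P ∈ range (c t₁) ∩ range (d t₁) := by
    rw [hPQ]; exact mem_insert _ _
  refine hc.not_touch hd (t₁ := t₁) (x₁ := x₁) (y₁ := y₁)
    ⟨ht₀.1.trans_lt ht₁'.1, ht₁'.2.trans_le hT⟩ (hx₁.trans hy₁.symm) ?_ hp01 hq01 ?_
  · have hfin : ((range (c t₁) ∩ range (d t₁)) \ {c t₁ x₁}).Finite := by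
      rw [hPQ]; exact (Set.toFinite _).subset sdiff_subset
    have := hfin.isClosed.isOpen_compl.mem_nhds (x := c t₁ x₁) (by simp)
    filter_upwards [mem_nhdsWithin_of_mem_nhds this, self_mem_nhdsWithin] with z h1 h2 h3
    exact h1 ⟨h3, h2⟩
  · exact eventually_of_mem (Ioo_mem_nhds ht₁'.1 ht₁'.2) hcombo

/-- A nonvanishing continuous function on a half-open interval has a continuous square root. -/
lemma exists_continuous_sqrt {T : ℝ} (hT : 0 < T) {D : Ico 0 T → ℂ} (hD : Continuous D)
    (h0 : ∀ t, D t ≠ 0) : ∃ r : Ico 0 T → ℂ, Continuous r ∧ ∀ t, r t ^ 2 = D t := by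
  have hpos : ∀ x : ℝ, 0 < 1 + max x 0 := fun x => by positivity
  let σ : ℝ → Ico 0 T := fun x => ⟨T * (max x 0 / (1 + max x 0)), by
    constructor
    · have := hpos x
      positivity
    · have : max x 0 / (1 + max x 0) < 1 := by rw [div_lt_one (hpos x)]; linarith
      nlinarith⟩
  have hσ : Continuous σ := by
    refine Continuous.subtype_mk (continuous_const.mul (Continuous.div₀ (by fun_prop) (by fun_prop)
      fun x => (hpos x).ne')) _
  obtain ⟨L, hL, hexp⟩ := exists_continuous_log (F := fun p => D (σ p.1)) (by fun_prop)
    fun p => h0 _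
  have hne : ∀ t : Ico 0 T, T - t ≠ 0 := fun t => (sub_pos.2 t.2.2).ne'
  refine ⟨fun t => Complex.exp (L (t / (T - t), 0) / 2), ?_, fun t => ?_⟩
  · have h1 : Continuous fun t : Ico 0 T => (t : ℝ) / (T - t) :=
      Continuous.div₀ (by fun_prop) (by fun_prop) hne
    have h2 : Continuous fun t : Ico 0 T => L ((t : ℝ) / (T - t), 0) :=
      hL.comp (h1.prodMk continuous_const)
    exact Complex.continuous_exp.comp (h2.div_const _)
  · rw [← Complex.exp_nat_mul]
    have h1 : σ ((t : ℝ) / (T - t)) = t := by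
      ext
      have h2 : 0 < T - t := sub_pos.2 t.2.2
      have h3 : max ((t : ℝ) / (T - t)) 0 = t / (T - t) := max_eq_left (div_nonneg t.2.1 h2.le)
      simp only [σ, h3]
      have h4 : 1 + (t : ℝ) / (T - t) = T / (T - t) := by field_simp; ring
      rw [h4, div_div_div_cancel_right₀ h2.ne', mul_div_cancel₀ _ hT.ne']
    have h4 := hexp ((t : ℝ) / (T - t), 0)
    simp only [h1] at h4
    rw [← h4]
    congr 1
    push_cast
    ring

/-- A lower semicontinuous family of two-point sets, parametrized by a half-open interval, has a
unique continuous selection with a given initial value. -/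
theorem existsUnique_selection {T : ℝ} (hT : 0 < T) {X : Ico 0 T → Set ℂ}
    (h2 : ∀ t, ∃ P Q, P ≠ Q ∧ X t = {P, Q})
    (hX : ∀ t, ∀ b ∈ X t, ∀ ε > 0, ∀ᶠ s in 𝓝 t, ∃ z ∈ X s, dist z b < ε)
    {x : ℂ} (hx : x ∈ X ⟨0, le_rfl, hT⟩) :
    ∃! p : Ico 0 T → ℂ, Continuous p ∧ p ⟨0, le_rfl, hT⟩ = x ∧ ∀ t, p t ∈ X t := by
  choose P Q hPQ hXe using h2
  have hsymm : ∀ F : ℂ × ℂ → ℂ, Continuous F → (∀ z w, F (z, w) = F (w, z)) →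
      Continuous fun t => F (P t, Q t) := by
    intro F hF hs
    refine continuous_iff_continuousAt.2 fun t => Metric.tendsto_nhds.2 fun ε hε => ?_
    obtain ⟨δ, hδ, hδ'⟩ := Metric.continuousAt_iff.1 (hF.continuousAt (x := (P t, Q t))) ε hε
    have hd : 0 < dist (P t) (Q t) := dist_pos.2 (hPQ t)
    have hm : 0 < min δ (dist (P t) (Q t) / 2) := lt_min hδ (by linarith)
    filter_upwards [hX t (P t) (by rw [hXe]; simp) _ hm, hX t (Q t) (by rw [hXe]; simp) _ hm]
      with s ⟨z, hz, hz'⟩ ⟨w, hw, hw'⟩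
    have hzw : z ≠ w := by
      rintro rfl
      have := dist_triangle_left (P t) (Q t) z
      have e1 := hz'.trans_le (min_le_right _ _)
      have e2 := hw'.trans_le (min_le_right _ _)
      linarith
    have hF' : F (P s, Q s) = F (z, w) := by
      rw [hXe] at hz hw
      rcases hz with rfl | rfl <;> rcases hw with rfl | rfl
      · exact absurd rfl hzw
      · rfl
      · exact hs _ _
      · exact absurd rfl hzw
    rw [hF']
    refine hδ' ?_
    rw [Prod.dist_eq]
    exact max_lt (hz'.trans_le (min_le_left _ _)) (hw'.trans_le (min_le_left _ _))
  set σ : Ico 0 T → ℂ := fun t => P t + Q t with hσdef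
  have hσ : Continuous σ := hsymm (fun p => p.1 + p.2) (by fun_prop) fun z w => add_comm _ _
  have hD : Continuous fun t => (P t - Q t) ^ 2 :=
    hsymm (fun p => (p.1 - p.2) ^ 2) (by fun_prop) fun z w => by ring
  have hD0 : ∀ t, (P t - Q t) ^ 2 ≠ 0 := fun t => pow_ne_zero 2 (sub_ne_zero.2 (hPQ t))
  obtain ⟨r, hr, hrsq⟩ := exists_continuous_sqrt hT hD hD0
  have hr0 : ∀ t, r t ≠ 0 := fun t h => hD0 t (by rw [← hrsq, h]; simp)
  have hrPQ : ∀ t, r t = P t - Q t ∨ r t = -(P t - Q t) := fun t =>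
    sq_eq_sq_iff_eq_or_eq_neg.1 (hrsq t)
  have hsign : ∀ t, ∀ z ∈ X t, 2 * z - σ t = r t ∨ 2 * z - σ t = -r t := by
    intro t z hz
    rw [hXe] at hz
    refine sq_eq_sq_iff_eq_or_eq_neg.1 ?_
    rw [hrsq]
    rcases hz with rfl | rfl <;> simp only [hσdef] <;> ring
  have hmem : ∀ e : ℂ, (e = 1 ∨ e = -1) → ∀ t, (σ t + e * r t) / 2 ∈ X t := by
    intro e he t
    rw [hXe]
    rcases he with rfl | rfl <;> rcases hrPQ t with h | h <;> rw [h]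
    · left; simp only [hσdef]; ring
    · right; simp only [hσdef, mem_singleton_iff]; ring
    · right; simp only [hσdef, mem_singleton_iff]; ring
    · left; simp only [hσdef]; ring
  have hconst : ∀ p : Ico 0 T → ℂ, Continuous p → (∀ t, p t ∈ X t) → ∀ t,
      (2 * p t - σ t) / r t = (2 * p ⟨0, le_rfl, hT⟩ - σ ⟨0, le_rfl, hT⟩) / r ⟨0, le_rfl, hT⟩ := by
    intro p hp hpX t
    have hval : ∀ t, (2 * p t - σ t) / r t = 1 ∨ (2 * p t - σ t) / r t = -1 := by
      intro t
      rcases hsign t _ (hpX t) with h | h <;> rw [h]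
      · left; exact div_self (hr0 t)
      · right; rw [neg_div, div_self (hr0 t)]
    have hc : Continuous fun t => ((2 * p t - σ t) / r t).re :=
      Complex.continuous_re.comp (Continuous.div₀ (by fun_prop) hr hr0)
    have : PreconnectedSpace (Ico 0 T) := Subtype.preconnectedSpace isPreconnected_Ico
    have h := eq_of_continuousOn_of_int isPreconnected_univ hc.continuousOn (fun t _ => by
      rcases hval t with h | h
      · exact ⟨1, by rw [h]; simp⟩
      · exact ⟨-1, by rw [h]; simp⟩) (mem_univ t) (mem_univ ⟨0, le_rfl, hT⟩)
    rcases hval t with h1 | h1 <;> rcases hval ⟨0, le_rfl, hT⟩ with h2 | h2 <;>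
      rw [h1, h2] at h ⊢ <;> norm_num at h
  obtain ⟨e, he, hex⟩ : ∃ e : ℂ, (e = 1 ∨ e = -1) ∧
      (σ ⟨0, le_rfl, hT⟩ + e * r ⟨0, le_rfl, hT⟩) / 2 = x := by
    rcases hsign _ x hx with h | h
    · exact ⟨1, Or.inl rfl, by rw [one_mul, ← h]; ring⟩
    · refine ⟨-1, Or.inr rfl, ?_⟩
      rw [neg_one_mul, ← h]; ring
  refine ⟨fun t => (σ t + e * r t) / 2, ⟨by fun_prop, hex, hmem e he⟩, ?_⟩
  rintro p ⟨hp, hp0, hpX⟩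
  funext t
  have h1 := hconst p hp hpX t
  have h2 := hconst (fun t => (σ t + e * r t) / 2) (by fun_prop) (hmem e he) t
  rw [hp0] at h1
  simp only [hex] at h2
  have h3 := h1.trans h2.symm
  rw [div_left_inj' (hr0 t)] at h3
  have h4 : 2 * p t = 2 * ((σ t + e * r t) / 2) := by linear_combination h3
  exact mul_left_cancel₀ two_ne_zero h4

/-- The curvature vector of a plane curve, in complex notation. -/
lemma IsSimpleClosed.im_conj_curvature {C : ℝ → ℂ} (hC : IsSimpleClosed C) (x : ℝ) :
    (conj (‖deriv C x‖⁻¹ • deriv (fun y => ‖deriv C y‖⁻¹ • deriv C y) x) * deriv C x).im =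
      -(deriv (deriv C) x / deriv C x).im := by
  have hd := hC.hasDerivAt_deriv x
  have hn : DifferentiableAt ℝ (fun y => ‖deriv C y‖⁻¹) x :=
    (hd.differentiableAt.norm ℝ (hC.reg x)).inv (norm_ne_zero_iff.2 (hC.reg x))
  obtain ⟨g', hg⟩ : ∃ g', HasDerivAt (fun y => ‖deriv C y‖⁻¹) g' x := ⟨_, hn.hasDerivAt⟩
  have hne : ‖deriv C x‖ ≠ 0 := norm_ne_zero_iff.2 (hC.reg x)
  have h0 : deriv (fun y => ‖deriv C y‖⁻¹ • deriv C y) x = _ := (hg.smul hd).deriv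
  rw [h0]
  set v := deriv C x
  set w := deriv (deriv C) x
  have h1 : (w / v).im = (‖v‖ ^ 2)⁻¹ * (w.im * v.re - w.re * v.im) := by
    rw [Complex.div_im, Complex.normSq_eq_norm_sq]; field_simp
  rw [h1]
  simp [Complex.mul_im]
  field_simp
  ring

variable (Φ : E2 ≃ₗᵢ[ℝ] ℂ)

lemma deriv_isometry (f : ℝ → E2) (x : ℝ) : deriv (fun y => Φ (f y)) x = Φ (deriv f x) := by
  have h := Φ.toContinuousLinearEquiv.comp_fderiv (f := f) (x := x)
  have h2 := congrArg (fun L : ℝ →L[ℝ] ℂ => L 1) h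
  exact h2

lemma isometry_curvatureVector (f : ℝ → E2) (x : ℝ) :
    Φ (curvatureVector f x) = ‖deriv (fun y => Φ (f y)) x‖⁻¹ •
      deriv (fun y => ‖deriv (fun y => Φ (f y)) y‖⁻¹ • deriv (fun y => Φ (f y)) y) x := by
  have h : (fun y => ‖deriv f y‖⁻¹ • Φ (deriv f y)) = fun y => Φ (‖deriv f y‖⁻¹ • deriv f y) :=
    funext fun y => (map_smul Φ _ _).symm
  simp only [deriv_isometry, LinearIsometryEquiv.norm_map]
  rw [h, deriv_isometry, ← map_smul]
  rfl

variable {γ : Set E2} {S : ℝ} (sol : CurvatureFlowSolution γ S)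

lemma eq_of_abs_sub_lt {t x y : ℝ} (ht : t ∈ Ioo 0 S) (hxy : |x - y| < 2 * π)
    (h : sol.Γ x t = sol.Γ y t) : x = y := by
  have h2pi : (0 : ℝ) < 2 * π := by positivity
  have hx := toIcoMod_mem_Ico h2pi 0 x
  have hy := toIcoMod_mem_Ico h2pi 0 y
  rw [zero_add] at hx hy
  have hp := sol.periodic t
  have h1 : sol.Γ (toIcoMod h2pi 0 x) t = sol.Γ x t :=
    hp.sub_zsmul_eq (toIcoDiv h2pi 0 x)
  have h2 : sol.Γ (toIcoMod h2pi 0 y) t = sol.Γ y t :=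
    hp.sub_zsmul_eq (toIcoDiv h2pi 0 y)
  have h3 := sol.inj t ht _ hx _ hy (h1.trans (h.trans h2.symm))
  have h4 := toIcoMod_add_toIcoDiv_zsmul h2pi 0 x
  have h5 := toIcoMod_add_toIcoDiv_zsmul h2pi 0 y
  have h6 : x - y = ((toIcoDiv h2pi 0 x - toIcoDiv h2pi 0 y : ℤ) : ℝ) * (2 * π) := by
    rw [zsmul_eq_mul] at h4 h5
    push_cast
    linear_combination h3 - h4 + h5
  rw [h6, abs_mul, abs_of_pos h2pi] at hxy
  have h7 : |((toIcoDiv h2pi 0 x - toIcoDiv h2pi 0 y : ℤ) : ℝ)| < 1 := by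
    by_contra! h8
    nlinarith
  have h8 : toIcoDiv h2pi 0 x - toIcoDiv h2pi 0 y = 0 := by
    rw [← Int.abs_lt_one_iff]; exact_mod_cast h7
  rw [h8] at h6
  simp at h6
  linarith

lemma isSimpleClosed_slice {t : ℝ} (ht : t ∈ Ioo 0 S) : IsSimpleClosed fun x => Φ (sol.Γ x t) where
  smooth := by
    have h1 : ContDiff ℝ 2 fun x : ℝ => (x, t) := by fun_prop
    have h2 : ContDiffOn ℝ 2 (fun x => sol.Γ x t) univ :=
      (sol.smooth.of_le (WithTop.coe_le_coe.2 (le_top (a := (2 : ℕ∞))))).comp h1.contDiffOn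
          fun x _ => ⟨mem_univ _, ht⟩
    exact Φ.contDiff.comp (contDiffOn_univ.1 h2)
  per x := congrArg Φ (sol.periodic t x)
  reg x := by
    rw [deriv_isometry]
    exact fun h => sol.deriv_ne t ht x (Φ.map_eq_zero_iff.1 h)
  inj x y h hxy := eq_of_abs_sub_lt sol ht h (Φ.injective hxy)

lemma isFlow : IsFlow (fun t x => Φ (sol.Γ x t)) S where
  smooth := by
    have h1 : ContDiff ℝ 3 fun p : ℝ × ℝ => (p.2, p.1) := by fun_prop
    have h2 : ContDiffOn ℝ 3 (fun p : ℝ × ℝ => sol.Γ p.2 p.1) (Ioo 0 S ×ˢ univ) :=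
      (sol.smooth.of_le (WithTop.coe_le_coe.2 (le_top (a := (3 : ℕ∞))))).comp h1.contDiffOn
        fun p hp => ⟨mem_univ _, hp.1⟩
    exact Φ.contDiff.comp_contDiffOn h2
  simple t ht := isSimpleClosed_slice Φ sol ht
  flow t ht x := by
    rw [← (isSimpleClosed_slice Φ sol ht).im_conj_curvature x, ← isometry_curvatureVector,
      ← sol.flow t ht x, ← deriv_isometry]
    rfl

lemma IsFlow.isLimitCurve {c : ℝ → ℝ → ℂ} {S t₀ : ℝ} (hc : IsFlow c S) (ht₀ : t₀ ∈ Ioo 0 S) :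
    IsLimitCurve c S t₀ (c t₀) where
  cont := (hc.simple t₀ ht₀).cont
  per := (hc.simple t₀ ht₀).per
  inj := (hc.simple t₀ ht₀).inj
  approx δ hδ := by
    have h1 : ∀ᶠ t in 𝓝 t₀, ∀ x ∈ Icc 0 (2 * π), dist (c t x) (c t₀ x) < δ := by
      refine isCompact_Icc.eventually_forall_of_forall_eventually
        (P := fun t x => dist (c t x) (c t₀ x) < δ) fun x _ => ?_
      have h2 := hc.continuousAt_uncurry ht₀ x
      have h3 : ContinuousAt (fun p : ℝ × ℝ => c t₀ p.2) (t₀, x) :=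
        (hc.simple t₀ ht₀).cont.continuousAt.comp continuousAt_snd
      have h4 := h2.dist h3
      exact h4.eventually (Iio_mem_nhds (by simpa using hδ))
    filter_upwards [mem_nhdsWithin_of_mem_nhds h1, self_mem_nhdsWithin] with t h2 ht
    refine ⟨c t, (hc.simple t ht).cont, rfl, fun θ => ?_⟩
    have hper : Function.Periodic (fun x => c t x - c t₀ x) (2 * π) := fun x => by
      simp only [(hc.simple t ht).per x, (hc.simple t₀ ht₀).per x]
    obtain ⟨y, hy, he⟩ := hper.exists_mem_Ico₀ (by positivity) θ
    rw [he, ← dist_eq_norm]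
    exact h2 y ⟨hy.1, hy.2.le⟩

lemma isQuotientMap_circleExp : Topology.IsQuotientMap Circle.exp :=
  isLocalHomeomorph_circleExp.isOpenMap.isQuotientMap Circle.exp.continuous
    fun z => ⟨_, Circle.exp_arg z⟩

lemma eq_of_circleExp_eq {x y : ℝ} (hxy : |x - y| < 2 * π) (h : Circle.exp x = Circle.exp y) :
    x = y := by
  obtain ⟨m, hm⟩ := Circle.exp_eq_exp.1 h
  have h2pi : (0 : ℝ) < 2 * π := by positivity
  rw [hm, add_sub_cancel_left, abs_mul, abs_of_pos h2pi] at hxy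
  have h7 : |(m : ℝ)| < 1 := by
    by_contra! h8
    nlinarith
  have h8 : m = 0 := by
    rw [← Int.abs_lt_one_iff]; exact_mod_cast h7
  simpa [h8] using hm

/-- A closed curve given by a periodic function is a curve parametrized by the circle. -/
lemma isParam_of_periodic {g : ℝ → E2} (hg : Continuous g) (hper : Function.Periodic g (2 * π))
    (hinj : ∀ x y, |x - y| < 2 * π → g x = g y → x = y) :
    IsParam (range g) fun z : Circle => g (Complex.arg z) := by
  have hcomp : ∀ x, g (Complex.arg (Circle.exp x)) = g x := by
    intro x
    obtain ⟨m, hm⟩ := Circle.exp_eq_exp.1 (Circle.exp_arg (Circle.exp x))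
    rw [hm]
    exact hper.int_mul m x
  refine ⟨?_, ?_, ?_⟩
  · rw [isQuotientMap_circleExp.continuous_iff]
    convert! hg using 1
    exact funext hcomp
  · intro z w h
    have h1 : |Complex.arg z - Complex.arg w| < 2 * π := by
      have := Complex.arg_mem_Ioc (z : ℂ)
      have := Complex.arg_mem_Ioc (w : ℂ)
      simp only [mem_Ioc] at *
      rw [abs_lt]; constructor <;> linarith
    have h2 := hinj _ _ h1 h
    rw [← Circle.exp_arg z, ← Circle.exp_arg w, h2]
  · refine Subset.antisymm ?_ ?_
    · rintro _ ⟨z, rfl⟩; exact mem_range_self _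
    · rintro _ ⟨x, rfl⟩; exact ⟨Circle.exp x, hcomp x⟩

/-- Two parametrizations of a curve differ by a change of parameter. -/
lemma exists_reparam {γ : Set E2} {φ ψ : Circle → E2} (hφ : IsParam γ φ)
    (hψ : IsParam γ ψ) : ∃ h : Circle → Circle, Continuous h ∧ Function.Surjective h ∧
      ∀ z, ψ (h z) = φ z := by
  let e := (hψ.1.isClosedEmbedding hψ.2.1).isEmbedding.toHomeomorph
  have hmem : ∀ z, φ z ∈ range ψ := fun z => by rw [hψ.2.2, ← hφ.2.2]; exact mem_range_self z
  have hval : ∀ z, ψ (e.symm ⟨φ z, hmem z⟩) = φ z := fun z =>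
    congrArg Subtype.val (e.apply_symm_apply ⟨φ z, hmem z⟩)
  refine ⟨fun z => e.symm ⟨φ z, hmem z⟩, e.symm.continuous.comp (hφ.1.subtype_mk _), fun w => ?_,
    hval⟩
  obtain ⟨z, hz⟩ : ψ w ∈ range φ := by rw [hφ.2.2, ← hψ.2.2]; exact mem_range_self w
  exact ⟨z, hψ.2.1 ((hval z).trans hz)⟩

lemma isLimitCurve_zero (sol : CurvatureFlowSolution γ S) {φ : Circle → E2} (hφ : IsParam γ φ) :
    IsLimitCurve (fun t x => Φ (sol.Γ x t)) S 0 fun θ => Φ (φ (Circle.exp θ)) where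
  cont := Φ.continuous.comp (hφ.1.comp Circle.exp.continuous)
  per θ := by
    have : Circle.exp (θ + 2 * π) = Circle.exp θ := Circle.exp_eq_exp.2 ⟨1, by simp⟩
    simp only [this]
  inj x y hxy h := eq_of_circleExp_eq hxy (hφ.2.1 (Φ.injective h))
  approx δ hδ := by
    have h1 : ∀ᶠ t in 𝓝[Ioo 0 S] 0, frechetDist (range fun x => sol.Γ x t) γ < δ :=
      (nhdsWithin_mono 0 Ioo_subset_Ioi_self) (sol.init.eventually (Iio_mem_nhds hδ))
    filter_upwards [h1, self_mem_nhdsWithin] with t h2 ht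
    have hsc := isSimpleClosed_slice Φ sol ht
    have hpar := isParam_of_periodic (g := fun x => sol.Γ x t)
      ((Φ.comp_continuous_iff (f := fun x => sol.Γ x t)).1 hsc.cont) (sol.periodic t)
      fun x y => eq_of_abs_sub_lt sol ht
    obtain ⟨_, ⟨φ₁, φ₂, hφ₁, hφ₂, rfl⟩, hlt⟩ := exists_lt_of_csInf_lt
      (s := {d : ℝ | ∃ φ₁ φ₂ : Circle → E2, IsParam (range fun x => sol.Γ x t) φ₁ ∧ IsParam γ φ₂ ∧
        d = ⨆ x : Circle, ‖φ₁ x - φ₂ x‖}) ⟨_, _, _, hpar, hφ, rfl⟩ h2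
    obtain ⟨h, hh, hsurj, hval⟩ := exists_reparam hφ hφ₂
    refine ⟨fun θ => Φ (φ₁ (h (Circle.exp θ))),
      Φ.continuous.comp (hφ₁.1.comp (hh.comp Circle.exp.continuous)), ?_, fun θ => ?_⟩
    · rw [show (fun θ => Φ (φ₁ (h (Circle.exp θ)))) = Φ ∘ φ₁ ∘ (h ∘ Circle.exp) from rfl,
        range_comp, (hsurj.comp isQuotientMap_circleExp.surjective).range_comp, hφ₁.2.2,
        ← range_comp]
      rfl
    · rw [← map_sub, Φ.norm_map, ← hval]
      have hb : BddAbove (range fun x => ‖φ₁ x - φ₂ x‖) :=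
        (isCompact_range (hφ₁.1.sub hφ₂.1).norm).bddAbove
      exact (le_ciSup hb (h (Circle.exp θ))).trans_lt hlt

/-- At each time, a curvature flow has a limit curve of measure zero. -/
lemma exists_isLimitCurve (hγ : IsJordanCurve γ) (hvol : volume γ = 0)
    (sol : CurvatureFlowSolution γ S) {t : ℝ} (ht : t ∈ Ico 0 S) :
    ∃ φ, IsLimitCurve (fun t x => Φ (sol.Γ x t)) S t φ ∧ range φ = Φ '' sol.cf t ∧
      volume (range φ) = 0 := by
  rcases ht.1.eq_or_lt with rfl | h0
  · obtain ⟨φ, hφ⟩ := hγ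
    have hr : range (fun θ => Φ (φ (Circle.exp θ))) = Φ '' γ := by
      rw [show (fun θ => Φ (φ (Circle.exp θ))) = Φ ∘ φ ∘ Circle.exp from rfl,
        range_comp, isQuotientMap_circleExp.surjective.range_comp, hφ.2.2]
    refine ⟨_, isLimitCurve_zero Φ sol hφ, ?_, ?_⟩
    · rw [hr, CurvatureFlowSolution.cf, if_pos rfl]
    · rw [hr, Φ.image_eq_preimage_symm]
      exact Φ.symm.measurePreserving.quasiMeasurePreserving.preimage_null hvol
  · refine ⟨_, (isFlow Φ sol).isLimitCurve ⟨h0, ht.2⟩, ?_,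
      (isSimpleClosed_slice Φ sol ⟨h0, ht.2⟩).volume_range⟩
    rw [CurvatureFlowSolution.cf, if_neg h0.ne', ← range_comp]
    rfl

end PlaneCurve

/-- Lemma 2.4, existence and uniqueness: if `γ` and `η` intersect at
exactly two points and the two intersection points of the evolving curves have not merged
before time `Tstar`, then for each initial intersection point `x` there is a unique
continuous trajectory of intersection points starting at `x`. -/
theorem intersection_trajectory_unique
    (S : ℝ) (hS : 0 < S)
    (γ η : Set E2) (hγ : IsJordanCurve γ) (hη : IsJordanCurve η)
    (hvolγ : volume γ = 0) (hvolη : volume η = 0)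
    (htwo₀ : HasTwoPoints (γ ∩ η))
    (solγ : CurvatureFlowSolution γ S) (solη : CurvatureFlowSolution η S)
    (x : E2) (hx : x ∈ γ ∩ η)
    (Tstar : ℝ) (hTstar : Tstar ∈ Ioc (0 : ℝ) S)
    (htwo : ∀ t ∈ Ico (0 : ℝ) Tstar, HasTwoPoints (solγ.cf t ∩ solη.cf t)) :
    ∃! p : Ico (0 : ℝ) Tstar → E2, Continuous p ∧
      p ⟨0, le_refl 0, hTstar.1⟩ = x ∧
      ∀ t : Ico (0 : ℝ) Tstar, p t ∈ solγ.cf t ∩ solη.cf t := by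
  have hT0 : (0 : ℝ) < Tstar := hTstar.1
  set Φ : E2 ≃ₗᵢ[ℝ] ℂ := Complex.orthonormalBasisOneI.repr.symm
  have hcf : ∀ t ∈ Ioo 0 S, range (fun x => Φ (solγ.Γ x t)) ∩ range (fun x => Φ (solη.Γ x t)) =
      Φ '' (solγ.cf t ∩ solη.cf t) := by
    intro t ht
    rw [image_inter Φ.injective, CurvatureFlowSolution.cf, CurvatureFlowSolution.cf,
      if_neg ht.1.ne', if_neg ht.1.ne', ← range_comp, ← range_comp]
    rfl
  have h2 : ∀ t ∈ Ico 0 Tstar, ∃ P Q, P ≠ Q ∧ Φ '' (solγ.cf t ∩ solη.cf t) = {P, Q} := by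
    intro t ht
    obtain ⟨P, Q, hPQ, h⟩ := htwo t ht
    exact ⟨Φ P, Φ Q, Φ.injective.ne hPQ, by rw [h, image_pair]⟩
  have hlsc : ∀ t₀ : Ico 0 Tstar, ∀ b ∈ Φ '' (solγ.cf t₀ ∩ solη.cf t₀), ∀ ε > 0,
      ∀ᶠ t : Ico 0 Tstar in nhds t₀, ∃ z ∈ Φ '' (solγ.cf t ∩ solη.cf t), dist z b < ε := by
    rintro ⟨t₀, ht₀⟩ b hb ε hε
    have ht₀' : t₀ ∈ Ico 0 S := ⟨ht₀.1, ht₀.2.trans_le hTstar.2⟩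
    obtain ⟨φ, hφ, hφr, hφ0⟩ := PlaneCurve.exists_isLimitCurve Φ hγ hvolγ solγ ht₀'
    obtain ⟨ψ, hψ, hψr, hψ0⟩ := PlaneCurve.exists_isLimitCurve Φ hη hvolη solη ht₀'
    obtain ⟨a, hab, hX⟩ : ∃ a, a ≠ b ∧ Φ '' (solγ.cf t₀ ∩ solη.cf t₀) = {a, b} := by
      obtain ⟨P, Q, hPQ, h⟩ := h2 t₀ ht₀
      rw [h] at hb
      rcases hb with rfl | rfl
      · exact ⟨Q, hPQ.symm, h.trans (pair_comm _ _)⟩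
      · exact ⟨P, hPQ, h⟩
    have hev := (PlaneCurve.isFlow Φ solγ).eventually_exists_mem (PlaneCurve.isFlow Φ solη) hTstar.2
      (fun t ht => by
        rw [hcf t ⟨ht₀.1.trans_lt ht.1, ht.2.trans_le hTstar.2⟩]
        exact h2 t ⟨ht₀.1.trans ht.1.le, ht.2⟩)
      ht₀ hφ hψ hφ0 hψ0 hab (by rw [hφr, hψr, ← image_inter Φ.injective, hX]) hε
    rw [eventually_nhdsWithin_iff] at hev
    have hpos : ∀ᶠ t : Ico 0 Tstar in nhds ⟨t₀, ht₀⟩, (t : ℝ) = 0 → t₀ = 0 := by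
      rcases ht₀.1.eq_or_lt with h | h
      · exact Eventually.of_forall fun _ _ => h.symm
      · filter_upwards [(continuous_subtype_val.continuousAt
          (x := (⟨t₀, ht₀⟩ : Ico 0 Tstar))).eventually (lt_mem_nhds h)] with t ht h0
        exact absurd h0 ht.ne'
    filter_upwards [continuous_subtype_val.continuousAt.eventually hev, hpos] with t ht htp
    rcases t.2.1.eq_or_lt with h | h
    · refine ⟨b, ?_, by simpa using hε⟩
      rw [← h, ← htp h.symm]
      exact hb
    · have htS : (t : ℝ) ∈ Ioo 0 S := ⟨h, t.2.2.trans_le hTstar.2⟩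
      rw [← hcf t htS]
      exact ht htS
  have hx0 : Φ x ∈ Φ '' (solγ.cf (0 : ℝ) ∩ solη.cf (0 : ℝ)) := by
    refine mem_image_of_mem _ ?_
    simpa [CurvatureFlowSolution.cf] using hx
  obtain ⟨p, ⟨hpc, hp0, hpm⟩, huniq⟩ := PlaneCurve.existsUnique_selection hT0
    (X := fun t : Ico 0 Tstar => Φ '' (solγ.cf t ∩ solη.cf t)) (fun t => h2 t t.2) hlsc hx0
  refine ⟨fun t => Φ.symm (p t), ⟨Φ.symm.continuous.comp hpc, ?_, fun t => ?_⟩, ?_⟩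
  · simp only [hp0, Φ.symm_apply_apply]
  · obtain ⟨y, hy, he⟩ := hpm t
    simpa only [← he, Φ.symm_apply_apply] using hy
  · rintro q ⟨hqc, hq0, hqm⟩
    have h := huniq (fun t => Φ (q t))
      ⟨Φ.continuous.comp hqc, by simp only [hq0], fun t => mem_image_of_mem _ (hqm t)⟩
    funext t
    rw [← h, Φ.symm_apply_apply]

end
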